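/- Let (Ω,Σ,μ) be a complete and saturated finite measure space and X a separable Asplund space. Let φ: X × Ω → ℝ be such that φ(·,ω) is Lipschitz continuous on a neighborhood U of x̄ for every ω ∈ Ω with a μ-integrable Lipschitz modulus uniform on U, φ(x,·) is measurable and μ-integrable for every x ∈ U, and ω ↦ ∂φ(x̄,ω) is w*-scalarly measurable. Then ∂I_φ(x̄) ⊂ ∫ ∂φ(x̄,ω) dμ = ∫ ∂°φ(x̄,ω) dμ (Gelfand integrals, with no closure operation), where I_φ(x) := ∫ φ(x,ω) dμ; moreover, the first inclusion holds as equality provided φ(·,ω) is regular at x̄ for every ω ∈ Ω. -/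

import Mathlib

open MeasureTheory Filter Topology Metric Set Pointwise
open scoped NNReal ENNReal

noncomputable section

universe u v

namespace Paper

section Defs

variable {X : Type u} [NormedAddCommGroup X] [NormedSpace ℝ X]
variable {Ω : Type v} [MeasurableSpace Ω]

/-- The identity map from the (strong) dual to the dual endowed with the weak* topology. -/
def wstar : (X →L[ℝ] ℝ) → WeakDual ℝ X := fun φ => φ

/-- Support function `s(x,C)` of a set `C ⊆ X*`. -/
def supp (x : X) (C : Set (X →L[ℝ] ℝ)) : ℝ :=
  sSup ((fun φ : X →L[ℝ] ℝ => φ x) '' C)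

/-- `f` is Gelfand integrable: all scalarizations are integrable and the scalar
integrals are represented by a continuous linear functional. -/
def GelfandIntegrable (μ : Measure Ω) (f : Ω → X →L[ℝ] ℝ) : Prop :=
  (∀ x : X, Integrable (fun ω => f ω x) μ) ∧
    ∃ g : X →L[ℝ] ℝ, ∀ x : X, g x = ∫ ω, f ω x ∂μ

/-- The set `S¹_Γ` of Gelfand-integrable a.e. selectors of `Γ`. -/
def selectors (μ : Measure Ω) (Γ : Ω → Set (X →L[ℝ] ℝ)) : Set (Ω → X →L[ℝ] ℝ) :=
  { f | GelfandIntegrable μ f ∧ ∀ᵐ ω ∂μ, f ω ∈ Γ ω }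

/-- The Gelfand integral `I(Γ) = { ∫ f dμ : f ∈ S¹_Γ }` of a multifunction. -/
def gelfandIntegral (μ : Measure Ω) (Γ : Ω → Set (X →L[ℝ] ℝ)) : Set (X →L[ℝ] ℝ) :=
  { g | ∃ f ∈ selectors μ Γ, ∀ x : X, g x = ∫ ω, f ω x ∂μ }

/-- The set `S^{1,w*}_Γ` of Gelfand-integrable w*-almost selectors of `Γ`. -/
def almostSelectors (μ : Measure Ω) (Γ : Ω → Set (X →L[ℝ] ℝ)) : Set (Ω → X →L[ℝ] ℝ) :=
  { f | GelfandIntegrable μ f ∧ ∀ x : X, ∀ᵐ ω ∂μ, f ω x ≤ supp x (Γ ω) }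

/-- `Γ` is w*-scalarly measurable. -/
def WScalarlyMeasurable (Γ : Ω → Set (X →L[ℝ] ℝ)) : Prop :=
  ∀ x : X, Measurable fun ω => supp x (Γ ω)

/-- `Γ` is w*-scalarly integrable. -/
def WScalarlyIntegrable (μ : Measure Ω) (Γ : Ω → Set (X →L[ℝ] ℝ)) : Prop :=
  ∀ x : X, Integrable (fun ω => supp x (Γ ω)) μ

/-- `Γ` is integrably bounded. -/
def IntegrablyBounded (μ : Measure Ω) (Γ : Ω → Set (X →L[ℝ] ℝ)) : Prop :=
  ∃ ψ : Ω → ℝ, Integrable ψ μ ∧ ∀ ω : Ω, ∀ φ ∈ Γ ω, ‖φ‖ ≤ ψ ω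

/-- `C ⊆ X*` is weak*-closed. -/
def WStarClosed (C : Set (X →L[ℝ] ℝ)) : Prop := IsClosed (wstar '' C)

/-- `C ⊆ X*` is weak*-compact. -/
def WStarCompact (C : Set (X →L[ℝ] ℝ)) : Prop := IsCompact (wstar '' C)

/-- Weak*-closure of `C ⊆ X*`. -/
def wstarClosure (C : Set (X →L[ℝ] ℝ)) : Set (X →L[ℝ] ℝ) :=
  wstar ⁻¹' closure (wstar '' C)

/-- Weak*-closed convex hull of `C ⊆ X*`. -/
def wstarClosedConvexHull (C : Set (X →L[ℝ] ℝ)) : Set (X →L[ℝ] ℝ) :=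
  wstar ⁻¹' closure (convexHull ℝ (wstar '' C))

/-- `Y` is an Asplund space: every continuous convex real function on an open convex
set is Fréchet differentiable on a dense subset of that set. -/
def Asplund (Y : Type*) [NormedAddCommGroup Y] [NormedSpace ℝ Y] : Prop :=
  ∀ U : Set Y, IsOpen U → Convex ℝ U →
    ∀ f : Y → ℝ, ContinuousOn f U → ConvexOn ℝ U f →
      U ⊆ closure { y | y ∈ U ∧ ∃ f' : Y →L[ℝ] ℝ, HasFDerivWithinAt f f' U y }

/-- `μ` is a nonatomic measure. -/
def Nonatomic (μ : Measure Ω) : Prop :=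
  ∀ A : Set Ω, MeasurableSet A → 0 < μ A →
    ∃ B : Set Ω, MeasurableSet B ∧ B ⊆ A ∧ 0 < μ B ∧ μ B < μ A

/-- `μ` is a saturated measure: `L¹` of every positive-measure restriction is nonseparable. -/
def Saturated (μ : Measure Ω) : Prop :=
  ∀ E : Set Ω, MeasurableSet E → 0 < μ E →
    ¬ TopologicalSpace.SeparableSpace (Lp ℝ 1 (μ.restrict E))

/-- `dens(Y)`: smallest cardinality of a dense subset of the open unit ball of `Y`. -/
def densCard (Y : Type u) [NormedAddCommGroup Y] : Cardinal.{u} :=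
  sInf { c : Cardinal.{u} |
    ∃ D : Set Y, D ⊆ ball (0 : Y) 1 ∧ ball (0 : Y) 1 ⊆ closure D ∧ Cardinal.mk ↥D = c }

/-- `dens(Y) < κ(μ)`: every family of `μ`-null measurable sets of cardinality at most
`dens(Y)` has measurable union. -/
def DensLtAdditivity (Y : Type u) [NormedAddCommGroup Y] (μ : Measure Ω) : Prop :=
  ∀ 𝒞 : Set (Set Ω), (∀ A ∈ 𝒞, MeasurableSet A ∧ μ A = 0) →
    Cardinal.lift.{u} (Cardinal.mk ↥𝒞) ≤ Cardinal.lift.{v} (densCard Y) →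
    MeasurableSet (⋃₀ 𝒞)

/-- Clarke generalized directional derivative `ψ°(x̄;h)`. -/
def clarkeDD (ψ : X → ℝ) (xbar h : X) : ℝ :=
  limsup (fun p : X × ℝ => (ψ (p.1 + p.2 • h) - ψ p.1) / p.2) ((𝓝 xbar) ×ˢ (𝓝[>] (0 : ℝ)))

/-- Clarke generalized gradient `∂°ψ(x̄)`. -/
def clarkeSubdiff (ψ : X → ℝ) (xbar : X) : Set (X →L[ℝ] ℝ) :=
  { φ | ∀ h : X, φ h ≤ clarkeDD ψ xbar h }

/-- `ψ` is (Clarke) regular at `x̄`: the directional derivative exists and equals `ψ°`. -/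
def ClarkeRegularAt (ψ : X → ℝ) (xbar : X) : Prop :=
  ∀ h : X, Tendsto (fun θ : ℝ => (ψ (xbar + θ • h) - ψ xbar) / θ) (𝓝[>] (0 : ℝ))
    (𝓝 (clarkeDD ψ xbar h))

/-- Limiting (Mordukhovich) subdifferential `∂ψ(x̄)`. -/
def limitingSubdiff (ψ : X → ℝ) (xbar : X) : Set (X →L[ℝ] ℝ) :=
  { p | ∃ (xk : ℕ → X) (pk : ℕ → X →L[ℝ] ℝ),
      Tendsto xk atTop (𝓝 xbar) ∧
      (∀ z : X, Tendsto (fun k => pk k z) atTop (𝓝 (p z))) ∧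
      ∀ k : ℕ, 0 ≤ liminf
        (fun y => (ψ y - ψ (xk k) - pk k (y - xk k)) / ‖y - xk k‖) (𝓝[≠] (xk k)) }

/-- Clarke generalized normal cone `N°(z̄;C)`. -/
def clarkeNormalCone (C : Set X) (zbar : X) : Set (X →L[ℝ] ℝ) :=
  wstarClosure (⋃ α ∈ Ioi (0 : ℝ), α • clarkeSubdiff (fun z => infDist z C) zbar)

/-- Limiting normal cone `N(z̄;C)`. -/
def limitingNormalCone (C : Set X) (zbar : X) : Set (X →L[ℝ] ℝ) :=
  ⋃ α ∈ Ioi (0 : ℝ), α • limitingSubdiff (fun z => infDist z C) zbar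

/-- A multifunction is lower semicontinuous. -/
def LowerSC {Y : Type*} [TopologicalSpace Y] {Z : Type*} [TopologicalSpace Z]
    (F : Y → Set Z) : Prop :=
  ∀ U : Set Z, IsOpen U → IsOpen { y | (F y ∩ U).Nonempty }

/-- A multifunction is upper semicontinuous. -/
def UpperSC {Y : Type*} [TopologicalSpace Y] {Z : Type*} [TopologicalSpace Z]
    (F : Y → Set Z) : Prop :=
  ∀ U : Set Z, IsOpen U → IsOpen { y | F y ⊆ U }

/-- `P` is a stochastic kernel (transition probability). -/
def StochasticKernel (P : Ω → Measure Ω) : Prop :=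
  (∀ ω, IsProbabilityMeasure (P ω)) ∧
    ∀ A : Set Ω, MeasurableSet A → Measurable fun ω => P ω A

/-- `v` is a bounded Carathéodory solution of the Bellman equation, the minimum
over `Γ x ω` being attained. -/
def BellmanSolution (P : Ω → Measure Ω) (β : ℝ) (u : X → X → Ω → ℝ)
    (Γ : X → Ω → Set X) (v : X → Ω → ℝ) : Prop :=
  (∃ M : ℝ, ∀ x ω, |v x ω| ≤ M) ∧
  (∀ ω, Continuous fun x => v x ω) ∧
  (∀ x, Measurable fun ω => v x ω) ∧
  ∀ x ω,
    (∃ y ∈ Γ x ω, v x ω = u x y ω + β * ∫ ω', v y ω' ∂(P ω)) ∧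
    ∀ y ∈ Γ x ω, v x ω ≤ u x y ω + β * ∫ ω', v y ω' ∂(P ω)

/-- The policy multifunction `G(x,ω)` associated with a Bellman solution `v`. -/
def policyMap (P : Ω → Measure Ω) (β : ℝ) (u : X → X → Ω → ℝ)
    (Γ : X → Ω → Set X) (v : X → Ω → ℝ) (x : X) (ω : Ω) : Set X :=
  { y ∈ Γ x ω | v x ω = u x y ω + β * ∫ ω', v y ω' ∂(P ω) }

/-- Standing assumptions (H1), (H2) on the stochastic DP problem. -/
def DPStandingAssumptions [MeasurableSpace X] (P : Ω → Measure Ω) (β : ℝ)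
    (u : X → X → Ω → ℝ) (Γ : X → Ω → Set X) : Prop :=
  StochasticKernel P ∧ 0 ≤ β ∧ β < 1 ∧
  (∃ M : ℝ, ∀ x y ω, |u x y ω| ≤ M) ∧
  (∀ ω, Continuous fun p : X × X => u p.1 p.2 ω) ∧
  (∀ x y, Measurable fun ω => u x y ω) ∧
  (∀ x ω, (Γ x ω).Nonempty ∧ IsCompact (Γ x ω)) ∧
  (∀ U : Set X, IsOpen U → MeasurableSet { p : X × Ω | (Γ p.1 p.2 ∩ U).Nonempty }) ∧
  (∀ ω, LowerSC (fun x => Γ x ω) ∧ UpperSC (fun x => Γ x ω)) ∧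
  (∀ x, ∀ U : Set X, IsOpen U → MeasurableSet { ω | (Γ x ω ∩ U).Nonempty })

/-- `G` is locally lower viable around `x̄` (relative to `Γ`). -/
def LocLowerViable (G Γ : X → Ω → Set X) (xbar : X) : Prop :=
  ∀ ω, ∃ U ∈ 𝓝 xbar, ∀ x ∈ U, ∀ x' ∈ U, (G x ω ∩ Γ x' ω).Nonempty

/-- `G` is locally upper viable around `x̄` (relative to `Γ`). -/
def LocUpperViable (G Γ : X → Ω → Set X) (xbar : X) : Prop :=
  ∀ ω, ∃ U ∈ 𝓝 xbar, ∀ x ∈ U, ∀ x' ∈ U, G x ω ⊆ Γ x' ω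

end Defs

section SeparableDual

variable {X : Type u} [NormedAddCommGroup X] [NormedSpace ℝ X]

/-- A metric space without a countable dense subset has an uncountable `ε`-separated subset. -/
lemma exists_uncountable_separated {E : Type*} [PseudoMetricSpace E]
    (h : ¬ SecondCountableTopology E) :
    ∃ ε > (0 : ℝ), ∃ A : Set E, ¬ A.Countable ∧ A.Pairwise fun a b => ε < dist a b := by
  have h1 : ¬ ∀ ε > (0 : ℝ), ∃ s : Set E, s.Countable ∧ ∀ x, ∃ y ∈ s, dist x y ≤ ε :=
    fun H => h (Metric.secondCountable_of_almost_dense_set H)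
  push Not at h1
  obtain ⟨ε, hε, H⟩ := h1
  obtain ⟨A, hA⟩ := zorn_subset {A : Set E | A.Pairwise fun a b => ε < dist a b} (by
    intro c hc hchain
    refine ⟨⋃₀ c, ?_, fun s hs => subset_sUnion_of_mem hs⟩
    exact (pairwise_sUnion hchain.directedOn).2 fun s hs => hc hs)
  refine ⟨ε, hε, A, fun hcount => ?_, hA.prop⟩
  obtain ⟨x, hx⟩ := H A hcount
  have hins : insert x A ∈ {A : Set E | A.Pairwise fun a b => ε < dist a b} := by
    refine (Set.pairwise_insert).2 ⟨hA.prop, fun b hb _ => ⟨hx b hb, ?_⟩⟩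
    rw [dist_comm]; exact hx b hb
  have hxA : x ∈ A := hA.le_of_ge hins (subset_insert _ _) (mem_insert _ _)
  have := hx x hxA
  rw [dist_self] at this
  linarith

/-- The support function of a nonempty bounded set is convex and continuous. -/
lemma convexOn_continuous_iSup_apply {A : Set (X →L[ℝ] ℝ)} (hne : A.Nonempty) {R : ℝ}
    (hR : ∀ a ∈ A, ‖a‖ ≤ R) :
    ConvexOn ℝ univ (fun y : X => ⨆ a : A, (a : X →L[ℝ] ℝ) y) ∧
      Continuous (fun y : X => ⨆ a : A, (a : X →L[ℝ] ℝ) y) := by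
  have : Nonempty A := hne.to_subtype
  have hbdd : ∀ y : X, BddAbove (range fun a : A => (a : X →L[ℝ] ℝ) y) := by
    intro y
    refine ⟨R * ‖y‖, ?_⟩
    rintro _ ⟨a, rfl⟩
    exact (le_abs_self _).trans (((a : X →L[ℝ] ℝ).le_opNorm y).trans
      (mul_le_mul_of_nonneg_right (hR a a.2) (norm_nonneg _)))
  have hR0 : 0 ≤ R := (norm_nonneg _).trans (hR _ hne.some_mem)
  constructor
  · refine ⟨convex_univ, fun x _ y _ s t hs ht _ => ciSup_le fun a => ?_⟩
    simp only [map_add, map_smul, smul_eq_mul]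
    exact add_le_add (mul_le_mul_of_nonneg_left (le_ciSup (hbdd x) a) hs)
      (mul_le_mul_of_nonneg_left (le_ciSup (hbdd y) a) ht)
  · have : LipschitzWith R.toNNReal (fun y : X => ⨆ a : A, (a : X →L[ℝ] ℝ) y) := by
      refine LipschitzWith.of_le_add_mul _ fun x y => ciSup_le fun a => ?_
      rw [Real.coe_toNNReal _ hR0, dist_eq_norm]
      have h1 := le_ciSup (hbdd y) a
      have h2 : (a : X →L[ℝ] ℝ) (x - y) ≤ R * ‖x - y‖ :=
        (le_abs_self _).trans (((a : X →L[ℝ] ℝ).le_opNorm _).trans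
          (mul_le_mul_of_nonneg_right (hR a a.2) (norm_nonneg _)))
      rw [map_sub] at h2
      linarith
    exact this.continuous

/-- Šmulian's criterion: at a point of Fréchet differentiability of a support function, slices
have small diameter. -/
lemma exists_slice_norm_le {A : Set (X →L[ℝ] ℝ)} {R : ℝ} (hR : ∀ a ∈ A, ‖a‖ ≤ R)
    {y : X} {f' : X →L[ℝ] ℝ} (hf' : HasFDerivAt (fun y : X => ⨆ a : A, (a : X →L[ℝ] ℝ) y) f' y)
    {η : ℝ} (hη : 0 < η) :
    ∃ δ > 0, ∀ a ∈ A, (⨆ a : A, (a : X →L[ℝ] ℝ) y) - δ < a y → ‖a - f'‖ ≤ η := by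
  have hbdd : ∀ y : X, BddAbove (range fun a : A => (a : X →L[ℝ] ℝ) y) := by
    intro y
    refine ⟨R * ‖y‖, ?_⟩
    rintro _ ⟨a, rfl⟩
    exact (le_abs_self _).trans (((a : X →L[ℝ] ℝ).le_opNorm y).trans
      (mul_le_mul_of_nonneg_right (hR a a.2) (norm_nonneg _)))
  have h1 := hasFDerivAt_iff_isLittleO_nhds_zero.1 hf'
  have h2 := h1.def (half_pos hη)
  obtain ⟨r, hr, hball⟩ := Metric.eventually_nhds_iff_ball.1 h2
  refine ⟨η / 2 * (r / 2), by positivity, fun a ha hay => ?_⟩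
  refine ContinuousLinearMap.opNorm_le_of_shell (ε := r) hr hη.le (c := (2 : ℝ)) (by simp) ?_
  intro h hh1 hh2
  have hh1' : r / 2 ≤ ‖h‖ := by simpa using hh1
  have key : ∀ h : X, r / 2 ≤ ‖h‖ → ‖h‖ < r → (a - f') h ≤ η * ‖h‖ := by
    intro h hh1 hh2
    have h3 := hball h (by simpa using hh2)
    have h4 : a y + a h ≤ ⨆ a : A, (a : X →L[ℝ] ℝ) (y + h) := by
      rw [← map_add]
      exact le_ciSup (hbdd (y + h)) ⟨a, ha⟩
    have h5 := (le_abs_self _).trans h3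
    rw [sub_apply]
    nlinarith
  rw [Real.norm_eq_abs, abs_le]
  refine ⟨?_, key h hh1' hh2⟩
  have := key (-h) (by simpa using hh1') (by simpa using hh2)
  rw [map_neg, norm_neg] at this
  linarith

/-- Every slice of a suitable uncountable subset of a bounded uncountable set of functionals on a
separable space has two points. -/
lemma exists_subset_slices_nontrivial [TopologicalSpace.SeparableSpace X]
    {A : Set (X →L[ℝ] ℝ)} (hA : ¬ A.Countable) {R : ℝ} (hR : ∀ a ∈ A, ‖a‖ ≤ R) :
    ∃ B ⊆ A, B.Nonempty ∧ ∀ x : X, ∀ t : ℝ, (∃ a ∈ B, t < a x) →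
      {a | a ∈ B ∧ t < a x}.Nontrivial := by
  obtain ⟨D, hDc, hD⟩ := TopologicalSpace.exists_countable_dense X
  let S : X → ℚ → Set (X →L[ℝ] ℝ) := fun x t => {a | a ∈ A ∧ (t : ℝ) < a x}
  let N : Set (X →L[ℝ] ℝ) := ⋃ x ∈ D, ⋃ t : ℚ, ⋃ _ : (S x t).Countable, S x t
  have hN : N.Countable := hDc.biUnion fun x _ => countable_iUnion fun t =>
    countable_iUnion fun h => h
  have hdiff : ∀ C ⊆ A, ¬ C.Countable → ¬ (C \ N).Countable := fun C _ hC h =>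
    hC ((h.union hN).mono fun a ha => by
      by_cases haN : a ∈ N
      · exact Or.inr haN
      · exact Or.inl ⟨ha, haN⟩)
  refine ⟨A \ N, sdiff_subset, ?_, ?_⟩
  · by_contra hne
    rw [not_nonempty_iff_eq_empty] at hne
    exact hdiff A subset_rfl hA (hne ▸ countable_empty)
  · rintro x t ⟨a, ⟨haA, haN⟩, hat⟩
    have hR0 : 0 ≤ R := (norm_nonneg _).trans (hR _ haA)
    set γ := (a x - t) / 4 with hγ
    have hγ0 : 0 < γ := by rw [hγ]; linarith
    obtain ⟨x', hx'D, hx'⟩ := hD.exists_dist_lt x (show 0 < γ / (R + 1) by positivity)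
    have hclose : ∀ b ∈ A, |b x - b x'| ≤ γ := by
      intro b hb
      rw [← map_sub]
      refine (b.le_opNorm _).trans ?_
      rw [← dist_eq_norm]
      calc ‖b‖ * dist x x' ≤ (R + 1) * (γ / (R + 1)) := by
            gcongr
            linarith [hR b hb]
        _ = γ := by field_simp
    obtain ⟨q, hq1, hq2⟩ := exists_rat_btwn (show t + γ < a x' by
      have := (abs_le.1 (hclose a haA)).2
      linarith)
    have hSsub : S x' q ⊆ {b | b ∈ A ∧ t < b x} := by
      rintro b ⟨hb, hbq⟩
      refine ⟨hb, ?_⟩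
      have := (abs_le.1 (hclose b hb)).1
      linarith
    have hunc : ¬ (S x' q).Countable := by
      intro hc
      exact haN (mem_biUnion hx'D (mem_iUnion₂.2 ⟨q, hc, haA, hq2⟩))
    have h2 := hdiff (S x' q) (fun b hb => hb.1) hunc
    have h3 : (S x' q \ N).Nontrivial := by
      by_contra h
      exact h2 (not_nontrivial_iff.1 h).countable
    exact h3.mono fun b hb => ⟨⟨hb.1.1, hb.2⟩, (hSsub hb.1).2⟩

/-- The dual of a separable Asplund space is separable. -/
theorem separableSpace_dual_of_asplund [TopologicalSpace.SeparableSpace X] (hX : Asplund X) :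
    TopologicalSpace.SeparableSpace (X →L[ℝ] ℝ) := by
  by_contra hsep
  have hsc : ¬ SecondCountableTopology (X →L[ℝ] ℝ) := fun h => hsep inferInstance
  obtain ⟨ε, hε, A, hA, hpair⟩ := exists_uncountable_separated hsc
  obtain ⟨n, hn⟩ : ∃ n : ℕ, ¬ (A ∩ closedBall 0 n).Countable := by
    by_contra! h
    refine hA ((countable_iUnion h).mono fun a ha => ?_)
    obtain ⟨n, hn⟩ := exists_nat_ge ‖a‖
    exact mem_iUnion.2 ⟨n, ha, by simpa using hn⟩
  have hR : ∀ a ∈ A ∩ closedBall 0 (n : ℝ), ‖a‖ ≤ n := fun a ha => by simpa using ha.2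
  obtain ⟨B, hBA, hBne, hB⟩ := exists_subset_slices_nontrivial hn hR
  have hRB : ∀ a ∈ B, ‖a‖ ≤ n := fun a ha => hR a (hBA ha)
  obtain ⟨hconv, hcont⟩ := convexOn_continuous_iSup_apply hBne hRB
  have h0 := hX univ isOpen_univ convex_univ _ hcont.continuousOn hconv (mem_univ (0 : X))
  obtain ⟨y, -, -, f', hf'⟩ := mem_closure_iff_nhds.1 h0 univ univ_mem
  rw [hasFDerivWithinAt_univ] at hf'
  obtain ⟨δ, hδ, hslice⟩ := exists_slice_norm_le hRB hf' (show 0 < ε / 2 by positivity)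
  have : Nonempty B := hBne.to_subtype
  obtain ⟨a, ha⟩ := exists_lt_of_lt_ciSup
    (show (⨆ a : B, (a : X →L[ℝ] ℝ) y) - δ < ⨆ a : B, (a : X →L[ℝ] ℝ) y by linarith)
  obtain ⟨b, hb, c, hc, hbc⟩ := hB y _ ⟨a, a.2, ha⟩
  have h1 := hslice b hb.1 hb.2
  have h2 := hslice c hc.1 hc.2
  have h3 : ε < dist b c := hpair (hBA hb.1).1 (hBA hc.1).1 hbc
  rw [dist_eq_norm] at h3
  have h4 : ‖b - c‖ ≤ ‖b - f'‖ + ‖c - f'‖ := by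
    have := norm_sub_le (b - f') (c - f')
    simpa using this
  linarith

end SeparableDual

section SmoothGauge

variable {X : Type u} [NormedAddCommGroup X] [NormedSpace ℝ X]

lemma eventually_lt_norm_restrict {ι : Type*} {l : Filter ι} {p : ι → X →L[ℝ] ℝ} {q : X →L[ℝ] ℝ}
    (hw : ∀ x, Tendsto (fun j => p j x) l (𝓝 (q x))) (Y : Submodule ℝ X) {c : ℝ}
    (hc : c < ‖q.comp Y.subtypeL‖) : ∀ᶠ j in l, c < ‖(p j).comp Y.subtypeL‖ := by
  by_cases hc0 : c < 0
  · exact Eventually.of_forall fun j => hc0.trans_le (ContinuousLinearMap.opNorm_nonneg _)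
  push Not at hc0
  obtain ⟨y, hy⟩ : ∃ y : Y, c * ‖y‖ < ‖q y‖ := by
    by_contra! h
    exact absurd (ContinuousLinearMap.opNorm_le_bound _ hc0 h) (not_le.2 hc)
  filter_upwards [(hw y).norm.eventually_const_lt hy] with j hj
  by_contra! h
  have h1 := ((p j).comp Y.subtypeL).le_opNorm y
  have h2 : ‖(p j).comp Y.subtypeL‖ * ‖y‖ ≤ c * ‖y‖ :=
    mul_le_mul_of_nonneg_right h (norm_nonneg _)
  exact absurd (h1.trans h2) (not_le.2 hj)

lemma eventually_lt_tsum {ι : Type*} {l : Filter ι} {g : ℕ → ι → ℝ} {G : ℕ → ℝ}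
    (hg0 : ∀ n j, 0 ≤ g n j) (hG : Summable G) (hg : ∀ j, Summable fun n => g n j)
    (hlsc : ∀ n, ∀ c < G n, ∀ᶠ j in l, c < g n j) {c : ℝ} (hc : c < ∑' n, G n) :
    ∀ᶠ j in l, c < ∑' n, g n j := by
  obtain ⟨s, hs⟩ := (hG.hasSum.eventually_const_lt hc).exists
  set δ := (∑ n ∈ s, G n - c) / (s.card + 1) with hδ
  have hδ0 : 0 < δ := div_pos (by linarith) (by positivity)
  have h1 : ∀ᶠ j in l, ∀ n ∈ s, G n - δ < g n j :=
    (s.eventually_all).2 fun n _ => hlsc n _ (by linarith)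
  filter_upwards [h1] with j hj
  have h2 : ∑ n ∈ s, (G n - δ) ≤ ∑ n ∈ s, g n j := Finset.sum_le_sum fun n hn => (hj n hn).le
  have h3 : ∑ n ∈ s, g n j ≤ ∑' n, g n j := (hg j).sum_le_tsum s fun n _ => hg0 n j
  rw [Finset.sum_sub_distrib, Finset.sum_const, nsmul_eq_mul] at h2
  have h4 : δ * (s.card + 1) = ∑ n ∈ s, G n - c := by rw [hδ]; field_simp
  nlinarith

lemma eventually_term_lt {ι : Type*} {l : Filter ι} {g : ℕ → ι → ℝ} {G : ℕ → ℝ}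
    (hg0 : ∀ n j, 0 ≤ g n j) (hG0 : ∀ n, 0 ≤ G n)
    (hG : Summable G) (hg : ∀ j, Summable fun n => g n j)
    (hlsc : ∀ n, ∀ c < G n, ∀ᶠ j in l, c < g n j)
    (hlim : ∀ η > 0, ∀ᶠ j in l, ∑' n, g n j < ∑' n, G n + η) (n : ℕ) {η : ℝ} (hη : 0 < η) :
    ∀ᶠ j in l, g n j < G n + η := by
  have hG1 := hG.tsum_eq_add_tsum_ite n
  have hsub : ∀ f : ℕ → ℝ, (∀ n, 0 ≤ f n) → Summable f →
      Summable fun m => if m = n then 0 else f m := by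
    intro f hf0 hf
    refine hf.of_nonneg_of_le (fun m => ?_) fun m => ?_ <;> split_ifs <;> simp [hf0]
  have h1 : ∀ᶠ j in l, ∑' m, (if m = n then 0 else G m) - η / 2 <
      ∑' m, (if m = n then 0 else g m j) := by
    refine eventually_lt_tsum (g := fun m j => if m = n then 0 else g m j) ?_
      (hsub G hG0 hG) (fun j => hsub (fun m => g m j) (fun m => hg0 m j) (hg j)) ?_ (by linarith)
    · intro m j
      split_ifs <;> simp [hg0]
    · intro m c hc
      by_cases hm : m = n
      · simp only [hm, if_true] at hc ⊢
        exact Eventually.of_forall fun _ => hc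
      · simp only [hm, if_false] at hc ⊢
        exact hlsc m c hc
  filter_upwards [h1, hlim (η / 2) (half_pos hη)] with j hj1 hj2
  have := (hg j).tsum_eq_add_tsum_ite n
  linarith

/-- Weak* convergence of bounded functionals improves to norm convergence, up to `3 ε`, when the
restrictions to a weak*-closed finite-codimensional subspace are `ε`-close. -/
lemma eventually_norm_sub_le {ι : Type*} {l : Filter ι} {p : ι → X →L[ℝ] ℝ} {q : X →L[ℝ] ℝ}
    (hw : ∀ x, Tendsto (fun j => p j x) l (𝓝 (q x))) {M : ℝ} (hM : ∀ j, ‖p j‖ ≤ M)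
    {m : ℕ} (e : Fin m → X →L[ℝ] ℝ) {ε : ℝ} (hε : 0 < ε)
    (hres : ∀ᶠ j in l, ‖(p j - q).comp (⨅ i, (e i : X →ₗ[ℝ] ℝ).ker).subtypeL‖ ≤ ε) :
    ∀ᶠ j in l, ‖p j - q‖ ≤ 3 * ε := by
  set Y : Submodule ℝ X := ⨅ i, (e i : X →ₗ[ℝ] ℝ).ker with hY
  set F : Submodule ℝ (X →L[ℝ] ℝ) := Submodule.span ℝ (range e) with hF
  have hext : ∀ j, ∃ r : X →L[ℝ] ℝ, ‖r‖ = ‖(p j - q).comp Y.subtypeL‖ ∧ p j - q - r ∈ F := by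
    intro j
    obtain ⟨r, hr1, hr2⟩ := exists_extension_norm_eq Y ((p j - q).comp Y.subtypeL)
    refine ⟨r, hr2, ?_⟩
    have hker : (⨅ i, (e i : X →ₗ[ℝ] ℝ).ker) ≤ ((p j - q - r : X →L[ℝ] ℝ) : X →ₗ[ℝ] ℝ).ker := by
      intro y hy
      have := hr1 ⟨y, hy⟩
      simp only [LinearMap.mem_ker]
      change (p j - q) y - r y = 0
      rw [this]
      simp
    have h1 := mem_span_of_iInf_ker_le_ker hker
    rw [Submodule.mem_span_range_iff_exists_fun] at h1 ⊢
    obtain ⟨c, hc⟩ := h1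
    refine ⟨c, ?_⟩
    ext y
    have := congrArg (fun f => f y) hc
    simpa using this
  choose r hr hrF using hext
  have : FiniteDimensional ℝ F := FiniteDimensional.span_of_finite ℝ (finite_range e)
  have : ProperSpace F := FiniteDimensional.proper ℝ F
  rw [Filter.eventually_iff, mem_iff_ultrafilter]
  intro 𝒰 h𝒰
  have hres' : ∀ᶠ j in (𝒰 : Filter ι), ‖(p j - q).comp Y.subtypeL‖ ≤ ε := h𝒰 hres
  let f : ι → F := fun j => ⟨p j - q - r j, hrF j⟩
  have hbd : ∀ᶠ j in (𝒰 : Filter ι), f j ∈ closedBall (0 : F) (M + ‖q‖ + ε) := by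
    filter_upwards [hres'] with j hj
    rw [mem_closedBall, Subtype.dist_eq, dist_eq_norm]
    change ‖p j - q - r j - 0‖ ≤ _
    rw [sub_zero]
    have h1 := norm_sub_le (p j - q) (r j)
    have h2 := norm_sub_le (p j) q
    have h3 := hM j
    rw [hr j] at h1
    linarith
  obtain ⟨f0, -, hf0⟩ := (isCompact_closedBall (0 : F) (M + ‖q‖ + ε)).ultrafilter_le_nhds
    (𝒰.map f) (by rw [Ultrafilter.coe_map, le_principal_iff]; exact hbd)
  have hlim : Tendsto f 𝒰 (𝓝 f0) := hf0
  have hf0norm : ‖(f0 : X →L[ℝ] ℝ)‖ ≤ ε := by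
    refine ContinuousLinearMap.opNorm_le_bound _ hε.le fun x => ?_
    have h1 : Tendsto (fun j => (f j : X →L[ℝ] ℝ) x) 𝒰 (𝓝 ((f0 : X →L[ℝ] ℝ) x)) :=
      ((ContinuousLinearMap.apply ℝ ℝ x).continuous.comp continuous_subtype_val)
        |>.continuousAt.tendsto.comp hlim
    have h2 : Tendsto (fun j => ‖p j x - q x‖ + ε * ‖x‖) 𝒰 (𝓝 (‖q x - q x‖ + ε * ‖x‖)) :=
      ((((hw x).mono_left h𝒰).sub_const (q x)).norm).add_const _
    rw [sub_self, norm_zero, zero_add] at h2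
    refine le_of_tendsto_of_tendsto h1.norm h2 ?_
    filter_upwards [hres'] with j hj
    change ‖p j x - q x - r j x‖ ≤ _
    refine (norm_sub_le _ _).trans (add_le_add le_rfl (((r j).le_opNorm x).trans ?_))
    rw [hr j]
    exact mul_le_mul_of_nonneg_right hj (norm_nonneg _)
  have hclose : ∀ᶠ j in (𝒰 : Filter ι), dist (f j) f0 < ε := hlim (ball_mem_nhds _ hε)
  filter_upwards [hclose, hres'] with j hj1 hj2
  have hj3 : ‖(f j : X →L[ℝ] ℝ) - f0‖ < ε := by
    rwa [Subtype.dist_eq, dist_eq_norm] at hj1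
  have heq : p j - q = ((f j : X →L[ℝ] ℝ) - f0) + f0 + r j := by
    change p j - q = (p j - q - r j - f0) + f0 + r j
    abel
  change ‖p j - q‖ ≤ 3 * ε
  rw [heq]
  refine (norm_add₃_le).trans ?_
  rw [hr j]
  linarith

end SmoothGauge

section GaugePenalty

variable {X : Type u} [NormedAddCommGroup X] [NormedSpace ℝ X]

/-- The terms of the penalty on the dual which defines the smooth gauge. -/
def penaltyTerm (Y : ℕ → Submodule ℝ X) (x : ℕ → X) (p : X →L[ℝ] ℝ) (n : ℕ) : ℝ :=
  (1 / 2) ^ n * (‖p.comp (Y n).subtypeL‖ ^ 2 + p (x n) ^ 2)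

/-- A penalty on the dual that is lower semicontinuous for the weak* topology. -/
def penalty (Y : ℕ → Submodule ℝ X) (x : ℕ → X) (p : X →L[ℝ] ℝ) : ℝ :=
  ∑' n, penaltyTerm Y x p n

variable {Y : ℕ → Submodule ℝ X} {x : ℕ → X}

lemma norm_restrict_le (p : X →L[ℝ] ℝ) (Z : Submodule ℝ X) : ‖p.comp Z.subtypeL‖ ≤ ‖p‖ := by
  refine ContinuousLinearMap.opNorm_le_bound _ (norm_nonneg _) fun y => ?_
  exact p.le_opNorm y

lemma penaltyTerm_nonneg (p : X →L[ℝ] ℝ) (n : ℕ) : 0 ≤ penaltyTerm Y x p n := by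
  unfold penaltyTerm; positivity

lemma penaltyTerm_le (hx : ∀ n, ‖x n‖ ≤ 1) (p : X →L[ℝ] ℝ) (n : ℕ) :
    penaltyTerm Y x p n ≤ (1 / 2) ^ n * (2 * ‖p‖ ^ 2) := by
  unfold penaltyTerm
  have h1 := norm_restrict_le p (Y n)
  have h2 : |p (x n)| ≤ ‖p‖ := by
    have := p.le_opNorm (x n)
    rw [Real.norm_eq_abs] at this
    exact this.trans (mul_le_of_le_one_right (norm_nonneg _) (hx n))
  have h3 : ‖p.comp (Y n).subtypeL‖ ^ 2 ≤ ‖p‖ ^ 2 :=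
    pow_le_pow_left₀ (ContinuousLinearMap.opNorm_nonneg _) h1 2
  have h4 : p (x n) ^ 2 ≤ ‖p‖ ^ 2 := by
    rw [← sq_abs]
    exact pow_le_pow_left₀ (abs_nonneg _) h2 2
  gcongr
  linarith

lemma summable_penaltyTerm (hx : ∀ n, ‖x n‖ ≤ 1) (p : X →L[ℝ] ℝ) :
    Summable (penaltyTerm Y x p) :=
  (summable_geometric_two.mul_right (2 * ‖p‖ ^ 2)).of_nonneg_of_le (penaltyTerm_nonneg p)
    (penaltyTerm_le hx p)

lemma penalty_nonneg (p : X →L[ℝ] ℝ) : 0 ≤ penalty Y x p :=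
  tsum_nonneg (penaltyTerm_nonneg p)

lemma penalty_le (hx : ∀ n, ‖x n‖ ≤ 1) (p : X →L[ℝ] ℝ) : penalty Y x p ≤ 4 * ‖p‖ ^ 2 := by
  have h := (summable_penaltyTerm (Y := Y) hx p).tsum_le_tsum (penaltyTerm_le hx p)
    (summable_geometric_two.mul_right (2 * ‖p‖ ^ 2))
  rw [tsum_mul_right, tsum_geometric_two] at h
  unfold penalty
  linarith

lemma penalty_midpoint_lt (hx : ∀ n, ‖x n‖ ≤ 1)
    {p q : X →L[ℝ] ℝ} {n : ℕ} (hn : p (x n) ≠ q (x n)) :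
    penalty Y x ((1 / 2 : ℝ) • (p + q)) < (penalty Y x p + penalty Y x q) / 2 := by
  have hle : ∀ m, penaltyTerm Y x ((1 / 2 : ℝ) • (p + q)) m ≤
      (penaltyTerm Y x p m + penaltyTerm Y x q m) / 2
        - (1 / 2) ^ m * ((p (x m) - q (x m)) ^ 2 / 4) := by
    intro m
    have h1 : ‖((1 / 2 : ℝ) • (p + q)).comp (Y m).subtypeL‖ ≤
        (‖p.comp (Y m).subtypeL‖ + ‖q.comp (Y m).subtypeL‖) / 2 := by
      have hp0 : 0 ≤ ‖p.comp (Y m).subtypeL‖ := ContinuousLinearMap.opNorm_nonneg _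
      have hq0 : 0 ≤ ‖q.comp (Y m).subtypeL‖ := ContinuousLinearMap.opNorm_nonneg _
      refine ContinuousLinearMap.opNorm_le_bound _ (by positivity) fun y => ?_
      have hpy : |p y| ≤ _ := (p.comp (Y m).subtypeL).le_opNorm y
      have hqy : |q y| ≤ _ := (q.comp (Y m).subtypeL).le_opNorm y
      have hval : (((1 / 2 : ℝ) • (p + q)).comp (Y m).subtypeL) y = (p y + q y) / 2 := by
        simp; ring
      rw [hval, Real.norm_eq_abs, abs_div, abs_two]
      have := abs_add_le (p y) (q y)
      linarith
    have h0 : 0 ≤ ‖((1 / 2 : ℝ) • (p + q)).comp (Y m).subtypeL‖ :=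
      ContinuousLinearMap.opNorm_nonneg _
    have h3 : ‖((1 / 2 : ℝ) • (p + q)).comp (Y m).subtypeL‖ ^ 2 ≤
        (‖p.comp (Y m).subtypeL‖ ^ 2 + ‖q.comp (Y m).subtypeL‖ ^ 2) / 2 := by
      nlinarith [sq_nonneg (‖p.comp (Y m).subtypeL‖ - ‖q.comp (Y m).subtypeL‖)]
    have h4 : ((1 / 2 : ℝ) • (p + q)) (x m) = (p (x m) + q (x m)) / 2 := by
      simp; ring
    unfold penaltyTerm
    rw [h4]
    have h5 : (0 : ℝ) < (1 / 2) ^ m := by positivity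
    have h6 := mul_le_mul_of_nonneg_left h3 h5.le
    nlinarith
  have hsum := ((summable_penaltyTerm (Y := Y) hx p).add
    (summable_penaltyTerm (Y := Y) hx q)).div_const 2
  have h := (summable_penaltyTerm (Y := Y) hx ((1 / 2 : ℝ) • (p + q))).tsum_lt_tsum (i := n)
    (fun m => (hle m).trans (sub_le_self _ (by positivity)))
    ((hle n).trans_lt (sub_lt_self _ (by
      have : p (x n) - q (x n) ≠ 0 := sub_ne_zero.2 hn
      positivity))) hsum
  rw [tsum_div_const, (summable_penaltyTerm hx p).tsum_add (summable_penaltyTerm hx q)] at h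
  exact h

/-- Lower semicontinuity of the terms of the penalty. -/
lemma eventually_lt_penaltyTerm {ι : Type*} {l : Filter ι} {p : ι → X →L[ℝ] ℝ} {q : X →L[ℝ] ℝ}
    (hw : ∀ z, Tendsto (fun j => p j z) l (𝓝 (q z))) (n : ℕ) {c : ℝ}
    (hc : c < penaltyTerm Y x q n) : ∀ᶠ j in l, c < penaltyTerm Y x (p j) n := by
  unfold penaltyTerm at hc ⊢
  set d := ‖q.comp (Y n).subtypeL‖ with hd
  have h0 : 0 ≤ d := ContinuousLinearMap.opNorm_nonneg _
  have hcont : Tendsto (fun a : ℝ × ℝ => (1 / 2 : ℝ) ^ n * (a.1 ^ 2 + a.2 ^ 2))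
      (𝓝 d ×ˢ 𝓝 (q (x n))) (𝓝 ((1 / 2) ^ n * (d ^ 2 + q (x n) ^ 2))) := by
    rw [← nhds_prod_eq]
    exact Continuous.tendsto (by fun_prop) (d, q (x n))
  have hev := hcont.eventually_const_lt hc
  obtain ⟨P, hP, Q, hQ, hPQ⟩ := Filter.eventually_prod_iff.1 hev
  obtain ⟨δ, hδ, hball⟩ := Metric.eventually_nhds_iff.1 hP
  by_cases hd0 : d = 0
  · have hPd : P d := hball (by simpa using hδ)
    filter_upwards [(hw (x n)).eventually hQ] with j hj
    refine (hPQ hPd hj).trans_le ?_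
    simp only [hd0]
    gcongr
    exact ContinuousLinearMap.opNorm_nonneg _
  · set d' := max 0 (d - δ / 2) with hd'
    have hd'd : d' < d := max_lt (lt_of_le_of_ne h0 (Ne.symm hd0)) (by linarith)
    have hPd : P d' := hball (by
      rw [Real.dist_eq, abs_lt]
      have := le_max_right 0 (d - δ / 2)
      constructor <;> linarith)
    filter_upwards [(hw (x n)).eventually hQ, eventually_lt_norm_restrict hw (Y n) hd'd]
      with j hj hj2
    refine (hPQ hPd hj).trans_le ?_
    have : 0 ≤ d' := le_max_left _ _
    simp only
    gcongr

lemma eventually_restrict_lt {ι : Type*} {l : Filter ι} (hx : ∀ n, ‖x n‖ ≤ 1)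
    {p : ι → X →L[ℝ] ℝ} {q : X →L[ℝ] ℝ}
    (hw : ∀ z, Tendsto (fun j => p j z) l (𝓝 (q z)))
    (hlim : ∀ η > 0, ∀ᶠ j in l, penalty Y x (p j) < penalty Y x q + η) (n : ℕ) {ε : ℝ}
    (hε : ‖q.comp (Y n).subtypeL‖ < ε) : ∀ᶠ j in l, ‖(p j).comp (Y n).subtypeL‖ < ε := by
  set d := ‖q.comp (Y n).subtypeL‖ with hd
  have h0 : 0 ≤ d := ContinuousLinearMap.opNorm_nonneg _
  set η := (ε ^ 2 - d ^ 2) / 2 with hη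
  have hη0 : 0 < η := by rw [hη]; nlinarith
  have hpos : (0 : ℝ) < (1 / 2) ^ n := by positivity
  have h1 := eventually_term_lt (g := fun m j => penaltyTerm Y x (p j) m)
    (G := penaltyTerm Y x q) (fun m j => penaltyTerm_nonneg _ _) (fun m => penaltyTerm_nonneg _ _)
    (summable_penaltyTerm hx q) (fun j => summable_penaltyTerm hx (p j))
    (fun m c hc => eventually_lt_penaltyTerm hw m hc) hlim n (mul_pos hpos hη0)
  have h2 : ∀ᶠ j in l, q (x n) ^ 2 - η < p j (x n) ^ 2 :=
    ((hw (x n)).pow 2).eventually_const_lt (by linarith)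
  filter_upwards [h1, h2] with j hj1 hj2
  unfold penaltyTerm at hj1
  rw [← mul_add] at hj1
  have hj3 := lt_of_mul_lt_mul_left hj1 hpos.le
  have hj4 : ‖(p j).comp (Y n).subtypeL‖ ^ 2 < ε ^ 2 := by linarith
  exact lt_of_pow_lt_pow_left₀ 2 (h0.trans hε.le) hj4

/-- Weak* convergent maximizing sequences of `p ↦ p z - penalty p` converge in norm to a
maximizer. -/
lemma tendsto_norm_of_maximizing (hx : ∀ n, ‖x n‖ ≤ 1) {e : ℕ → X →L[ℝ] ℝ} (he : DenseRange e)
    (hY : ∀ n, Y n = ⨅ i : Fin n, (e i : X →ₗ[ℝ] ℝ).ker)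
    {p : ℕ → X →L[ℝ] ℝ} {q : X →L[ℝ] ℝ} (hp : ∀ j, ‖p j‖ ≤ 1)
    (hw : ∀ z, Tendsto (fun j => p j z) atTop (𝓝 (q z))) {z : X} {N : ℝ}
    (hN : q z - penalty Y x q ≤ N)
    (hmax : Tendsto (fun j => p j z - penalty Y x (p j)) atTop (𝓝 N)) :
    q z - penalty Y x q = N ∧ Tendsto p atTop (𝓝 q) := by
  have hpen : Tendsto (fun j => penalty Y x (p j)) atTop (𝓝 (q z - N)) := by
    simpa using (hw z).sub hmax
  have hle : penalty Y x q ≤ q z - N := by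
    by_contra! h
    obtain ⟨c, hc1, hc2⟩ := exists_between h
    have h1 := eventually_lt_tsum (l := atTop) (g := fun m j => penaltyTerm Y x (p j) m)
      (G := penaltyTerm Y x q) (fun m j => penaltyTerm_nonneg _ _)
      (summable_penaltyTerm hx q) (fun j => summable_penaltyTerm hx (p j))
      (fun m c hc => eventually_lt_penaltyTerm hw m hc) hc2
    obtain ⟨j, hj1, hj2⟩ := (h1.and (hpen.eventually_lt_const hc1)).exists
    exact absurd hj1 (not_lt.2 hj2.le)
  have heq : q z - penalty Y x q = N := by linarith
  refine ⟨heq, ?_⟩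
  have hpen' : penalty Y x q = q z - N := by linarith
  have hlim : ∀ η > 0, ∀ᶠ j in atTop, penalty Y x (p j) < penalty Y x q + η := fun η hη =>
    hpen.eventually_lt_const (by linarith)
  rw [tendsto_iff_norm_sub_tendsto_zero, Metric.tendsto_nhds]
  intro ε hε
  obtain ⟨i, hi⟩ := he.exists_dist_lt q (show 0 < ε / 16 by positivity)
  have hqi : ‖q.comp (Y (i + 1)).subtypeL‖ < ε / 8 := by
    have h1 : q.comp (Y (i + 1)).subtypeL = (q - e i).comp (Y (i + 1)).subtypeL := by
      ext y
      have h2 : (y : X) ∈ ⨅ k : Fin (i + 1), (e k : X →ₗ[ℝ] ℝ).ker := hY (i + 1) ▸ y.2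
      have h3 : e i y = 0 := (Submodule.mem_iInf _).1 h2 ⟨i, Nat.lt_succ_self i⟩
      simp [h3]
    rw [h1]
    refine (norm_restrict_le _ _).trans_lt ?_
    rw [← dist_eq_norm]
    linarith
  have hev := eventually_restrict_lt hx hw hlim (i + 1) hqi
  have hres : ∀ᶠ j in atTop, ‖(p j - q).comp
      (⨅ k : Fin (i + 1), (e k : X →ₗ[ℝ] ℝ).ker).subtypeL‖ ≤ ε / 4 := by
    filter_upwards [hev] with j hj
    rw [← hY (i + 1)]
    refine ContinuousLinearMap.opNorm_le_bound _ (by positivity) fun y => ?_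
    have hpy : |p j y| ≤ _ := ((p j).comp (Y (i + 1)).subtypeL).le_opNorm y
    have hqy : |q y| ≤ _ := (q.comp (Y (i + 1)).subtypeL).le_opNorm y
    have hval : ((p j - q).comp (Y (i + 1)).subtypeL) y = p j y - q y := rfl
    rw [hval, Real.norm_eq_abs]
    have h1 := abs_sub (p j y) (q y)
    have h2 := mul_le_mul_of_nonneg_right (add_lt_add hj hqi).le (norm_nonneg y)
    linarith
  filter_upwards [eventually_norm_sub_le hw hp (fun k : Fin (i + 1) => e k)
    (show 0 < ε / 4 by positivity) hres] with j hj
  rw [dist_zero_right, norm_norm]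
  linarith

end GaugePenalty

section Gauge

variable {X : Type u} [NormedAddCommGroup X] [NormedSpace ℝ X]

/-- Every bounded sequence of functionals on a separable space has a weak* convergent
subsequence. -/
lemma exists_subseq_tendsto_apply [TopologicalSpace.SeparableSpace X] {L : ℝ}
    {p : ℕ → X →L[ℝ] ℝ} (hp : ∀ j, ‖p j‖ ≤ L) :
    ∃ q : X →L[ℝ] ℝ, ‖q‖ ≤ L ∧ ∃ σ : ℕ → ℕ, StrictMono σ ∧
      ∀ z, Tendsto (fun j => p (σ j) z) atTop (𝓝 (q z)) := by
  have hball : IsSeqCompact (WeakDual.toStrongDual ⁻¹' closedBall (0 : StrongDual ℝ X) L) :=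
    WeakDual.isSeqCompact_closedBall ℝ X 0 L
  obtain ⟨q, hq, σ, hσ, hlim⟩ := hball (x := fun j => StrongDual.toWeakDual (p j))
    (fun j => by simpa using hp j)
  refine ⟨WeakDual.toStrongDual q, by simpa using hq, σ, hσ, fun z => ?_⟩
  exact ((WeakDual.eval_continuous z).tendsto q).comp hlim

/-- The conjugate of the penalty restricted to the unit ball of the dual. -/
def smoothGauge (Y : ℕ → Submodule ℝ X) (x : ℕ → X) (z : X) : ℝ :=
  ⨆ p : closedBall (0 : X →L[ℝ] ℝ) 1, ((p : X →L[ℝ] ℝ) z - penalty Y x p)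

variable {Y : ℕ → Submodule ℝ X} {x : ℕ → X}

lemma apply_le_norm_of_norm_le_one {p : X →L[ℝ] ℝ} (hp : ‖p‖ ≤ 1) (z : X) : p z ≤ ‖z‖ :=
  (le_abs_self _).trans ((p.le_opNorm z).trans (mul_le_of_le_one_left (norm_nonneg _) hp))

lemma le_smoothGauge {p : X →L[ℝ] ℝ} (hp : ‖p‖ ≤ 1) (z : X) :
    p z - penalty Y x p ≤ smoothGauge Y x z := by
  have hb : BddAbove (range fun p : closedBall (0 : X →L[ℝ] ℝ) 1 =>
      ((p : X →L[ℝ] ℝ) z - penalty Y x p)) := by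
    refine ⟨‖z‖, ?_⟩
    rintro _ ⟨r, rfl⟩
    have h1 := apply_le_norm_of_norm_le_one (mem_closedBall_zero_iff.1 r.2) z
    have h2 := penalty_nonneg (Y := Y) (x := x) (r : X →L[ℝ] ℝ)
    simp only
    linarith
  exact le_ciSup hb ⟨p, mem_closedBall_zero_iff.2 hp⟩

lemma exists_maximizing (z : X) : ∃ p : ℕ → X →L[ℝ] ℝ, (∀ j, ‖p j‖ ≤ 1) ∧
    Tendsto (fun j => p j z - penalty Y x (p j)) atTop (𝓝 (smoothGauge Y x z)) := by
  have hne : Nonempty (closedBall (0 : X →L[ℝ] ℝ) 1) := ⟨0, by simp⟩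
  have h : ∀ j : ℕ, ∃ p : X →L[ℝ] ℝ, ‖p‖ ≤ 1 ∧
      smoothGauge Y x z - 1 / ((j : ℝ) + 1) < p z - penalty Y x p := by
    intro j
    obtain ⟨r, hr⟩ := exists_lt_of_lt_ciSup (show smoothGauge Y x z - 1 / ((j : ℝ) + 1) <
      ⨆ p : closedBall (0 : X →L[ℝ] ℝ) 1, ((p : X →L[ℝ] ℝ) z - penalty Y x p) from
        sub_lt_self _ (by positivity))
    exact ⟨r, mem_closedBall_zero_iff.1 r.2, hr⟩
  choose p hp hlt using h
  refine ⟨p, hp, ?_⟩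
  have h1 : Tendsto (fun j : ℕ => smoothGauge Y x z - 1 / ((j : ℝ) + 1)) atTop
      (𝓝 (smoothGauge Y x z)) := by
    simpa using tendsto_one_div_add_atTop_nhds_zero_nat.const_sub (smoothGauge Y x z)
  exact tendsto_of_tendsto_of_tendsto_of_le_of_le h1 tendsto_const_nhds (fun j => (hlt j).le)
    fun j => le_smoothGauge (hp j) z

/-- On a separable Banach space with separable dual there is a Fréchet differentiable function
which behaves like the norm up to a quadratic error. -/
theorem exists_smooth_gauge [TopologicalSpace.SeparableSpace X]
    [TopologicalSpace.SeparableSpace (X →L[ℝ] ℝ)] :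
    ∃ N : X → ℝ, Differentiable ℝ N ∧ LipschitzWith 1 N ∧ N 0 = 0 ∧
      ∀ z, ∀ s ∈ Icc (0 : ℝ) 1, s * ‖z‖ - 4 * s ^ 2 ≤ N z := by
  set e := TopologicalSpace.denseSeq (X →L[ℝ] ℝ) with he_def
  have he : DenseRange e := TopologicalSpace.denseRange_denseSeq _
  set d := TopologicalSpace.denseSeq X with hd_def
  have hd : DenseRange d := TopologicalSpace.denseRange_denseSeq _
  set x : ℕ → X := fun n => (1 / (1 + ‖d n‖)) • d n with hx_def
  have hx : ∀ n, ‖x n‖ ≤ 1 := by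
    intro n
    have : 0 ≤ ‖d n‖ := norm_nonneg _
    rw [hx_def]
    simp only
    rw [norm_smul, Real.norm_of_nonneg (by positivity), one_div, inv_mul_le_iff₀ (by positivity)]
    linarith
  have hsep : ∀ p q : X →L[ℝ] ℝ, (∀ n, p (x n) = q (x n)) → p = q := by
    intro p q h
    apply ContinuousLinearMap.coeFn_injective
    refine hd.equalizer p.continuous q.continuous (funext fun n => ?_)
    have h1 := h n
    have h2 : (1 / (1 + ‖d n‖)) ≠ 0 := by positivity
    simp only [hx_def, map_smul, smul_eq_mul] at h1
    exact mul_left_cancel₀ h2 h1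
  set Y : ℕ → Submodule ℝ X := fun n => ⨅ i : Fin n, (e i : X →ₗ[ℝ] ℝ).ker with hY_def
  have hY : ∀ n, Y n = ⨅ i : Fin n, (e i : X →ₗ[ℝ] ℝ).ker := fun n => rfl
  set N := smoothGauge Y x with hN
  have hsub : ∀ (z : X) (p : ℕ → X →L[ℝ] ℝ), (∀ j, ‖p j‖ ≤ 1) →
      Tendsto (fun j => p j z - penalty Y x (p j)) atTop (𝓝 (N z)) →
      ∃ q : X →L[ℝ] ℝ, ‖q‖ ≤ 1 ∧ q z - penalty Y x q = N z ∧
        ∃ σ : ℕ → ℕ, StrictMono σ ∧ Tendsto (p ∘ σ) atTop (𝓝 q) := by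
    intro z p hp hmax
    obtain ⟨q, hq, σ, hσ, hw⟩ := exists_subseq_tendsto_apply hp
    obtain ⟨h1, h2⟩ := tendsto_norm_of_maximizing hx he hY (p := p ∘ σ) (fun j => hp (σ j)) hw
      (le_smoothGauge hq z) (hmax.comp hσ.tendsto_atTop)
    exact ⟨q, hq, h1, σ, hσ, h2⟩
  have hex : ∀ z, ∃ q : X →L[ℝ] ℝ, ‖q‖ ≤ 1 ∧ q z - penalty Y x q = N z := by
    intro z
    obtain ⟨p, hp, hmax⟩ := exists_maximizing (Y := Y) (x := x) z
    obtain ⟨q, hq, h1, -⟩ := hsub z p hp hmax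
    exact ⟨q, hq, h1⟩
  choose D hD1 hD using hex
  have huniq : ∀ z (q : X →L[ℝ] ℝ), ‖q‖ ≤ 1 → q z - penalty Y x q = N z → q = D z := by
    intro z q hq hqN
    refine hsep _ _ fun n => ?_
    by_contra hne
    have h1 := penalty_midpoint_lt (Y := Y) hx hne
    have h2 : ‖(1 / 2 : ℝ) • (q + D z)‖ ≤ 1 := by
      rw [norm_smul, Real.norm_of_nonneg (by norm_num)]
      have := norm_add_le q (D z)
      have := hD1 z
      linarith
    have h3 : _ ≤ N z := le_smoothGauge (Y := Y) (x := x) h2 z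
    have h4 : ((1 / 2 : ℝ) • (q + D z)) z = (q z + D z z) / 2 := by simp; ring
    have h5 := hD z
    linarith
  have hmono : ∀ z h, D z h ≤ N (z + h) - N z := by
    intro z h
    have h1 : _ ≤ N (z + h) := le_smoothGauge (Y := Y) (x := x) (hD1 z) (z + h)
    have h2 := hD z
    rw [map_add] at h1
    linarith
  have hmono' : ∀ z h, N (z + h) - N z ≤ D (z + h) h := by
    intro z h
    have := hmono (z + h) (-h)
    rw [add_neg_cancel_right, map_neg] at this
    linarith
  have hDle : ∀ z h, |D z h| ≤ ‖h‖ := fun z h =>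
    ((D z).le_opNorm h).trans (mul_le_of_le_one_left (norm_nonneg _) (hD1 z))
  have hLip : LipschitzWith 1 N := by
    refine LipschitzWith.of_le_add fun a b => ?_
    have h1 := hmono' b (a - b)
    rw [add_sub_cancel] at h1
    have h2 := (le_abs_self _).trans (hDle a (a - b))
    rw [dist_eq_norm]
    linarith
  have hcont : ∀ z, Tendsto D (𝓝 z) (𝓝 (D z)) := by
    intro z
    refine tendsto_of_seq_tendsto fun w hw => tendsto_of_subseq_tendsto fun τ hτ => ?_
    have hwτ : Tendsto (fun j => w (τ j)) atTop (𝓝 z) := hw.comp hτ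
    have hmax : Tendsto (fun j => D (w (τ j)) z - penalty Y x (D (w (τ j)))) atTop
        (𝓝 (N z)) := by
      have h1 : Tendsto (fun j => N (w (τ j))) atTop (𝓝 (N z)) :=
        (hLip.continuous.tendsto z).comp hwτ
      have h2 : Tendsto (fun j => D (w (τ j)) (z - w (τ j))) atTop (𝓝 0) := by
        refine squeeze_zero_norm (fun j => hDle _ _) ?_
        simpa using (hwτ.const_sub z).norm
      have h3 := h1.add h2
      rw [add_zero] at h3
      refine h3.congr fun j => ?_
      rw [← hD (w (τ j)), map_sub]
      ring
    obtain ⟨q, hq, hqN, σ, -, hlim⟩ := hsub z _ (fun j => hD1 _) hmax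
    rw [huniq z q hq hqN] at hlim
    exact ⟨σ, hlim⟩
  refine ⟨N, fun z => HasFDerivAt.differentiableAt (f' := D z) ?_, hLip, ?_, ?_⟩
  · rw [hasFDerivAt_iff_isLittleO_nhds_zero, Asymptotics.isLittleO_iff]
    intro c hc
    have h1 : Tendsto (fun h => D (z + h)) (𝓝 0) (𝓝 (D z)) := by
      have : Tendsto (fun h => z + h) (𝓝 0) (𝓝 z) := by
        simpa using (continuous_const_add z).tendsto 0
      exact (hcont z).comp this
    filter_upwards [Metric.tendsto_nhds.1 h1 c hc] with h hh
    rw [dist_eq_norm] at hh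
    have h2 := hmono z h
    have h3 := hmono' z h
    have h4 : D (z + h) h - D z h ≤ ‖D (z + h) - D z‖ * ‖h‖ :=
      (le_abs_self _).trans ((D (z + h) - D z).le_opNorm h)
    have h5 := mul_le_mul_of_nonneg_right hh.le (norm_nonneg h)
    rw [Real.norm_of_nonneg (by linarith)]
    linarith
  · have h1 := hD 0
    have h2 : _ ≤ N 0 := le_smoothGauge (Y := Y) (x := x) (p := 0) (by simp) 0
    have h3 := penalty_nonneg (Y := Y) (x := x) (D 0)
    have h4 := penalty_le (Y := Y) hx 0
    simp only [map_zero, norm_zero] at h1 h2 h4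
    norm_num at h4
    linarith
  · intro z s hs
    obtain ⟨g, hg, hgz⟩ := exists_dual_vector'' ℝ z
    have hsg : ‖s • g‖ ≤ s := by
      rw [norm_smul, Real.norm_of_nonneg hs.1]
      exact mul_le_of_le_one_right hs.1 hg
    have h1 : _ ≤ N z := le_smoothGauge (Y := Y) (x := x) (p := s • g) (hsg.trans hs.2) z
    have h2 := penalty_le (Y := Y) hx (s • g)
    have h3 : ‖s • g‖ ^ 2 ≤ s ^ 2 := pow_le_pow_left₀ (norm_nonneg _) hsg 2
    have h4 : (s • g) z = s * ‖z‖ := by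
      simp only [smul_apply, smul_eq_mul]
      rw [hgz]
      rfl
    linarith

end Gauge

section VariationalPrinciple

variable {X : Type u} [NormedAddCommGroup X] [NormedSpace ℝ X]

/-- A smooth variational principle: a continuous function bounded below attains its minimum after
a differentiable perturbation with small Lipschitz constant. -/
theorem exists_smooth_perturbation_minimizer [CompleteSpace X] {N : X → ℝ}
    (hNd : Differentiable ℝ N) (hNL : LipschitzWith 1 N) (hN0 : N 0 = 0)
    (hNg : ∀ z, ∀ s ∈ Icc (0 : ℝ) 1, s * ‖z‖ - 4 * s ^ 2 ≤ N z)
    {F : X → ℝ} (hF : Continuous F) (hb : BddBelow (range F)) {δ : ℝ≥0} (hδ : 0 < δ) :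
    ∃ P : X → ℝ, Differentiable ℝ P ∧ LipschitzWith δ P ∧
      ∃ y, ∀ z, F y + P y ≤ F z + P z := by
  have hN_nonneg : ∀ z, 0 ≤ N z := fun z => by simpa using hNg z 0 (by simp)
  have hN_le : ∀ z, N z ≤ ‖z‖ := fun z => by
    have := hNL.le_add_mul z 0
    simpa [hN0] using this
  have hδ' : (0 : ℝ) < δ := hδ
  set d : ℕ → ℝ := fun n => (δ : ℝ) / 2 / 2 ^ n with hd
  have hdpos : ∀ n, 0 < d n := fun n => by rw [hd]; positivity
  have hdsum : HasSum d δ := hasSum_geometric_two' (δ : ℝ)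
  set η : ℕ → ℝ := fun n => d n * ((1 / 2) ^ n) ^ 2 with hη
  have hηpos : ∀ n, 0 < η n := fun n => mul_pos (hdpos n) (by positivity)
  have hmin : ∀ (G : X → ℝ) (n : ℕ), ∃ y, BddBelow (range G) → ∀ z, G y ≤ G z + η n := by
    intro G n
    by_cases hG : BddBelow (range G)
    · obtain ⟨y, hy⟩ := exists_lt_of_ciInf_lt (lt_add_of_pos_right (⨅ z, G z) (hηpos n))
      exact ⟨y, fun _ z => hy.le.trans (by gcongr; exact ciInf_le hG z)⟩
    · exact ⟨0, fun h => absurd h hG⟩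
  choose m hm using hmin
  let G : ℕ → X → ℝ := fun n => Nat.rec F (fun n G z => G z + d n * N (z - m G n)) n
  set y : ℕ → X := fun n => m (G n) n with hy_def
  have hG0 : G 0 = F := rfl
  have hGs : ∀ n z, G (n + 1) z = G n z + d n * N (z - y n) := fun n z => rfl
  have hGmono : ∀ z, Monotone fun n => G n z := fun z => monotone_nat_of_le_succ fun n => by
    rw [hGs]
    exact le_add_of_nonneg_right (mul_nonneg (hdpos n).le (hN_nonneg _))
  have hGb : ∀ n, BddBelow (range (G n)) := by
    obtain ⟨c, hc⟩ := hb
    intro n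
    refine ⟨c, ?_⟩
    rintro _ ⟨z, rfl⟩
    exact (hc ⟨z, rfl⟩).trans (hGmono z (Nat.zero_le n))
  have hyG : ∀ n z, G n (y n) ≤ G n z + η n := fun n z => hm (G n) n (hGb n) z
  have hGcont : ∀ n, Continuous (G n) := by
    intro n
    induction n with
    | zero => exact hF
    | succ n ih =>
      have : G (n + 1) = fun z => G n z + d n * N (z - y n) := funext (hGs n)
      rw [this]
      exact ih.add (continuous_const.mul (hNL.continuous.comp (continuous_sub_right _)))
  have hηle : ∀ n, η (n + 1) ≤ η n := by
    intro n
    have h1 : η (n + 1) = η n / 8 := by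
      simp only [hη, hd, pow_succ]
      ring
    have := hηpos n
    linarith
  have hdist : ∀ n, dist (y n) (y (n + 1)) ≤ 6 * (1 / 2) ^ n := by
    intro n
    have h1 := hyG (n + 1) (y n)
    rw [hGs, hGs, sub_self, hN0, mul_zero, add_zero] at h1
    have h2 := hyG n (y (n + 1))
    have h3 : d n * N (y (n + 1) - y n) ≤ d n * (2 * ((1 / 2) ^ n) ^ 2) := by
      have := hηle n
      have h4 : η n = d n * ((1 / 2) ^ n) ^ 2 := rfl
      linarith
    have h4 := le_of_mul_le_mul_left h3 (hdpos n)
    have hs : (0 : ℝ) < (1 / 2) ^ n := by positivity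
    have h5 := hNg (y (n + 1) - y n) ((1 / 2) ^ n)
      ⟨hs.le, pow_le_one₀ (by norm_num) (by norm_num)⟩
    rw [dist_comm, dist_eq_norm]
    have h6 : (1 / 2 : ℝ) ^ n * ‖y (n + 1) - y n‖ ≤ (1 / 2) ^ n * (6 * (1 / 2) ^ n) := by
      nlinarith
    exact le_of_mul_le_mul_left h6 hs
  have hcauchy : CauchySeq y := cauchySeq_of_le_geometric (1 / 2) 6 (by norm_num) hdist
  obtain ⟨ybar, hybar⟩ := cauchySeq_tendsto_of_complete hcauchy
  have hsumm : ∀ z, Summable fun n => d n * N (z - y n) := by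
    intro z
    obtain ⟨c, hc⟩ := (hybar.const_sub z).norm.bddAbove_range
    refine (hdsum.summable.mul_right c).of_nonneg_of_le
      (fun n => mul_nonneg (hdpos n).le (hN_nonneg _)) fun n => ?_
    exact mul_le_mul_of_nonneg_left ((hN_le _).trans (hc ⟨n, rfl⟩)) (hdpos n).le
  have hGsum : ∀ z, Tendsto (fun n => G n z) atTop
      (𝓝 (F z + ∑' n, d n * N (z - y n))) := by
    intro z
    have h1 : ∀ n, G n z = F z + ∑ i ∈ Finset.range n, d i * N (z - y i) := by
      intro n
      induction n with
      | zero => simp [hG0]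
      | succ n ih => rw [hGs, ih, Finset.sum_range_succ, add_assoc]
    simp only [h1]
    exact (hsumm z).hasSum.tendsto_sum_nat.const_add _
  have hfd : ∀ n, Differentiable ℝ fun z => d n * N (z - y n) := fun n =>
    (hNd.comp (differentiable_id.sub_const (y n))).const_mul (d n)
  have hlip : ∀ n, ∀ a b, d n * N (a - y n) ≤ d n * N (b - y n) + d n * dist a b := by
    intro n a b
    rw [← mul_add]
    refine mul_le_mul_of_nonneg_left ?_ (hdpos n).le
    simpa using hNL.le_add_mul (a - y n) (b - y n)
  refine ⟨fun z => ∑' n, d n * N (z - y n), ?_, ?_, ybar, fun z => ?_⟩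
  · refine differentiable_tsum hdsum.summable (fun n z => (hfd n z).hasFDerivAt) fun n z => ?_
    have h1 : LipschitzWith (d n).toNNReal fun z => d n * N (z - y n) := by
      refine LipschitzWith.of_le_add_mul _ fun a b => ?_
      rw [Real.coe_toNNReal _ (hdpos n).le]
      exact hlip n a b
    simpa [Real.coe_toNNReal _ (hdpos n).le] using norm_fderiv_le_of_lipschitz ℝ h1 (x₀ := z)
  · refine LipschitzWith.of_le_add_mul _ fun a b => ?_
    have h1 := (hsumm a).tsum_le_tsum (fun n => hlip n a b)
      ((hsumm b).add (hdsum.summable.mul_right _))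
    rwa [(hsumm b).tsum_add (hdsum.summable.mul_right _), tsum_mul_right, hdsum.tsum_eq] at h1
  · have hη0 : Tendsto η atTop (𝓝 0) := by
      have h1 := hdsum.summable.tendsto_atTop_zero
      have h2 : Tendsto (fun n : ℕ => ((1 / 2 : ℝ) ^ n) ^ 2) atTop (𝓝 (0 ^ 2)) :=
        (tendsto_pow_atTop_nhds_zero_of_lt_one (by norm_num) (by norm_num)).pow 2
      have h3 := h1.mul h2
      rwa [zero_mul] at h3
    have hGle : ∀ n, G n z ≤ F z + ∑' n, d n * N (z - y n) := fun n =>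
      (hGmono z).ge_of_tendsto (hGsum z) n
    refine le_of_tendsto (hGsum ybar) (Eventually.of_forall fun k => ?_)
    have h1 : Tendsto (fun n => G k (y n)) atTop (𝓝 (G k ybar)) :=
      ((hGcont k).tendsto ybar).comp hybar
    have h2 : Tendsto (fun n => F z + ∑' i, d i * N (z - y i) + η n) atTop
        (𝓝 (F z + ∑' n, d n * N (z - y n))) := by simpa using hη0.const_add _
    refine le_of_tendsto_of_tendsto h1 h2 ?_
    filter_upwards [eventually_ge_atTop k] with n hn
    have h3 : G k (y n) ≤ G n (y n) := hGmono (y n) hn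
    have h4 := hyG n z
    have h5 := hGle n
    linarith

end VariationalPrinciple

section FuzzySum

variable {X : Type u} [NormedAddCommGroup X] [NormedSpace ℝ X]

/-- `p` is a Fréchet subgradient of `f` at `y`. -/
def IsFrechetSubgradient (f : X → ℝ) (y : X) (p : X →L[ℝ] ℝ) : Prop :=
  ∀ ε > 0, ∀ᶠ z in 𝓝 y, f y + p (z - y) - ε * ‖z - y‖ ≤ f z

lemma IsFrechetSubgradient.apply_le {f : X → ℝ} {y : X} {p : X →L[ℝ] ℝ}
    (h : IsFrechetSubgradient f y p) {L : ℝ}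
    (hL : ∀ᶠ z in 𝓝 y, f z - f y ≤ L * ‖z - y‖) (v : X) : p v ≤ L * ‖v‖ := by
  refine le_of_forall_pos_le_add fun ε hε => ?_
  set c := ε / (‖v‖ + 1)
  have hc : 0 < c := by positivity
  have hcv : c * ‖v‖ ≤ ε := by
    rw [div_mul_eq_mul_div, div_le_iff₀ (by positivity)]
    nlinarith [norm_nonneg v]
  have ht : Tendsto (fun t : ℝ => y + t • v) (𝓝[>] 0) (𝓝 y) := by
    have h1 : Continuous fun t : ℝ => y + t • v := by fun_prop
    have h2 := h1.tendsto 0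
    rw [zero_smul, add_zero] at h2
    exact h2.mono_left nhdsWithin_le_nhds
  obtain ⟨t, ⟨h1, h2⟩, ht0⟩ :=
    ((ht.eventually ((h c hc).and hL)).and self_mem_nhdsWithin).exists
  have ht0 : 0 < t := ht0
  rw [add_sub_cancel_left, norm_smul, Real.norm_of_nonneg ht0.le] at h1 h2
  rw [map_smul, smul_eq_mul] at h1
  have h3 : t * p v ≤ t * (L * ‖v‖ + c * ‖v‖) := by linarith
  have := le_of_mul_le_mul_left h3 ht0
  linarith

lemma IsFrechetSubgradient.norm_le {f : X → ℝ} {y : X} {p : X →L[ℝ] ℝ}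
    (h : IsFrechetSubgradient f y p) {L : ℝ} (hL0 : 0 ≤ L)
    (hL : ∀ᶠ z in 𝓝 y, f z - f y ≤ L * ‖z - y‖) : ‖p‖ ≤ L := by
  refine ContinuousLinearMap.opNorm_le_bound _ hL0 fun v => ?_
  rw [Real.norm_eq_abs, abs_le]
  have h1 := h.apply_le hL v
  have h2 := h.apply_le hL (-v)
  rw [map_neg, norm_neg] at h2
  constructor <;> linarith

lemma _root_.HasFDerivAt.eventually_abs_sub_le {f : X → ℝ} {y : X} {p : X →L[ℝ] ℝ}
    (h : HasFDerivAt f p y) {ε : ℝ} (hε : 0 < ε) :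
    ∀ᶠ z in 𝓝 y, |f z - f y - p (z - y)| ≤ ε * ‖z - y‖ :=
  (Asymptotics.isLittleO_iff.1 h.isLittleO) hε

/-- Fuzzy sum rule for the sum of a Lipschitz function and a function on a compact set. -/
theorem exists_fuzzy_minimizer [CompleteSpace X] [TopologicalSpace.SeparableSpace X]
    [TopologicalSpace.SeparableSpace (X →L[ℝ] ℝ)] {f : X → ℝ} {L : ℝ≥0} (hf : LipschitzWith L f)
    {Q : Set X} (hQ : IsCompact Q) (hQne : Q.Nonempty) {g : X → ℝ} (hg : ContinuousOn g Q)
    {η : ℝ} (hη : 0 < η) :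
    ∃ w ∈ Q, ∃ y p, IsFrechetSubgradient f y p ∧ ‖y - w‖ ≤ η ∧
      (∀ w' ∈ Q, f w + g w ≤ f w' + g w' + η) ∧
      ∀ᶠ w' in 𝓝[Q] w, g w - p (w' - w) - η * ‖w' - w‖ ≤ g w' := by
  obtain ⟨N, hNd, hNL, hN0, hNg⟩ := exists_smooth_gauge (X := X)
  obtain ⟨R, hR⟩ := hQ.isBounded.exists_norm_le
  have hR0 : 0 ≤ R := (norm_nonneg _).trans (hR _ hQne.some_mem)
  set δ : ℝ≥0 := ⟨min 1 (min (η / 2) (η / (4 * R + 1))), by positivity⟩ with hδ_def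
  have hδ : 0 < δ := by
    rw [← NNReal.coe_pos]
    change 0 < min 1 (min (η / 2) (η / (4 * R + 1)))
    positivity
  have hδ' : (0 : ℝ) < δ := hδ
  have hδ2 : (δ : ℝ) ≤ η / 2 := (min_le_right _ _).trans (min_le_left _ _)
  have hδR : (δ : ℝ) * (4 * R) ≤ η := by
    have h1 : (δ : ℝ) ≤ η / (4 * R + 1) := (min_le_right _ _).trans (min_le_right _ _)
    rw [le_div_iff₀ (by positivity)] at h1
    linarith
  set s : ℝ := min 1 (min (η / 8) (η / (16 * (L + δ)))) with hs_def
  have hs0 : 0 < s := by positivity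
  have hs1 : s ≤ 1 := min_le_left _ _
  have hs8 : 8 * s ≤ η := by
    have : s ≤ η / 8 := (min_le_right _ _).trans (min_le_left _ _)
    linarith
  have hsL : (L + δ) * (8 * s) ≤ η / 2 := by
    have h1 : s ≤ η / (16 * (L + δ)) := (min_le_right _ _).trans (min_le_right _ _)
    rw [le_div_iff₀ (by positivity)] at h1
    linarith
  set K : ℝ := 2 * (L + δ) / s with hK_def
  have hK : 0 < K := by positivity
  have hKs : K * s = 2 * (L + δ) := div_mul_cancel₀ _ hs0.ne'
  have hKN : ∀ z, 2 * (L + δ) * ‖z‖ - 2 * (L + δ) * (4 * s) ≤ K * N z := by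
    intro z
    have h1 := mul_le_mul_of_nonneg_left (hNg z s ⟨hs0.le, hs1⟩) hK.le
    rw [← hKs]
    linarith
  have hmin : ∀ y, ∃ w ∈ Q, ∀ w' ∈ Q, g w + K * N (y - w) ≤ g w' + K * N (y - w') := by
    intro y
    have hc : ContinuousOn (fun w => g w + K * N (y - w)) Q :=
      hg.add (continuous_const.mul
        (hNL.continuous.comp (continuous_sub_left y))).continuousOn
    exact hQ.exists_isMinOn hQne hc
  choose W hWQ hW using hmin
  set h : X → ℝ := fun y => g (W y) + K * N (y - W y) with hh
  have hhL : LipschitzWith K.toNNReal h := by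
    refine LipschitzWith.of_le_add_mul _ fun a b => ?_
    rw [Real.coe_toNNReal _ hK.le]
    have h1 := hW a (W b) (hWQ b)
    have h2 := hNL.le_add_mul (a - W b) (b - W b)
    rw [dist_sub_right, NNReal.coe_one, one_mul] at h2
    have h3 := mul_le_mul_of_nonneg_left h2 hK.le
    simp only [hh]
    linarith
  have hfle : ∀ a b, f a ≤ f b + L * ‖a - b‖ := fun a b => by
    simpa [dist_eq_norm] using hf.le_add_mul a b
  have hb : BddBelow (range fun y => f y + h y) := by
    obtain ⟨w₀, -, hw₀⟩ := hQ.exists_isMinOn hQne (hf.continuous.continuousOn.add hg)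
    refine ⟨f w₀ + g w₀ - 2 * (L + δ) * (4 * s), ?_⟩
    rintro _ ⟨y, rfl⟩
    have h1 : f w₀ + g w₀ ≤ f (W y) + g (W y) := hw₀ (hWQ y)
    have h2 := hfle (W y) y
    have h3 := hKN (y - W y)
    rw [norm_sub_rev] at h2
    have h4 : 0 ≤ (L + 2 * δ) * ‖y - W y‖ := by positivity
    simp only [hh]
    linarith
  obtain ⟨P, hPd, hPL, y, hy⟩ := exists_smooth_perturbation_minimizer hNd hNL hN0 hNg
    (hf.continuous.add hhL.continuous) hb hδ
  set w := W y with hw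
  have hmin2 : ∀ z, ∀ w' ∈ Q,
      f y + (g w + K * N (y - w)) + P y ≤ f z + (g w' + K * N (z - w')) + P z := by
    intro z w' hw'
    have h1 := hy z
    have h2 := hW z w' hw'
    simp only [Pi.add_apply, hh] at h1
    linarith
  have hPle : ∀ a b, P a ≤ P b + δ * ‖a - b‖ := fun a b => by
    simpa [dist_eq_norm] using hPL.le_add_mul a b
  have hyw : ‖y - w‖ ≤ 8 * s := by
    have h1 := hmin2 w w (hWQ y)
    rw [sub_self, hN0, mul_zero, add_zero] at h1
    have h2 := hfle w y
    have h3 := hPle w y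
    have h4 := hKN (y - w)
    rw [norm_sub_rev] at h2 h3
    have h5 : (L + δ) * ‖y - w‖ ≤ (L + δ) * (8 * s) := by linarith
    exact le_of_mul_le_mul_left h5 (by positivity)
  have hNnn : 0 ≤ K * N (y - w) :=
    mul_nonneg hK.le (by simpa using hNg (y - w) 0 (by simp))
  set N' := fderiv ℝ N (y - w) with hN'
  set P' := fderiv ℝ P y with hP'
  have hP'n : ‖P'‖ ≤ δ := norm_fderiv_le_of_lipschitz ℝ hPL
  have hdN : HasFDerivAt N N' (y - w) := (hNd _).hasFDerivAt
  refine ⟨w, hWQ y, y, -(K • N' + P'), ?_, hyw.trans hs8, ?_, ?_⟩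
  · intro ε hε
    have hd : HasFDerivAt (fun z => K * N (z - w) + P z) (K • N' + P') y :=
      ((HasFDerivAt.comp y hdN ((hasFDerivAt_id y).sub_const w)).const_mul K).add
        (hPd y).hasFDerivAt
    filter_upwards [hd.eventually_abs_sub_le hε] with z hz
    have h1 := hmin2 z w (hWQ y)
    have h2 := (le_abs_self _).trans hz
    have h3 : (-(K • N' + P')) (z - y) = -((K • N' + P') (z - y)) := rfl
    rw [h3]
    linarith
  · intro w' hw'
    have h1 := hmin2 w' w' hw'
    rw [sub_self, hN0, mul_zero, add_zero] at h1
    have h2 := hfle w y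
    have h3 := hPle w y
    have h4 := hPle w' w
    rw [norm_sub_rev] at h2 h3
    have h5 : ‖w' - w‖ ≤ 2 * R := by
      have := norm_sub_le w' w
      have := hR w' hw'
      have := hR w (hWQ y)
      linarith
    have h6 : (δ : ℝ) * ‖w' - w‖ ≤ δ * (2 * R) := by gcongr
    have h7 : ((L : ℝ) + δ) * ‖y - w‖ ≤ (L + δ) * (8 * s) := by gcongr
    linarith
  · have hd : HasFDerivAt (fun w' => K * N (y - w')) (-(K • N')) w := by
      have h1 := (HasFDerivAt.comp w hdN ((hasFDerivAt_id w).const_sub y)).const_mul K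
      refine h1.congr_fderiv ?_
      ext v
      simp
    filter_upwards [(hd.eventually_abs_sub_le (half_pos hη)).filter_mono nhdsWithin_le_nhds,
      self_mem_nhdsWithin] with w' hw' hw'Q
    have h1 := hmin2 y w' hw'Q
    have h2 := (le_abs_self _).trans hw'
    have h3 : (-(K • N' + P')) (w' - w) = (-(K • N')) (w' - w) - P' (w' - w) := by
      simp; ring
    have h4 : P' (w' - w) ≤ ‖P'‖ * ‖w' - w‖ :=
      (abs_le.1 (P'.le_opNorm (w' - w))).2
    have h5 : ‖P'‖ * ‖w' - w‖ ≤ η / 2 * ‖w' - w‖ := by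
      gcongr
      exact hP'n.trans hδ2
    rw [h3]
    linarith

end FuzzySum

section LimitingSubdifferential

variable {X : Type u} [NormedAddCommGroup X] [NormedSpace ℝ X]

lemma limitingSubdiff_subset_of_eventuallyEq {f g : X → ℝ} {x : X} (h : f =ᶠ[𝓝 x] g) :
    limitingSubdiff f x ⊆ limitingSubdiff g x := by
  rintro p ⟨xk, pk, hx, hp, hk⟩
  obtain ⟨k₀, hk₀⟩ := eventually_atTop.1 (hx.eventually (eventually_eventually_nhds.2 h))
  refine ⟨fun k => xk (k + k₀), fun k => pk (k + k₀), (tendsto_add_atTop_iff_nat k₀).2 hx,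
    fun z => (tendsto_add_atTop_iff_nat k₀).2 (hp z), fun k => (hk (k + k₀)).trans_eq ?_⟩
  have h1 : f =ᶠ[𝓝 (xk (k + k₀))] g := hk₀ _ (Nat.le_add_left _ _)
  refine liminf_congr ?_
  filter_upwards [h1.filter_mono nhdsWithin_le_nhds] with y hy
  rw [hy, h1.eq_of_nhds]

lemma limitingSubdiff_congr {f g : X → ℝ} {x : X} (h : f =ᶠ[𝓝 x] g) :
    limitingSubdiff f x = limitingSubdiff g x :=
  (limitingSubdiff_subset_of_eventuallyEq h).antisymm
    (limitingSubdiff_subset_of_eventuallyEq h.symm)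

lemma tendsto_add_smul_nhds (x h : X) :
    Tendsto (fun p : X × ℝ => p.1 + p.2 • h) (𝓝 x ×ˢ 𝓝[>] (0 : ℝ)) (𝓝 x) := by
  have h1 : Continuous fun p : X × ℝ => p.1 + p.2 • h := by fun_prop
  have h2 := h1.tendsto (x, 0)
  rw [nhds_prod_eq] at h2
  simp only [zero_smul, add_zero] at h2
  exact h2.mono_left (prod_mono le_rfl nhdsWithin_le_nhds)

lemma clarkeDD_congr {f g : X → ℝ} {x : X} (h : f =ᶠ[𝓝 x] g) (z : X) :
    clarkeDD f x z = clarkeDD g x z := by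
  refine limsup_congr ?_
  filter_upwards [(tendsto_add_smul_nhds x z).eventually h, tendsto_fst.eventually h] with p h1 h2
  rw [h1, h2]

lemma abs_clarke_quotient_le {f : X → ℝ} {L : ℝ≥0} (hf : LipschitzWith L f) (x z : X) :
    ∀ᶠ p : X × ℝ in 𝓝 x ×ˢ 𝓝[>] (0 : ℝ), |(f (p.1 + p.2 • z) - f p.1) / p.2| ≤ L * ‖z‖ := by
  filter_upwards [tendsto_snd.eventually (self_mem_nhdsWithin (a := (0 : ℝ)) (s := Ioi 0))]
    with p hp
  have hp : 0 < p.2 := hp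
  rw [abs_div, abs_of_pos hp, div_le_iff₀ hp]
  have := hf.dist_le_mul (p.1 + p.2 • z) p.1
  rw [Real.dist_eq, dist_eq_norm, add_sub_cancel_left, norm_smul, Real.norm_of_nonneg hp.le] at this
  linarith

lemma isBoundedUnder_le_clarke {f : X → ℝ} {L : ℝ≥0} (hf : LipschitzWith L f) (x z : X) :
    IsBoundedUnder (· ≤ ·) (𝓝 x ×ˢ 𝓝[>] (0 : ℝ))
      fun p : X × ℝ => (f (p.1 + p.2 • z) - f p.1) / p.2 :=
  isBoundedUnder_of_eventually_le
    ((abs_clarke_quotient_le hf x z).mono fun _ h => (abs_le.1 h).2)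

lemma isBoundedUnder_ge_clarke {f : X → ℝ} {L : ℝ≥0} (hf : LipschitzWith L f) (x z : X) :
    IsBoundedUnder (· ≥ ·) (𝓝 x ×ˢ 𝓝[>] (0 : ℝ))
      fun p : X × ℝ => (f (p.1 + p.2 • z) - f p.1) / p.2 :=
  isBoundedUnder_of_eventually_ge
    ((abs_clarke_quotient_le hf x z).mono fun _ h => (abs_le.1 h).1)

/-- The lower limit in the definition of the limiting subdifferential describes Fréchet
subgradients. -/
lemma isFrechetSubgradient_iff_liminf {f : X → ℝ} {L : ℝ≥0} (hf : LipschitzWith L f) (y : X)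
    (p : X →L[ℝ] ℝ) : IsFrechetSubgradient f y p ↔
      0 ≤ liminf (fun z => (f z - f y - p (z - y)) / ‖z - y‖) (𝓝[≠] y) := by
  have hb : ∀ z, |(f z - f y - p (z - y)) / ‖z - y‖| ≤ L + ‖p‖ := by
    intro z
    rw [abs_div, abs_norm]
    refine div_le_of_le_mul₀ (norm_nonneg _) (by positivity) ?_
    have h1 := hf.dist_le_mul z y
    rw [Real.dist_eq, dist_eq_norm] at h1
    have h2 : |p (z - y)| ≤ _ := p.le_opNorm (z - y)
    have h3 := abs_sub (f z - f y) (p (z - y))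
    linarith
  constructor
  · intro h
    rcases (𝓝[≠] y).eq_or_neBot with hbot | hne
    · rw [hbot, liminf_eq]
      simp
    · refine le_of_forall_pos_sub_le fun ε hε => ?_
      refine le_liminf_of_le (IsBoundedUnder.isCoboundedUnder_ge
        (isBoundedUnder_of ⟨_, fun z => (abs_le.1 (hb z)).2⟩)) ?_
      filter_upwards [(h ε hε).filter_mono nhdsWithin_le_nhds, self_mem_nhdsWithin] with z hz hzy
      have h1 : 0 < ‖z - y‖ := norm_pos_iff.2 (sub_ne_zero.2 hzy)
      rw [le_div_iff₀ h1]
      linarith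
  · intro h ε hε
    have h1 := eventually_lt_of_lt_liminf ((neg_lt_zero.2 hε).trans_le h)
      (isBoundedUnder_of ⟨_, fun z => (abs_le.1 (hb z)).1⟩)
    rw [eventually_nhdsWithin_iff] at h1
    filter_upwards [h1] with z hz
    by_cases hzy : z = y
    · simp [hzy]
    · have h2 : 0 < ‖z - y‖ := norm_pos_iff.2 (sub_ne_zero.2 hzy)
      have h3 := hz hzy
      rw [lt_div_iff₀ h2] at h3
      linarith

lemma IsFrechetSubgradient.norm_le_of_lipschitzWith {f : X → ℝ} {L : ℝ≥0}
    (hf : LipschitzWith L f) {y : X} {p : X →L[ℝ] ℝ} (h : IsFrechetSubgradient f y p) :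
    ‖p‖ ≤ L := by
  refine h.norm_le L.2 (Eventually.of_forall fun z => ?_)
  have := hf.le_add_mul z y
  rw [dist_eq_norm] at this
  linarith

/-- Limiting subgradients of Lipschitz functions on separable spaces are the weak* cluster points
of Fréchet subgradients. -/
lemma mem_limitingSubdiff_iff [TopologicalSpace.SeparableSpace X] {f : X → ℝ} {L : ℝ≥0}
    (hf : LipschitzWith L f) {x : X} {p : X →L[ℝ] ℝ} :
    p ∈ limitingSubdiff f x ↔ ∀ (s : Finset X), ∀ ε > 0, ∃ y q, IsFrechetSubgradient f y q ∧
      ‖y - x‖ ≤ ε ∧ ∀ z ∈ s, |q z - p z| ≤ ε := by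
  classical
  constructor
  · rintro ⟨xk, pk, hx, hp, hk⟩ s ε hε
    have h1 : ∀ᶠ k in atTop, ∀ z ∈ s, |pk k z - p z| ≤ ε := by
      refine (Finset.eventually_all s).2 fun z _ => ?_
      filter_upwards [Metric.tendsto_nhds.1 (hp z) ε hε] with k hk
      exact hk.le
    obtain ⟨k, h2, h3⟩ := (h1.and (Metric.tendsto_nhds.1 hx ε hε)).exists
    refine ⟨xk k, pk k, (isFrechetSubgradient_iff_liminf hf _ _).2 (hk k), ?_, h2⟩
    rw [← dist_eq_norm]
    exact h3.le
  · intro h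
    set d := TopologicalSpace.denseSeq X
    have hd : DenseRange d := TopologicalSpace.denseRange_denseSeq _
    choose! y q hq hy hqp using fun k : ℕ => h ((Finset.range k).image d)
      (1 / ((k : ℝ) + 1)) (by positivity)
    refine ⟨y, q, ?_, fun z => ?_, fun k => (isFrechetSubgradient_iff_liminf hf _ _).1 (hq k)⟩
    · rw [tendsto_iff_norm_sub_tendsto_zero]
      exact squeeze_zero (fun k => norm_nonneg _) hy tendsto_one_div_add_atTop_nhds_zero_nat
    · rw [Metric.tendsto_nhds]
      intro ε hε
      obtain ⟨i, hi⟩ := hd.exists_dist_lt z (show 0 < ε / (2 * (L + ‖p‖ + 1)) by positivity)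
      have h1 : ∀ᶠ k : ℕ in atTop, 1 / ((k : ℝ) + 1) < ε / 2 :=
        tendsto_one_div_add_atTop_nhds_zero_nat.eventually_lt_const (half_pos hε)
      filter_upwards [h1, eventually_gt_atTop i] with k hk hki
      have h2 := hqp k (d i) (Finset.mem_image_of_mem d (Finset.mem_range.2 hki))
      have h3 : |(q k - p) (z - d i)| ≤ (L + ‖p‖) * ‖z - d i‖ := by
        refine ((q k - p).le_opNorm _).trans (mul_le_mul_of_nonneg_right ?_ (norm_nonneg _))
        exact (norm_sub_le _ _).trans (add_le_add_left
          ((hq k).norm_le_of_lipschitzWith hf) _)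
      have h4 : q k z - p z = (q k (d i) - p (d i)) + (q k - p) (z - d i) := by
        simp only [sub_apply, map_sub]
        ring
      rw [dist_eq_norm, lt_div_iff₀ (by positivity)] at hi
      rw [Real.dist_eq, h4]
      have h5 := abs_add_le (q k (d i) - p (d i)) ((q k - p) (z - d i))
      nlinarith [norm_nonneg (z - d i)]

lemma mem_limitingSubdiff_of_approx [TopologicalSpace.SeparableSpace X] {f : X → ℝ} {L : ℝ≥0}
    (hf : LipschitzWith L f) {x : X} {p : X →L[ℝ] ℝ}
    (h : ∀ (s : Finset X), ∀ ε > 0, ∃ q ∈ limitingSubdiff f x, ∀ z ∈ s, |q z - p z| ≤ ε) :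
    p ∈ limitingSubdiff f x := by
  rw [mem_limitingSubdiff_iff hf]
  intro s ε hε
  obtain ⟨q, hq, hqp⟩ := h s (ε / 2) (half_pos hε)
  obtain ⟨y, r, hr, hy, hrq⟩ := (mem_limitingSubdiff_iff hf).1 hq s (ε / 2) (half_pos hε)
  refine ⟨y, r, hr, by linarith, fun z hz => ?_⟩
  have := abs_sub_le (r z) (q z) (p z)
  have := hqp z hz
  have := hrq z hz
  linarith

lemma norm_le_of_mem_limitingSubdiff [TopologicalSpace.SeparableSpace X] {f : X → ℝ} {L : ℝ≥0}
    (hf : LipschitzWith L f) {x : X} {p : X →L[ℝ] ℝ} (hp : p ∈ limitingSubdiff f x) :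
    ‖p‖ ≤ L := by
  refine ContinuousLinearMap.opNorm_le_bound _ L.2 fun z => ?_
  refine le_of_forall_pos_le_add fun ε hε => ?_
  obtain ⟨y, q, hq, -, hqp⟩ := (mem_limitingSubdiff_iff hf).1 hp {z} ε hε
  have h1 := hqp z (Finset.mem_singleton_self z)
  have h2 := q.le_of_opNorm_le (hq.norm_le_of_lipschitzWith hf) z
  rw [Real.norm_eq_abs] at h2 ⊢
  have h3 := abs_sub_abs_le_abs_sub (p z) (q z)
  rw [abs_sub_comm] at h3
  exact (by linarith : |p z| ≤ L * ‖z‖ + ε)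

lemma apply_le_clarkeDD_of_mem_limitingSubdiff [TopologicalSpace.SeparableSpace X] {f : X → ℝ}
    {L : ℝ≥0} (hf : LipschitzWith L f) {x : X} {p : X →L[ℝ] ℝ} (hp : p ∈ limitingSubdiff f x)
    (z : X) : p z ≤ clarkeDD f x z := by
  refine le_of_forall_pos_sub_le fun ε hε => ?_
  refine le_limsup_of_frequently_le ?_ (isBoundedUnder_le_clarke hf x z)
  intro hev
  obtain ⟨P, hP, R, hR, hPR⟩ := Filter.eventually_prod_iff.1 hev
  obtain ⟨ρ, hρ, hball⟩ := Metric.eventually_nhds_iff.1 hP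
  obtain ⟨y, q, hq, hy, hqp⟩ := (mem_limitingSubdiff_iff hf).1 hp {z} (min (ε / 2) (ρ / 2))
    (by positivity)
  have h1 := (abs_le.1 ((hqp z (Finset.mem_singleton_self z)).trans (min_le_left _ _))).1
  have hPy : P y := hball (by
    rw [dist_eq_norm]
    have := hy.trans (min_le_right _ _)
    linarith)
  set c := ε / (2 * (‖z‖ + 1)) with hc
  have hc0 : 0 < c := by positivity
  have hcz : c * ‖z‖ ≤ ε / 2 := by
    rw [hc, div_mul_eq_mul_div, div_le_iff₀ (by positivity)]
    nlinarith [norm_nonneg z]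
  have ht : Tendsto (fun t : ℝ => y + t • z) (𝓝[>] 0) (𝓝 y) := by
    have h2 : Continuous fun t : ℝ => y + t • z := by fun_prop
    have h3 := h2.tendsto 0
    rw [zero_smul, add_zero] at h3
    exact h3.mono_left nhdsWithin_le_nhds
  obtain ⟨t, ⟨h2, h3⟩, ht0⟩ :=
    (((ht.eventually (hq c hc0)).and hR).and self_mem_nhdsWithin).exists
  have ht0 : 0 < t := ht0
  refine hPR hPy h3 ?_
  rw [add_sub_cancel_left, norm_smul, Real.norm_of_nonneg ht0.le, map_smul, smul_eq_mul] at h2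
  simp only
  rw [le_div_iff₀ ht0]
  have h4 := mul_le_mul_of_nonneg_left (show p z - ε ≤ q z - c * ‖z‖ by linarith) ht0.le
  linarith

end LimitingSubdifferential

section MeanValue

variable {X : Type u} [NormedAddCommGroup X] [NormedSpace ℝ X] [CompleteSpace X]
  [TopologicalSpace.SeparableSpace X] [TopologicalSpace.SeparableSpace (X →L[ℝ] ℝ)]

/-- Approximate mean value inequality. -/
lemma exists_frechet_mean_value {f : X → ℝ} {L : ℝ≥0} (hf : LipschitzWith L f) {a h : X} {r : ℝ}
    (hr : r < f (a + h) - f a) (hh : h ≠ 0) {ε : ℝ} (hε : 0 < ε) :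
    ∃ t ∈ Icc (0 : ℝ) 1, ∃ y q, IsFrechetSubgradient f y q ∧ ‖y - (a + t • h)‖ ≤ ε ∧
      r - ε * ‖h‖ ≤ q h := by
  obtain ⟨e, he⟩ := SeparatingDual.exists_eq_one (R := ℝ) hh
  set γ := f (a + h) - f a - r with hγ
  have hγ0 : 0 < γ := by linarith
  have hQ : IsCompact ((fun t : ℝ => a + t • h) '' Icc 0 1) :=
    isCompact_Icc.image (by fun_prop)
  obtain ⟨w, ⟨t, ht, rfl⟩, y, q, hq, hyw, hmin, hev⟩ := exists_fuzzy_minimizer hf hQ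
    ⟨a, 0, by simp, by simp⟩ (g := fun w => -r * e (w - a))
    (Continuous.continuousOn (by fun_prop)) (lt_min hε (half_pos hγ0))
  refine ⟨t, ht, y, q, hq, hyw.trans (min_le_left _ _), ?_⟩
  have hval : ∀ t : ℝ, -r * e (a + t • h - a) = -r * t := by
    intro t
    rw [add_sub_cancel_left, map_smul, he]
    simp
  have ht1 : t < 1 := by
    refine lt_of_le_of_ne ht.2 fun h1 => ?_
    have h2 := hmin a ⟨0, by simp, by simp⟩
    have h3 := hval t
    simp only at h2
    rw [h3, h1, one_smul, sub_self, map_zero] at h2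
    have h4 := min_le_right ε (γ / 2)
    linarith
  have hlim : Tendsto (fun t' : ℝ => a + t' • h) (𝓝[>] t)
      (𝓝[(fun t : ℝ => a + t • h) '' Icc 0 1] (a + t • h)) := by
    refine tendsto_nhdsWithin_iff.2 ⟨?_, ?_⟩
    · have h1 : Continuous fun t' : ℝ => a + t' • h := by fun_prop
      exact (h1.tendsto t).mono_left nhdsWithin_le_nhds
    · filter_upwards [Ioo_mem_nhdsGT ht1] with t' ht'
      exact ⟨t', ⟨ht.1.trans ht'.1.le, ht'.2.le⟩, rfl⟩
  obtain ⟨t', h1, h2⟩ := ((hlim.eventually hev).and self_mem_nhdsWithin).exists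
  have h2 : 0 < t' - t := sub_pos.2 h2
  have h3 : a + t' • h - (a + t • h) = (t' - t) • h := by rw [sub_smul]; abel
  have h4 := hval t
  have h5 := hval t'
  simp only at h1
  rw [h3, h4, h5, norm_smul, Real.norm_of_nonneg h2.le, map_smul, smul_eq_mul] at h1
  have h6 : min ε (γ / 2) * ((t' - t) * ‖h‖) ≤ ε * ((t' - t) * ‖h‖) := by
    gcongr
    exact min_le_left _ _
  refine le_of_mul_le_mul_left ?_ h2
  linarith

/-- Clarke's directional derivative is the support function of the limiting subdifferential. -/
lemma exists_mem_limitingSubdiff_apply_eq {f : X → ℝ} {L : ℝ≥0} (hf : LipschitzWith L f)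
    (x z : X) : ∃ p ∈ limitingSubdiff f x, p z = clarkeDD f x z := by
  suffices h : ∃ p ∈ limitingSubdiff f x, clarkeDD f x z ≤ p z by
    obtain ⟨p, hp, hpz⟩ := h
    exact ⟨p, hp, (apply_le_clarkeDD_of_mem_limitingSubdiff hf hp z).antisymm hpz⟩
  have key : ∀ k : ℕ, ∃ y q, IsFrechetSubgradient f y q ∧
      ‖y - x‖ ≤ (2 + ‖z‖) * (1 / ((k : ℝ) + 1)) ∧
      clarkeDD f x z - (1 / ((k : ℝ) + 1)) * (1 + ‖z‖) ≤ q z := by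
    intro k
    set ε : ℝ := 1 / ((k : ℝ) + 1) with hε_def
    have hε : 0 < ε := by positivity
    by_cases hz : z = 0
    · obtain ⟨w, hw, y, q, hq, hyw, -⟩ := exists_fuzzy_minimizer hf (isCompact_singleton (x := x))
        (singleton_nonempty x) (g := fun _ => 0) continuousOn_const hε
      rw [mem_singleton_iff.1 hw] at hyw
      refine ⟨y, q, hq, ?_, ?_⟩
      · nlinarith [norm_nonneg z]
      · have h0 : clarkeDD f x z ≤ 0 := by
          refine limsup_le_of_le (isBoundedUnder_ge_clarke hf x z).isCoboundedUnder_le ?_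
          exact Eventually.of_forall fun p => by simp [hz]
        rw [hz] at h0 ⊢
        simp only [map_zero, norm_zero]
        linarith
    · have h1 := frequently_lt_of_lt_limsup (isBoundedUnder_ge_clarke hf x z).isCoboundedUnder_le
        (sub_lt_self (clarkeDD f x z) hε)
      have h2 : ∀ᶠ p : X × ℝ in 𝓝 x ×ˢ 𝓝[>] (0 : ℝ), dist p.1 x < ε ∧ p.2 ∈ Ioo 0 ε :=
        (tendsto_fst.eventually (Metric.ball_mem_nhds x hε)).and
          (tendsto_snd.eventually (Ioo_mem_nhdsGT hε))
      obtain ⟨⟨a, θ⟩, h3, h4, h5⟩ := (h1.and_eventually h2).exists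
      simp only at h3 h4 h5
      rw [lt_div_iff₀ h5.1] at h3
      obtain ⟨t, ht, y, q, hq, hy, hqz⟩ := exists_frechet_mean_value hf h3
        (smul_ne_zero h5.1.ne' hz) hε
      refine ⟨y, q, hq, ?_, ?_⟩
      · have h6 : y - x = (y - (a + t • θ • z)) + ((a - x) + t • θ • z) := by abel
        rw [dist_eq_norm] at h4
        have h7 : ‖t • θ • z‖ ≤ ε * ‖z‖ := by
          rw [norm_smul, norm_smul, Real.norm_of_nonneg ht.1, Real.norm_of_nonneg h5.1.le]
          calc t * (θ * ‖z‖) ≤ 1 * (ε * ‖z‖) := by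
                gcongr
                · exact mul_nonneg h5.1.le (norm_nonneg _)
                · exact ht.2
                · exact h5.2.le
            _ = ε * ‖z‖ := one_mul _
        rw [h6]
        have h8 := norm_add_le (y - (a + t • θ • z)) ((a - x) + t • θ • z)
        have h9 := norm_add_le (a - x) (t • θ • z)
        linarith
      · rw [map_smul, smul_eq_mul, norm_smul, Real.norm_of_nonneg h5.1.le] at hqz
        refine le_of_mul_le_mul_left ?_ h5.1
        linarith
  choose y q hq hy hqz using key
  obtain ⟨p, -, σ, hσ, hp⟩ := exists_subseq_tendsto_apply
    (fun k => (hq k).norm_le_of_lipschitzWith hf)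
  have h0 := tendsto_one_div_add_atTop_nhds_zero_nat (𝕜 := ℝ)
  refine ⟨p, ⟨y ∘ σ, q ∘ σ, ?_, hp, fun k => (isFrechetSubgradient_iff_liminf hf _ _).1 (hq _)⟩, ?_⟩
  · have h1 : Tendsto y atTop (𝓝 x) := by
      rw [tendsto_iff_norm_sub_tendsto_zero]
      refine squeeze_zero (fun k => norm_nonneg _) hy ?_
      simpa using h0.const_mul (2 + ‖z‖)
    exact h1.comp hσ.tendsto_atTop
  · have h1 : Tendsto (fun k : ℕ => clarkeDD f x z - (1 / ((k : ℝ) + 1)) * (1 + ‖z‖)) atTop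
        (𝓝 (clarkeDD f x z)) := by
      simpa using (h0.mul_const (1 + ‖z‖)).const_sub (clarkeDD f x z)
    exact le_of_tendsto_of_tendsto (h1.comp hσ.tendsto_atTop) (hp z)
      (Eventually.of_forall fun k => hqz (σ k))

/-- Functionals below the lower Dini derivative of a Lipschitz function are limiting
subgradients. -/
lemma mem_limitingSubdiff_of_le_dini {f : X → ℝ} {L : ℝ≥0} (hf : LipschitzWith L f) {x : X}
    {p : X →L[ℝ] ℝ}
    (hp : ∀ z, ∀ ε > 0, ∀ᶠ θ in 𝓝[>] (0 : ℝ), p z - ε ≤ (f (x + θ • z) - f x) / θ) :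
    p ∈ limitingSubdiff f x := by
  rw [mem_limitingSubdiff_iff hf]
  intro s ε hε
  set F : Submodule ℝ X := Submodule.span ℝ (s : Set X) with hF
  have hproper : ProperSpace F := FiniteDimensional.proper_real F
  obtain ⟨C, hC0, hC⟩ : ∃ C : ℝ, 0 < C ∧ ∀ z ∈ s, ‖z‖ ≤ C := by
    refine ⟨1 + ∑ z ∈ s, ‖z‖, by positivity, fun z hz => ?_⟩
    have := Finset.single_le_sum (f := fun z : X => ‖z‖) (fun i _ => norm_nonneg i) hz
    linarith
  set c := min ε (ε / (3 * C)) with hc_def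
  have hc : 0 < c := by positivity
  have hcC : 3 * c * C ≤ ε := by
    have : c ≤ ε / (3 * C) := min_le_right _ _
    rw [le_div_iff₀ (by positivity)] at this
    linarith
  have hflow : ∀ a b, f a ≤ f b + L * ‖a - b‖ := fun a b => by
    simpa [dist_eq_norm] using hf.le_add_mul a b
  obtain ⟨ρ, hρ, hunif⟩ : ∃ ρ > 0, ∀ v : F, ‖v‖ ≤ ρ → p v - c * ‖v‖ ≤ f (x + v) - f x := by
    obtain ⟨T, hTS, hT, hcov⟩ := (isCompact_sphere (0 : F) 1).finite_cover_balls
      (show 0 < c / (2 * (L + ‖p‖ + 1)) by positivity)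
    have hev : ∀ᶠ θ in 𝓝[>] (0 : ℝ), ∀ u ∈ T,
        p u - c / 2 ≤ (f (x + θ • (u : X)) - f x) / θ :=
      (eventually_all_finite hT).2 fun u _ => hp u (c / 2) (half_pos hc)
    obtain ⟨ρ, hρ, hsub⟩ := mem_nhdsGT_iff_exists_Ioc_subset.1 hev
    refine ⟨ρ, hρ, fun v hv => ?_⟩
    by_cases hv0 : v = 0
    · simp [hv0]
    have hvpos : 0 < ‖v‖ := norm_pos_iff.2 hv0
    have hu : ‖v‖⁻¹ • v ∈ sphere (0 : F) 1 := by
      rw [mem_sphere_zero_iff_norm, norm_smul, norm_inv, norm_norm,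
        inv_mul_cancel₀ hvpos.ne']
    obtain ⟨u, huT, hvu⟩ := mem_iUnion₂.1 (hcov hu)
    have h1 := hsub ⟨hvpos, hv⟩ u huT
    rw [le_div_iff₀ hvpos] at h1
    have h2 : ‖(v : X) - ‖v‖ • (u : X)‖ * (2 * (L + ‖p‖ + 1)) ≤ ‖v‖ * c := by
      rw [mem_ball, lt_div_iff₀ (by positivity), Subtype.dist_eq, dist_eq_norm] at hvu
      have h3 : (v : X) - ‖v‖ • (u : X) = ‖v‖ • (((‖v‖⁻¹ • v : F) : X) - u) := by
        rw [smul_sub, Submodule.coe_smul, smul_smul, mul_inv_cancel₀ hvpos.ne', one_smul]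
      rw [h3, norm_smul, norm_norm, mul_assoc]
      exact mul_le_mul_of_nonneg_left hvu.le hvpos.le
    have h4 := hflow (x + ‖v‖ • (u : X)) (x + v)
    rw [add_sub_add_left_eq_sub, norm_sub_rev] at h4
    have h5 : |p ((v : X) - ‖v‖ • (u : X))| ≤ _ := p.le_opNorm _
    have h6 := (le_abs_self _).trans h5
    rw [map_sub, map_smul, smul_eq_mul] at h6
    have h7 := norm_nonneg ((v : X) - ‖v‖ • (u : X))
    nlinarith
  set Q : Set X := (fun v : F => x + (v : X)) '' closedBall (0 : F) ρ with hQ_def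
  have hQ : IsCompact Q := (isCompact_closedBall (0 : F) ρ).image (by fun_prop)
  have hxQ : x ∈ Q := ⟨0, by simp [hρ.le], by simp⟩
  set η := min (min c (ε / 2)) (min (c * ρ / 2) (c * ε / 2)) with hη_def
  have hρ : 0 < ρ := hρ
  have hη : 0 < η := by positivity
  have hηρ : η < c * ρ := by
    have : η ≤ c * ρ / 2 := (min_le_right _ _).trans (min_le_left _ _)
    have : 0 < c * ρ := by positivity
    linarith
  have hηc : η ≤ c := (min_le_left _ _).trans (min_le_left _ _)
  have hηε : η ≤ c * ε / 2 := (min_le_right _ _).trans (min_le_right _ _)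
  obtain ⟨w, ⟨v, hv, rfl⟩, y, q, hq, hyw, hmin, hev⟩ := exists_fuzzy_minimizer hf hQ ⟨x, hxQ⟩
    (g := fun w => -p (w - x) + 2 * c * ‖w - x‖) (Continuous.continuousOn (by fun_prop)) hη
  simp only [add_sub_cancel_left] at hmin hev hyw
  have hvη : c * ‖v‖ ≤ η := by
    have h1 := hmin x hxQ
    have h2 := hunif v (mem_closedBall_zero_iff.1 hv)
    simp only [sub_self, map_zero, norm_zero] at h1
    have h3 : ‖(v : X)‖ = ‖v‖ := rfl
    rw [h3] at h1
    linarith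
  have hvρ : ‖v‖ < ρ := lt_of_mul_lt_mul_left (hvη.trans_lt hηρ) hc.le
  have hle : ∀ z : F, p z - q z ≤ 3 * c * ‖z‖ := by
    intro z
    have hlim : Tendsto (fun t : ℝ => x + (v : X) + t • (z : X)) (𝓝[>] 0) (𝓝[Q] (x + v)) := by
      refine tendsto_nhdsWithin_iff.2 ⟨?_, ?_⟩
      · have h1 : Continuous fun t : ℝ => x + (v : X) + t • (z : X) := by fun_prop
        have h2 := h1.tendsto 0
        rw [zero_smul, add_zero] at h2
        exact h2.mono_left nhdsWithin_le_nhds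
      · have h1 : Continuous fun t : ℝ => ‖v + t • z‖ := by fun_prop
        have h2 := h1.tendsto 0
        rw [zero_smul, add_zero] at h2
        filter_upwards [(h2.mono_left nhdsWithin_le_nhds).eventually_lt_const hvρ] with t ht
        exact ⟨v + t • z, mem_closedBall_zero_iff.2 ht.le, by simp [add_assoc]⟩
    obtain ⟨t, h1, ht⟩ := ((hlim.eventually hev).and self_mem_nhdsWithin).exists
    have ht : 0 < t := ht
    have h2 : x + (v : X) + t • (z : X) - (x + v) = t • (z : X) := by abel
    have h3 : x + (v : X) + t • (z : X) - x = v + t • (z : X) := by abel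
    rw [h2, h3] at h1
    have h4 := norm_add_le (v : X) (t • (z : X))
    have h5 := mul_le_mul_of_nonneg_left h4 (show 0 ≤ 2 * c by positivity)
    have h6 : ‖t • (z : X)‖ = t * ‖z‖ := by
      rw [norm_smul, Real.norm_of_nonneg ht.le]
      rfl
    rw [h6] at h1 h5
    rw [map_add, map_smul, map_smul, smul_eq_mul, smul_eq_mul] at h1
    have h7 : η * (t * ‖z‖) ≤ c * (t * ‖z‖) :=
      mul_le_mul_of_nonneg_right hηc (by positivity)
    refine le_of_mul_le_mul_left ?_ ht
    linarith
  refine ⟨y, q, hq, ?_, fun z hz => ?_⟩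
  · have h1 : ‖v‖ ≤ ε / 2 := by
      refine le_of_mul_le_mul_left ?_ hc
      linarith
    have h2 : y - x = (y - (x + v)) + v := by abel
    have h3 := norm_add_le (y - (x + v)) (v : X)
    have h4 : ‖(v : X)‖ = ‖v‖ := rfl
    have h5 : η ≤ ε / 2 := (min_le_left _ _).trans (min_le_right _ _)
    rw [h2]
    linarith
  · set z' : F := ⟨z, Submodule.subset_span hz⟩
    have h1 := hle z'
    have h2 := hle (-z')
    have h3 : ‖z'‖ ≤ C := hC z hz
    have h4 : 3 * c * ‖z'‖ ≤ 3 * c * C := by gcongr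
    rw [norm_neg, Submodule.coe_neg, map_neg, map_neg] at h2
    have h5 : (z' : X) = z := rfl
    rw [h5] at h1 h2
    rw [abs_le]
    constructor <;> linarith

end MeanValue

section ExtremePoints

lemma isCompact_convexJoin {E : Type*} [AddCommGroup E] [Module ℝ E] [TopologicalSpace E]
    [ContinuousAdd E] [ContinuousSMul ℝ E] {s t : Set E} (hs : IsCompact s) (ht : IsCompact t) :
    IsCompact (convexJoin ℝ s t) := by
  have h1 : convexJoin ℝ s t =
      (fun w : ℝ × E × E => (1 - w.1) • w.2.1 + w.1 • w.2.2) '' (Icc 0 1 ×ˢ s ×ˢ t) := by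
    ext q
    simp only [mem_convexJoin, segment_eq_image, mem_image, mem_prod, Prod.exists]
    constructor
    · rintro ⟨a, ha, b, hb, θ, hθ, rfl⟩
      exact ⟨θ, a, b, ⟨hθ, ha, hb⟩, rfl⟩
    · rintro ⟨θ, a, b, ⟨hθ, ha, hb⟩, rfl⟩
      exact ⟨a, ha, b, hb, θ, hθ, rfl⟩
  rw [h1]
  exact (isCompact_Icc.prod (hs.prod ht)).image (by fun_prop)

/-- A finite family of compact convex sets is contained in a compact convex set all of whose
points that are extreme in some larger convex set belong to the family. -/
lemma exists_isCompact_convex_superset {E ι : Type*} [AddCommGroup E] [Module ℝ E]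
    [TopologicalSpace E] [ContinuousAdd E] [ContinuousSMul ℝ E] (s : Finset ι) (K : ι → Set E)
    (hK : ∀ i ∈ s, IsCompact (K i)) (hKc : ∀ i ∈ s, Convex ℝ (K i)) :
    ∃ M, IsCompact M ∧ Convex ℝ M ∧ (∀ i ∈ s, K i ⊆ M) ∧
      ∀ C, Convex ℝ C → (∀ i ∈ s, K i ⊆ C) →
        M ⊆ C ∧ ∀ q ∈ M, q ∈ C.extremePoints ℝ → ∃ i ∈ s, q ∈ K i := by
  classical
  induction s using Finset.induction_on with
  | empty => exact ⟨∅, isCompact_empty, convex_empty, by simp, by simp⟩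
  | insert d s hd ih =>
    obtain ⟨M, hM, hMc, hKM, hMC⟩ := ih (fun i hi => hK i (Finset.mem_insert_of_mem hi))
      (fun i hi => hKc i (Finset.mem_insert_of_mem hi))
    have hd1 := hK d (Finset.mem_insert_self d s)
    have hd2 := hKc d (Finset.mem_insert_self d s)
    rcases (K d).eq_empty_or_nonempty with he | hne
    · refine ⟨M, hM, hMc, ?_, fun C hC h => ?_⟩
      · intro i hi
        rcases Finset.mem_insert.1 hi with rfl | hi
        · simp [he]
        · exact hKM i hi
      · obtain ⟨h1, h2⟩ := hMC C hC fun i hi => h i (Finset.mem_insert_of_mem hi)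
        exact ⟨h1, fun q hq hqe => (h2 q hq hqe).imp fun i hi =>
          ⟨Finset.mem_insert_of_mem hi.1, hi.2⟩⟩
    rcases M.eq_empty_or_nonempty with rfl | hMne
    · refine ⟨K d, hd1, hd2, ?_, fun C hC h => ⟨h d (Finset.mem_insert_self d s), fun q hq _ =>
        ⟨d, Finset.mem_insert_self d s, hq⟩⟩⟩
      intro i hi
      rcases Finset.mem_insert.1 hi with rfl | hi
      · exact subset_rfl
      · exact (hKM i hi).trans (empty_subset _)
    refine ⟨convexJoin ℝ (K d) M, isCompact_convexJoin hd1 hM, hd2.convexJoin hMc, ?_,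
      fun C hC h => ?_⟩
    · intro i hi
      rcases Finset.mem_insert.1 hi with rfl | hi
      · exact subset_convexJoin_left hMne
      · exact (hKM i hi).trans (subset_convexJoin_right hne)
    · obtain ⟨h1, h2⟩ := hMC C hC fun i hi => h i (Finset.mem_insert_of_mem hi)
      have h3 := h d (Finset.mem_insert_self d s)
      refine ⟨convexJoin_subset h3 h1 hC, fun q hq hqe => ?_⟩
      obtain ⟨a, ha, b, hb, hqab⟩ := mem_convexJoin.1 hq
      rcases (mem_extremePoints_iff_forall_segment.1 hqe).2 a (h3 ha) b (h1 hb) hqab with rfl | rfl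
      · exact ⟨d, Finset.mem_insert_self d s, ha⟩
      · exact (h2 b hb hqe).imp fun i hi => ⟨Finset.mem_insert_of_mem hi.1, hi.2⟩

variable {X : Type u} [NormedAddCommGroup X] [NormedSpace ℝ X]

lemma isCompact_setOf_forall_apply_le {L : ℝ} {s : X → ℝ}
    (hs : ∀ z, s z ≤ L * ‖z‖) :
    IsCompact {q : WeakDual ℝ X | ∀ z, q z ≤ s z} := by
  refine (WeakDual.isCompact_closedBall (𝕜 := ℝ) (0 : X →L[ℝ] ℝ) (max L 0)).of_isClosed_subset ?_ ?_
  · simp only [Set.ofPred_forall]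
    exact isClosed_iInter fun z => isClosed_le (WeakDual.eval_continuous z) continuous_const
  · intro q hq
    have h1 : ‖WeakDual.toStrongDual q‖ ≤ max L 0 := by
      refine ContinuousLinearMap.opNorm_le_bound _ (le_max_right _ _) fun z => ?_
      have h2 : L * ‖z‖ ≤ max L 0 * ‖z‖ := by
        gcongr
        exact le_max_left _ _
      have h3 : q z ≤ s z := hq z
      have h4 : q (-z) ≤ s (-z) := hq (-z)
      have h5 := hs (-z)
      rw [norm_neg] at h5
      rw [map_neg] at h4
      have h6 := hs z
      rw [Real.norm_eq_abs, abs_le]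
      constructor
      · change _ ≤ q z
        linarith
      · change q z ≤ _
        linarith
    simpa using h1

/-- A form of Milman's theorem: a set of functionals that is closed for pointwise convergence
contains the extreme points of the convex set determined by its support function. -/
theorem mem_of_extreme_of_forall_apply_le {L : ℝ} {s : X → ℝ} {Γ : Set (X →L[ℝ] ℝ)}
    (hs : ∀ z, s z ≤ L * ‖z‖) (hle : ∀ p ∈ Γ, ∀ z, p z ≤ s z)
    (hattain : ∀ z, ∃ p ∈ Γ, p z = s z)
    (hclosed : ∀ p : X →L[ℝ] ℝ,
      (∀ (t : Finset X), ∀ ε > 0, ∃ q ∈ Γ, ∀ z ∈ t, |q z - p z| ≤ ε) → p ∈ Γ)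
    {p : X →L[ℝ] ℝ} (hp : ∀ z, p z ≤ s z)
    (hext : ∀ v : X →L[ℝ] ℝ, (∀ z, p z + v z ≤ s z) → (∀ z, p z - v z ≤ s z) → v = 0) :
    p ∈ Γ := by
  classical
  have hlc : LocallyConvexSpace ℝ (WeakDual ℝ X) :=
    WeakBilin.locallyConvexSpace (B := topDualPairing ℝ X)
  by_contra hpΓ
  have h1 := mt (hclosed p) hpΓ
  push Not at h1
  obtain ⟨t, ε, hε, ht⟩ := h1
  set C : Set (WeakDual ℝ X) := {q | ∀ z, q z ≤ s z} with hCdef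
  have hCc : Convex ℝ C := by
    intro q hq r hr a b ha hb hab z
    have h2 : (a • q + b • r) z = a * q z + b * r z := rfl
    rw [h2]
    calc a * q z + b * r z ≤ a * s z + b * s z := by
          have := hq z
          have := hr z
          gcongr
      _ = s z := by rw [← add_mul, hab, one_mul]
  have hCk : IsCompact C := isCompact_setOf_forall_apply_le hs
  let K : X → Set (WeakDual ℝ X) := fun d => C ∩ {q | p d + ε ≤ q d}
  have hcl : ∀ d, IsClosed {q : WeakDual ℝ X | p d + ε ≤ q d} := fun d =>
    isClosed_le continuous_const (WeakDual.eval_continuous d)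
  have hcv : ∀ d, Convex ℝ {q : WeakDual ℝ X | p d + ε ≤ q d} := by
    intro d q hq r hr a b ha hb hab
    have h2 : (a • q + b • r) d = a * q d + b * r d := rfl
    have hq : p d + ε ≤ q d := hq
    have hr : p d + ε ≤ r d := hr
    rw [Set.mem_ofPred_eq, h2]
    calc p d + ε = a * (p d + ε) + b * (p d + ε) := by rw [← add_mul, hab, one_mul]
      _ ≤ _ := by gcongr
  obtain ⟨M, hM, hMc, hKM, hMC⟩ := exists_isCompact_convex_superset (t ∪ t.image Neg.neg) K
    (fun d _ => hCk.inter_right (hcl d)) (fun d _ => hCc.inter (hcv d))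
  obtain ⟨-, hMext⟩ := hMC C hCc fun d _ => inter_subset_left
  let p' : WeakDual ℝ X := wstar p
  have hp'C : p' ∈ C := hp
  have hp'M : p' ∈ M := by
    by_contra hn
    obtain ⟨f, c, hf, hc⟩ := geometric_hahn_banach_closed_point hMc hM.isClosed hn
    obtain ⟨z, hz⟩ := LinearMap.dualEmbedding_surjective (topDualPairing ℝ X) f
    have hz' : ∀ q : WeakDual ℝ X, f q = q z := fun q => by rw [← hz]; rfl
    obtain ⟨q, hq, hqz⟩ := hattain z
    obtain ⟨d, hd, hdε⟩ := ht q hq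
    have hqM : wstar q ∈ M := by
      rcases le_total 0 (q d - p d) with h0 | h0
      · rw [abs_of_nonneg h0] at hdε
        refine hKM d (Finset.mem_union_left _ hd) ⟨hle q hq, ?_⟩
        change p d + ε ≤ q d
        linarith
      · rw [abs_of_nonpos h0] at hdε
        refine hKM (-d) (Finset.mem_union_right _ (Finset.mem_image_of_mem _ hd)) ⟨hle q hq, ?_⟩
        change p (-d) + ε ≤ q (-d)
        rw [map_neg, map_neg]
        linarith
    have h2 := hf _ hqM
    rw [hz'] at h2 hc
    have h3 : q z < c := h2
    have h4 : c < p z := hc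
    have h5 := hp z
    linarith
  have hp'e : p' ∈ C.extremePoints ℝ := by
    refine mem_extremePoints.2 ⟨hp'C, fun a ha b hb hab => ?_⟩
    obtain ⟨α, β, hα, hβ, hαβ, hab⟩ := hab
    set m := min α β
    have hm : 0 < m := lt_min hα hβ
    let a' : X →L[ℝ] ℝ := WeakDual.toStrongDual a
    let b' : X →L[ℝ] ℝ := WeakDual.toStrongDual b
    have hab' : ∀ z, p z = α * a' z + β * b' z := fun z => by
      have : p' z = (α • a + β • b) z := by rw [hab]
      exact this
    have ha' : ∀ z, a' z ≤ s z := ha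
    have hb' : ∀ z, b' z ≤ s z := hb
    have hmα : m ≤ α := min_le_left _ _
    have hmβ : m ≤ β := min_le_right _ _
    have hv : m • (a' - b') = 0 := by
      refine hext _ (fun z => ?_) fun z => ?_
      · have h2 : (m • (a' - b')) z = m * (a' z - b' z) := rfl
        rw [h2, hab']
        have h3 := mul_le_mul_of_nonneg_left (ha' z) (show 0 ≤ α + m by positivity)
        have h4 := mul_le_mul_of_nonneg_left (hb' z) (show 0 ≤ β - m by linarith)
        have h5 : (α + m) * s z + (β - m) * s z = s z := by
          rw [← add_mul, show α + m + (β - m) = α + β by ring, hαβ, one_mul]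
        linarith
      · have h2 : (m • (a' - b')) z = m * (a' z - b' z) := rfl
        rw [h2, hab']
        have h3 := mul_le_mul_of_nonneg_left (ha' z) (show 0 ≤ α - m by linarith)
        have h4 := mul_le_mul_of_nonneg_left (hb' z) (show 0 ≤ β + m by positivity)
        have h5 : (α - m) * s z + (β + m) * s z = s z := by
          rw [← add_mul, show α - m + (β + m) = α + β by ring, hαβ, one_mul]
        linarith
    have heq : a' = b' := sub_eq_zero.1 ((smul_eq_zero.1 hv).resolve_left hm.ne')
    have hpa : p = a' := by
      ext z
      rw [hab' z, ← heq, ← add_mul, hαβ, one_mul]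
    exact ⟨hpa.symm, heq.symm.trans hpa.symm⟩
  obtain ⟨d, -, hd⟩ := hMext p' hp'M hp'e
  have h2 : p d + ε ≤ p d := hd.2
  linarith

end ExtremePoints

section SublinearIntegrand

variable {X : Type u} [NormedAddCommGroup X] [NormedSpace ℝ X]
variable {Ω : Type v} [MeasurableSpace Ω] {μ : Measure Ω}

/-- A bounded additive map on a dense subgroup extends to a continuous linear functional. -/
lemma exists_continuousLinearMap_eq_of_denseRange {I : Type*} [AddCommGroup I] (e : I →+ X)
    (he : DenseRange e) {G : I → ℝ} {c : ℝ≥0} (hadd : ∀ i j, G (i + j) = G i + G j)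
    (hle : ∀ i, G i ≤ c * ‖e i‖) :
    ∃ u : X →L[ℝ] ℝ, ∀ i, u (e i) = G i := by
  classical
  have hG0 : G 0 = 0 := by
    have := hadd 0 0
    rw [add_zero] at this
    linarith
  have hneg : ∀ i, G (-i) = -G i := fun i => by
    have := hadd i (-i)
    rw [add_neg_cancel, hG0] at this
    linarith
  have hdist : ∀ i j, |G i - G j| ≤ c * ‖e i - e j‖ := fun i j => by
    have h1 := hle (i - j)
    have h2 := hle (j - i)
    rw [map_sub, sub_eq_add_neg, hadd, hneg, ← sub_eq_add_neg] at h1 h2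
    rw [norm_sub_rev] at h2
    rw [abs_le]
    constructor <;> linarith
  choose r hr using fun y : range e => y.2
  have hlip : LipschitzOnWith c (fun x => if h : x ∈ range e then G (r ⟨x, h⟩) else 0)
      (range e) := by
    refine LipschitzOnWith.of_dist_le_mul fun x hx y hy => ?_
    simp only [dif_pos hx, dif_pos hy]
    have := hdist (r ⟨x, hx⟩) (r ⟨y, hy⟩)
    rw [hr, hr] at this
    rwa [Real.dist_eq, dist_eq_norm]
  obtain ⟨u, hu, huG⟩ := hlip.extend_real
  have hue : ∀ i, u (e i) = G i := fun i => by
    rw [← huG (mem_range_self i)]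
    simp only [mem_range_self, dif_pos]
    have h1 := hdist (r ⟨e i, mem_range_self i⟩) i
    rw [hr, sub_self, norm_zero, mul_zero] at h1
    exact sub_eq_zero.1 (abs_nonpos_iff.1 h1)
  have huadd : ∀ x y, u (x + y) = u x + u y := by
    intro x y
    refine he.induction_on₂ (p := fun x y => u (x + y) = u x + u y) ?_ ?_ x y
    · have := hu.continuous
      exact isClosed_eq (by fun_prop) (by fun_prop)
    · intro i j
      rw [← map_add, hue, hue, hue, hadd]
  have hu0 : u 0 = 0 := by
    have := huadd 0 0
    rw [add_zero] at this
    linarith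
  exact ⟨(AddMonoidHom.mk ⟨u, hu0⟩ huadd).toRealLinearMap hu.continuous, hue⟩

/-- A measurable family of sublinear functionals with an integrable bound. -/
structure IsSublinearIntegrand (μ : Measure Ω) (s : Ω → X → ℝ) (l : Ω → ℝ) : Prop where
  integrable_bound : Integrable l μ
  nonneg : ∀ ω, 0 ≤ l ω
  measurable : ∀ z, Measurable fun ω => s ω z
  add_le : ∀ ω y z, s ω (y + z) ≤ s ω y + s ω z
  smul : ∀ ω (c : ℝ), 0 < c → ∀ z, s ω (c • z) = c * s ω z
  le : ∀ ω z, s ω z ≤ l ω * ‖z‖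

namespace IsSublinearIntegrand

variable {s : Ω → X → ℝ} {l : Ω → ℝ}

lemma zero (hs : IsSublinearIntegrand μ s l) (ω : Ω) : s ω 0 = 0 := by
  have := hs.smul ω 2 two_pos 0
  rw [smul_zero] at this
  linarith

lemma abs_le (hs : IsSublinearIntegrand μ s l) (ω : Ω) (z : X) : |s ω z| ≤ l ω * ‖z‖ := by
  have h1 := hs.add_le ω z (-z)
  have h2 := hs.le ω (-z)
  rw [add_neg_cancel, hs.zero] at h1
  rw [norm_neg] at h2
  exact _root_.abs_le.2 ⟨by linarith, hs.le ω z⟩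

lemma abs_sub_le (hs : IsSublinearIntegrand μ s l) (ω : Ω) (y z : X) :
    |s ω y - s ω z| ≤ l ω * ‖y - z‖ := by
  have h1 := hs.add_le ω z (y - z)
  have h2 := hs.add_le ω y (z - y)
  have h3 := hs.le ω (y - z)
  have h4 := hs.le ω (z - y)
  rw [norm_sub_rev] at h4
  rw [add_sub_cancel] at h1 h2
  rw [_root_.abs_le]
  constructor <;> linarith

lemma continuous (hs : IsSublinearIntegrand μ s l) (ω : Ω) : Continuous (s ω) := by
  refine LipschitzWith.continuous (K := ⟨l ω, hs.nonneg ω⟩)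
    (LipschitzWith.of_dist_le_mul fun y z => ?_)
  rw [Real.dist_eq, dist_eq_norm]
  exact hs.abs_sub_le ω y z

lemma integrable (hs : IsSublinearIntegrand μ s l) (z : X) : Integrable (fun ω => s ω z) μ :=
  (hs.integrable_bound.mul_const ‖z‖).mono' (hs.measurable z).aestronglyMeasurable
    (ae_of_all _ fun ω => hs.abs_le ω z)

/-- A linear functional dominated by a sublinear integrand is dominated in absolute value. -/
lemma abs_apply_le (hs : IsSublinearIntegrand μ s l) {ω : Ω} {p : X →L[ℝ] ℝ}
    (hp : ∀ z, p z ≤ s ω z) (z : X) : |p z| ≤ l ω * ‖z‖ := by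
  have h1 := (hp z).trans (hs.le ω z)
  have h2 := (hp (-z)).trans (hs.le ω (-z))
  rw [norm_neg, map_neg] at h2
  exact _root_.abs_le.2 ⟨by linarith, h1⟩

end IsSublinearIntegrand

/-- A finitely additive set function dominated by the indefinite integral of an integrable
function has a density. -/
lemma exists_density_of_abs_le_setIntegral [SigmaFinite μ] {l : Ω → ℝ} (hl : Integrable l μ)
    {m : Set Ω → ℝ}
    (hadd : ∀ A B, MeasurableSet A → MeasurableSet B → Disjoint A B → m (A ∪ B) = m A + m B)
    (hm : ∀ A, MeasurableSet A → |m A| ≤ ∫ ω in A, l ω ∂μ) :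
    ∃ g : Ω → ℝ, Measurable g ∧ Integrable g μ ∧
      ∀ A, MeasurableSet A → ∫ ω in A, g ω ∂μ = m A := by
  classical
  have hempty : m ∅ = 0 := by
    have := hadd ∅ ∅ .empty .empty (disjoint_empty _)
    rw [union_empty] at this
    linarith
  have hfin : ∀ (f : ℕ → Set Ω), (∀ i, MeasurableSet (f i)) → Pairwise (Function.onFun Disjoint f) →
      ∀ t : Finset ℕ, m (⋃ i ∈ t, f i) = ∑ i ∈ t, m (f i) := by
    intro f hf hd t
    induction t using Finset.induction_on with
    | empty => simp [hempty]
    | insert i t hi ih =>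
      rw [Finset.set_biUnion_insert, Finset.sum_insert hi, ← ih]
      refine hadd _ _ (hf i) (Finset.measurableSet_biUnion _ fun j _ => hf j) ?_
      refine Set.disjoint_iUnion₂_right.2 fun j hj => hd ?_
      rintro rfl
      exact hi hj
  let v : SignedMeasure Ω :=
    { measureOf' := fun A => if MeasurableSet A then m A else 0
      empty' := by simp [hempty]
      not_measurable' := fun A hA => if_neg hA
      m_iUnion' := by
        intro f hf hd
        simp only [hf, MeasurableSet.iUnion hf, if_true]
        have h1 := hasSum_integral_iUnion hf hd (hl.integrableOn (s := ⋃ i, f i))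
        have h2 : ∀ t : Finset ℕ, ‖∑ i ∈ t, m (f i) - m (⋃ i, f i)‖ ≤
            ∫ ω in ⋃ i, f i, l ω ∂μ - ∑ i ∈ t, ∫ ω in f i, l ω ∂μ := by
          intro t
          have hsub : ⋃ i ∈ t, f i ⊆ ⋃ i, f i := iUnion₂_subset fun i _ => subset_iUnion f i
          have hmt : MeasurableSet (⋃ i ∈ t, f i) := Finset.measurableSet_biUnion _ fun j _ => hf j
          have hmd := (MeasurableSet.iUnion hf).diff hmt
          have h3 := hadd _ _ hmt hmd disjoint_sdiff_right
          rw [union_sdiff_cancel hsub, hfin f hf hd] at h3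
          have h4 := hm _ hmd
          rw [setIntegral_sdiff hmt hl.integrableOn hsub,
            integral_biUnion_finset t (fun i _ => hf i) (fun i _ j _ hij => hd hij)
              (fun i _ => hl.integrableOn)] at h4
          rw [h3, sub_add_cancel_left, norm_neg]
          exact h4
        have h3 := squeeze_zero_norm h2 (by simpa using h1.const_sub (∫ ω in ⋃ i, f i, l ω ∂μ))
        exact tendsto_sub_nhds_zero_iff.1 h3 }
  have hv : ∀ A, MeasurableSet A → v A = m A := fun A hA => if_pos hA
  have hac : v ≪ᵥ μ.toENNRealVectorMeasure := by
    refine VectorMeasure.AbsolutelyContinuous.mk fun A hA h0 => ?_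
    rw [Measure.toENNRealVectorMeasure_apply_measurable hA] at h0
    have h1 := hm A hA
    rw [Measure.restrict_zero_set h0, integral_zero_measure] at h1
    rw [hv A hA]
    exact abs_nonpos_iff.1 h1
  refine ⟨v.rnDeriv μ, SignedMeasure.measurable_rnDeriv _ _, SignedMeasure.integrable_rnDeriv _ _,
    fun A hA => ?_⟩
  rw [← withDensityᵥ_apply (SignedMeasure.integrable_rnDeriv _ _) hA,
    SignedMeasure.withDensityᵥ_rnDeriv_eq v μ hac, hv A hA]

end SublinearIntegrand

section Representation

variable {X : Type u} [NormedAddCommGroup X] [NormedSpace ℝ X]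
variable {Ω : Type v} [MeasurableSpace Ω] {μ : Measure Ω}

lemma abs_apply_le_of_add {X : Type*} [NormedAddCommGroup X] {f : X → ℝ} {c : ℝ}
    (hadd : ∀ y z, f (y + z) = f y + f z)
    (hle : ∀ z, f z ≤ c * ‖z‖) (z : X) : |f z| ≤ c * ‖z‖ := by
  have h1 := hle z
  have h2 := hle (-z)
  have h3 := hadd 0 0
  have h4 := hadd z (-z)
  rw [add_zero] at h3
  rw [add_neg_cancel] at h4
  rw [norm_neg] at h2
  rw [abs_le]
  constructor <;> linarith

lemma continuous_of_add_of_le {X : Type*} [NormedAddCommGroup X] {f : X → ℝ} {c : ℝ}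
    (hadd : ∀ y z, f (y + z) = f y + f z)
    (hle : ∀ z, f z ≤ c * ‖z‖) : Continuous f := by
  refine LipschitzWith.continuous (K := ⟨max c 0, le_max_right _ _⟩)
    (LipschitzWith.of_dist_le_mul fun y z => ?_)
  have h1 := abs_apply_le_of_add hadd hle (y - z)
  have h2 := hadd (y - z) z
  rw [sub_add_cancel] at h2
  rw [Real.dist_eq, dist_eq_norm, show f y - f z = f (y - z) by linarith]
  refine h1.trans ?_
  gcongr
  exact le_max_left _ _

/-- An additive set function with values in the linear functionals that is dominated by the
indefinite integrals of `s`. -/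
structure IsIntegralMinorant (μ : Measure Ω) (s : Ω → X → ℝ) (m : Set Ω → X → ℝ) : Prop where
  union : ∀ A B, MeasurableSet A → MeasurableSet B → Disjoint A B →
    ∀ z, m (A ∪ B) z = m A z + m B z
  add : ∀ A, MeasurableSet A → ∀ y z, m A (y + z) = m A y + m A z
  le : ∀ A, MeasurableSet A → ∀ z, m A z ≤ ∫ ω in A, s ω z ∂μ

lemma IsIntegralMinorant.le_mul_norm {s : Ω → X → ℝ} {l : Ω → ℝ}
    (hs : IsSublinearIntegrand μ s l) {m : Set Ω → X → ℝ} (hm : IsIntegralMinorant μ s m)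
    {A : Set Ω} (hA : MeasurableSet A) (z : X) : m A z ≤ (∫ ω in A, l ω ∂μ) * ‖z‖ := by
  rw [← integral_mul_const]
  exact (hm.le A hA z).trans (integral_mono (hs.integrable z).integrableOn
    (hs.integrable_bound.mul_const _).integrableOn fun ω => hs.le ω z)

theorem IsIntegralMinorant.exists_density [TopologicalSpace.SeparableSpace X] [IsFiniteMeasure μ]
    {s : Ω → X → ℝ} {l : Ω → ℝ} (hs : IsSublinearIntegrand μ s l) {m : Set Ω → X → ℝ}
    (hm : IsIntegralMinorant μ s m) :
    ∃ u : Ω → X →L[ℝ] ℝ, (∀ z, Measurable fun ω => u ω z) ∧ (∀ᵐ ω ∂μ, ∀ z, u ω z ≤ s ω z) ∧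
      (∀ z, Integrable (fun ω => u ω z) μ) ∧
      ∀ A, MeasurableSet A → ∀ z, ∫ ω in A, u ω z ∂μ = m A z := by
  classical
  let e : (ℕ →₀ ℤ) →+ X :=
    (Finsupp.linearCombination ℤ (TopologicalSpace.denseSeq X)).toAddMonoidHom
  have he : DenseRange e := by
    refine (TopologicalSpace.denseRange_denseSeq X).mono ?_
    rintro _ ⟨n, rfl⟩
    exact ⟨Finsupp.single n 1, by simp [e]⟩
  have hden : ∀ z, ∃ g : Ω → ℝ, Measurable g ∧ Integrable g μ ∧
      ∀ A, MeasurableSet A → ∫ ω in A, g ω ∂μ = m A z := by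
    intro z
    refine exists_density_of_abs_le_setIntegral (hs.integrable_bound.mul_const ‖z‖)
      (fun A B hA hB hAB => hm.union A B hA hB hAB z) fun A hA => ?_
    rw [integral_mul_const]
    exact abs_apply_le_of_add (hm.add A hA) (hm.le_mul_norm hs hA) z
  choose g hgm hgi hgA using hden
  have hae : ∀ᵐ ω ∂μ, (∀ i, g (e i) ω ≤ s ω (e i)) ∧
      ∀ i j, g (e i + e j) ω = g (e i) ω + g (e j) ω := by
    refine (ae_all_iff.2 fun i => ?_).and (ae_all_iff.2 fun i => ae_all_iff.2 fun j => ?_)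
    · refine ae_le_of_forall_setIntegral_le (hgi _) (hs.integrable _) fun A hA _ => ?_
      rw [hgA _ A hA]
      exact hm.le A hA _
    · refine Integrable.ae_eq_of_forall_setIntegral_eq _ _ (hgi _) ((hgi _).add (hgi _))
        fun A hA _ => ?_
      rw [integral_add (hgi _).integrableOn (hgi _).integrableOn, hgA _ A hA, hgA _ A hA,
        hgA _ A hA, hm.add A hA]
  obtain ⟨T, hTae, hTm, hT⟩ := hae.exists_measurable_mem
  have hex : ∀ ω, ∃ u : X →L[ℝ] ℝ, ∀ i, u (e i) = T.indicator (g (e i)) ω := by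
    intro ω
    by_cases hω : ω ∈ T
    · simp only [indicator_of_mem hω]
      refine exists_continuousLinearMap_eq_of_denseRange e he (c := ⟨l ω, hs.nonneg ω⟩)
        (fun i j => ?_) fun i => ((hT ω hω).1 i).trans (hs.le ω _)
      rw [map_add, (hT ω hω).2]
    · exact ⟨0, fun i => by rw [indicator_of_notMem hω]; rfl⟩
  choose u hu using hex
  have hum : ∀ z, Measurable fun ω => u ω z := by
    intro z
    obtain ⟨x, hx, hxz⟩ := mem_closure_iff_seq_limit.1 (he z)
    choose i hi using hx
    refine measurable_of_tendsto_metrizable (f := fun n ω => u ω (x n)) (fun n => ?_)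
      (tendsto_pi_nhds.2 fun ω => ((u ω).continuous.tendsto z).comp hxz)
    simp only [← hi, hu]
    exact (hgm _).indicator hTm
  have hule : ∀ ω ∈ T, ∀ z, u ω z ≤ s ω z := by
    intro ω hω z
    refine he.induction_on (p := fun z => u ω z ≤ s ω z) z
      (isClosed_le (u ω).continuous (hs.continuous ω)) fun i => ?_
    rw [hu, indicator_of_mem hω]
    exact (hT ω hω).1 i
  have hui : ∀ z, Integrable (fun ω => u ω z) μ := fun z =>
    (hs.integrable_bound.mul_const ‖z‖).mono' (hum z).aestronglyMeasurable
      (mem_of_superset hTae fun ω hω => hs.abs_apply_le (hule ω hω) z)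
  refine ⟨u, hum, mem_of_superset hTae hule, hui, fun A hA z => ?_⟩
  refine he.induction_on (p := fun z => ∫ ω in A, u ω z ∂μ = m A z) z
    (isClosed_eq ?_ ?_) fun i => ?_
  · refine continuous_of_add_of_le (c := ∫ ω in A, l ω ∂μ) (fun y z => ?_) fun z => ?_
    · simp only [map_add]
      exact integral_add (hui y).integrableOn (hui z).integrableOn
    · rw [← integral_mul_const]
      exact integral_mono_ae (hui z).integrableOn (hs.integrable_bound.mul_const _).integrableOn
        (ae_restrict_of_ae (mem_of_superset hTae fun ω hω => (hule ω hω z).trans (hs.le ω z)))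
  · exact continuous_of_add_of_le (hm.add A hA) (hm.le_mul_norm hs hA)
  · rw [← hgA _ A hA]
    refine setIntegral_congr_ae hA (mem_of_superset hTae fun ω hω _ => ?_)
    rw [hu, indicator_of_mem hω]

end Representation

section ExtremeDensity

/-- The Hahn–Banach theorem with a prescribed restriction along a linear map. -/
lemma exists_linearMap_le_comp_eq {E Z : Type*} [AddCommGroup E] [Module ℝ E] [AddCommGroup Z]
    [Module ℝ Z] (T : Z →ₗ[ℝ] E) (p : Z →ₗ[ℝ] ℝ) {S : E → ℝ}
    (hsmul : ∀ c : ℝ, 0 < c → ∀ x, S (c • x) = c * S x) (hadd : ∀ x y, S (x + y) ≤ S x + S y)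
    (hle : ∀ z, p z ≤ S (T z)) :
    ∃ F : E →ₗ[ℝ] ℝ, (∀ z, F (T z) = p z) ∧ ∀ x, F x ≤ S x := by
  have hS0 : S 0 = 0 := by
    have := hsmul 2 two_pos 0
    rw [smul_zero] at this
    linarith
  obtain ⟨r, hr⟩ := T.rangeRestrict.exists_rightInverse_of_surjective T.range_rangeRestrict
  have hTr : ∀ y : LinearMap.range T, T (r y) = y := fun y => by
    have h := LinearMap.congr_fun hr y
    exact congrArg Subtype.val h
  obtain ⟨F, hF, hFS⟩ := exists_extension_of_le_sublinear ⟨LinearMap.range T, p ∘ₗ r⟩ S hsmul hadd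
    fun y => by
      have := hle (r y)
      rw [hTr] at this
      exact this
  refine ⟨F, fun z => ?_, hFS⟩
  have h1 : F (T z) = p (r ⟨T z, LinearMap.mem_range_self T z⟩) :=
    hF ⟨T z, LinearMap.mem_range_self T z⟩
  rw [h1]
  set w := r ⟨T z, LinearMap.mem_range_self T z⟩ with hw
  have h2 : T w = T z := hTr ⟨T z, _⟩
  have h3 := hle (w - z)
  have h4 := hle (z - w)
  rw [map_sub, map_sub, h2, sub_self, hS0] at h3 h4
  linarith

variable {X : Type u} [NormedAddCommGroup X] [NormedSpace ℝ X]
variable {Ω : Type v} [MeasurableSpace Ω] {μ : Measure Ω} {s : Ω → X → ℝ} {l : Ω → ℝ}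

lemma IsSublinearIntegrand.integrable_comp (hs : IsSublinearIntegrand μ s l)
    (ξ : SimpleFunc Ω X) : Integrable (fun ω => s ω (ξ ω)) μ := by
  obtain ⟨C, hC⟩ := ξ.exists_forall_norm_le
  refine (hs.integrable_bound.mul_const C).mono'
    (ξ.measurable_bind (fun x ω => s ω x) hs.measurable).aestronglyMeasurable
    (ae_of_all _ fun ω => (hs.abs_le ω _).trans ?_)
  have := hs.nonneg ω
  have := hC ω
  gcongr

lemma exists_isIntegralMinorant (hs : IsSublinearIntegrand μ s l) {p : X →L[ℝ] ℝ}
    (hp : ∀ z, p z ≤ ∫ ω, s ω z ∂μ) :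
    ∃ m, IsIntegralMinorant μ s m ∧ (∀ z, m univ z = p z) ∧
      ∀ A, ¬ MeasurableSet A → ∀ z, m A z = 0 := by
  let T : X →ₗ[ℝ] SimpleFunc Ω X :=
    { toFun := SimpleFunc.const Ω
      map_add' := fun y z => by ext; rfl
      map_smul' := fun c z => by ext; rfl }
  obtain ⟨F, hFT, hF⟩ := exists_linearMap_le_comp_eq T p.toLinearMap
    (S := fun ξ => ∫ ω, s ω (ξ ω) ∂μ)
    (fun c hc ξ => by
      simp only [SimpleFunc.coe_smul, Pi.smul_apply, hs.smul _ c hc]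
      exact integral_const_mul c _)
    (fun ξ η => by
      rw [← integral_add (hs.integrable_comp ξ) (hs.integrable_comp η)]
      exact integral_mono (hs.integrable_comp _)
        ((hs.integrable_comp ξ).add (hs.integrable_comp η)) fun ω => hs.add_le ω _ _) hp
  refine ⟨fun A z => F ((SimpleFunc.const Ω z).restrict A), ⟨?_, ?_, ?_⟩, ?_, ?_⟩
  · intro A B hA hB hAB z
    rw [← map_add]
    congr 1
    ext ω
    simp only [SimpleFunc.coe_add, Pi.add_apply, SimpleFunc.restrict_apply _ hA,
      SimpleFunc.restrict_apply _ hB, SimpleFunc.restrict_apply _ (hA.union hB)]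
    rw [indicator_union_of_disjoint hAB]
  · intro A hA y z
    rw [← map_add]
    congr 1
    ext ω
    simp only [SimpleFunc.coe_add, Pi.add_apply, SimpleFunc.restrict_apply _ hA]
    by_cases hω : ω ∈ A <;> simp [hω]
  · intro A hA z
    refine (hF _).trans_eq ?_
    rw [← integral_indicator hA]
    refine integral_congr_ae (ae_of_all _ fun ω => ?_)
    simp only [SimpleFunc.restrict_apply _ hA]
    by_cases hω : ω ∈ A
    · simp [hω]
    · simp [hω, hs.zero]
  · intro z
    simp only [SimpleFunc.restrict_univ]
    exact hFT z
  · intro A hA z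
    simp only [SimpleFunc.restrict_of_not_measurable hA, map_zero]

/-- The integral minorants with prescribed total mass have an extreme element. -/
lemma exists_extreme_isIntegralMinorant (hs : IsSublinearIntegrand μ s l) {p : X →L[ℝ] ℝ}
    (hp : ∀ z, p z ≤ ∫ ω, s ω z ∂μ) :
    ∃ m, IsIntegralMinorant μ s m ∧ (∀ z, m univ z = p z) ∧
      ∀ θ : Set Ω → X → ℝ, IsIntegralMinorant μ s (m + θ) → IsIntegralMinorant μ s (m - θ) →
        (∀ z, θ univ z = 0) → ∀ A, MeasurableSet A → ∀ z, θ A z = 0 := by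
  classical
  let K : Set (Set Ω → X → ℝ) := {m | IsIntegralMinorant μ s m ∧ (∀ z, m univ z = p z) ∧
      ∀ A, ¬ MeasurableSet A → ∀ z, m A z = 0}
  have hev : ∀ A z, Continuous fun m : Set Ω → X → ℝ => m A z := fun A z => by fun_prop
  have hKcl : IsClosed K := by
    have h1 : K = {m | ∀ A B, MeasurableSet A → MeasurableSet B → Disjoint A B →
          ∀ z, m (A ∪ B) z = m A z + m B z} ∩
        {m | ∀ A, MeasurableSet A → ∀ y z, m A (y + z) = m A y + m A z} ∩
        {m | ∀ A, MeasurableSet A → ∀ z, m A z ≤ ∫ ω in A, s ω z ∂μ} ∩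
        {m | ∀ z, m univ z = p z} ∩ {m | ∀ A, ¬ MeasurableSet A → ∀ z, m A z = 0} := by
      ext m
      exact ⟨fun h => ⟨⟨⟨⟨h.1.1, h.1.2⟩, h.1.3⟩, h.2.1⟩, h.2.2⟩,
        fun h => ⟨⟨h.1.1.1.1, h.1.1.1.2, h.1.1.2⟩, h.1.2, h.2⟩⟩
    rw [h1]
    simp only [Set.ofPred_forall]
    refine IsClosed.inter (IsClosed.inter (IsClosed.inter (IsClosed.inter ?_ ?_) ?_) ?_) ?_
    · refine isClosed_iInter fun A => isClosed_iInter fun B => isClosed_iInter fun _ =>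
        isClosed_iInter fun _ => isClosed_iInter fun _ => isClosed_iInter fun z => ?_
      exact isClosed_eq (hev _ _) ((hev _ _).add (hev _ _))
    · refine isClosed_iInter fun A => isClosed_iInter fun _ => isClosed_iInter fun y =>
        isClosed_iInter fun z => ?_
      exact isClosed_eq (hev _ _) ((hev _ _).add (hev _ _))
    · refine isClosed_iInter fun A => isClosed_iInter fun _ => isClosed_iInter fun z => ?_
      exact isClosed_le (hev _ _) continuous_const
    · exact isClosed_iInter fun z => isClosed_eq (hev _ _) continuous_const
    · refine isClosed_iInter fun A => isClosed_iInter fun _ => isClosed_iInter fun z => ?_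
      exact isClosed_eq (hev _ _) continuous_const
  have hKsub : K ⊆ Set.pi univ fun A => Set.pi univ fun z : X =>
      Icc (-((∫ ω, l ω ∂μ) * ‖z‖)) ((∫ ω, l ω ∂μ) * ‖z‖) := by
    intro m hm A _ z _
    have hl0 : 0 ≤ ∫ ω, l ω ∂μ := integral_nonneg hs.nonneg
    by_cases hA : MeasurableSet A
    · refine abs_le.1 ((abs_apply_le_of_add (hm.1.add A hA) (hm.1.le_mul_norm hs hA) z).trans ?_)
      exact mul_le_mul_of_nonneg_right
        (setIntegral_le_integral hs.integrable_bound (ae_of_all _ hs.nonneg)) (norm_nonneg z)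
    · rw [hm.2.2 A hA]
      have : 0 ≤ (∫ ω, l ω ∂μ) * ‖z‖ := by positivity
      exact ⟨neg_nonpos.2 this, this⟩
  have hKc : IsCompact K := (isCompact_univ_pi fun A => isCompact_univ_pi fun z =>
    isCompact_Icc).of_isClosed_subset hKcl hKsub
  obtain ⟨m, hm⟩ := hKc.extremePoints_nonempty (exists_isIntegralMinorant hs hp)
  obtain ⟨hmK, hmext⟩ := mem_extremePoints.1 hm
  refine ⟨m, hmK.1, hmK.2.1, fun θ h1 h2 h0 A hA z => ?_⟩
  let θ' : Set Ω → X → ℝ := fun A z => if MeasurableSet A then θ A z else 0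
  have hθ' : ∀ A, MeasurableSet A → ∀ z, θ' A z = θ A z := fun A hA z => if_pos hA
  have key : ∀ c : ℝ, IsIntegralMinorant μ s (m + c • θ) → m + c • θ' ∈ K := by
    intro c hc
    refine ⟨⟨fun A B hA hB hAB z => ?_, fun A hA y z => ?_, fun A hA z => ?_⟩, fun z => ?_,
      fun A hA z => ?_⟩
    · have := hc.union A B hA hB hAB z
      simpa only [Pi.add_apply, Pi.smul_apply, hθ' _ hA, hθ' _ hB, hθ' _ (hA.union hB)] using this
    · have := hc.add A hA y z
      simpa only [Pi.add_apply, Pi.smul_apply, hθ' _ hA] using this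
    · have := hc.le A hA z
      simpa only [Pi.add_apply, Pi.smul_apply, hθ' _ hA] using this
    · simp only [Pi.add_apply, Pi.smul_apply, hθ' _ .univ, h0, smul_zero, add_zero, hmK.2.1]
    · simp only [Pi.add_apply, Pi.smul_apply, hmK.2.2 A hA, θ', if_neg hA, smul_zero, add_zero]
  have h3 := key 1 (by rwa [one_smul])
  have h4 := key (-1) (by rwa [neg_one_smul, ← sub_eq_add_neg])
  have h5 := (hmext _ h3 _ h4 ⟨1 / 2, 1 / 2, by norm_num, by norm_num, by norm_num, by module⟩).1
  have h6 := congrFun (congrFun h5 A) z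
  simp only [Pi.add_apply, hθ' _ hA, one_smul] at h6
  linarith

/-- An integral minorant of a sublinear integrand has a density that is extreme. -/
theorem exists_extreme_density [TopologicalSpace.SeparableSpace X] [IsFiniteMeasure μ]
    (hs : IsSublinearIntegrand μ s l) {p : X →L[ℝ] ℝ} (hp : ∀ z, p z ≤ ∫ ω, s ω z ∂μ) :
    ∃ u : Ω → X →L[ℝ] ℝ, (∀ z, Measurable fun ω => u ω z) ∧ (∀ᵐ ω ∂μ, ∀ z, u ω z ≤ s ω z) ∧
      (∀ z, Integrable (fun ω => u ω z) μ) ∧ (∀ z, ∫ ω, u ω z ∂μ = p z) ∧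
      ∀ v : Ω → X →L[ℝ] ℝ, (∀ z, Integrable (fun ω => v ω z) μ) →
        (∀ᵐ ω ∂μ, ∀ z, u ω z + v ω z ≤ s ω z ∧ u ω z - v ω z ≤ s ω z) →
        (∀ z, ∫ ω, v ω z ∂μ = 0) → ∀ z, (fun ω => v ω z) =ᵐ[μ] 0 := by
  obtain ⟨m, hm, hmp, hmext⟩ := exists_extreme_isIntegralMinorant hs hp
  obtain ⟨u, hum, hus, hui, huA⟩ := hm.exists_density hs
  refine ⟨u, hum, hus, hui, fun z => ?_, fun v hvi hvs hv0 z => ?_⟩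
  · rw [← hmp z, ← huA univ .univ z, Measure.restrict_univ]
  have key : ∀ c : ℝ, (∀ᵐ ω ∂μ, ∀ z, u ω z + c * v ω z ≤ s ω z) →
      IsIntegralMinorant μ s (m + c • fun A z => ∫ ω in A, v ω z ∂μ) := by
    intro c hc
    refine ⟨fun A B hA hB hAB z => ?_, fun A hA y z => ?_, fun A hA z => ?_⟩
    · simp only [Pi.add_apply, Pi.smul_apply, smul_eq_mul, hm.union A B hA hB hAB,
        setIntegral_union hAB hB (hvi z).integrableOn (hvi z).integrableOn]
      ring
    · simp only [Pi.add_apply, Pi.smul_apply, smul_eq_mul, hm.add A hA, map_add,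
        integral_add (hvi y).integrableOn (hvi z).integrableOn]
      ring
    · simp only [Pi.add_apply, Pi.smul_apply, smul_eq_mul, ← huA A hA]
      rw [← integral_const_mul, ← integral_add (hui z).integrableOn
        ((hvi z).const_mul c).integrableOn]
      exact integral_mono_ae ((hui z).add ((hvi z).const_mul c)).integrableOn
        (hs.integrable z).integrableOn (ae_restrict_of_ae (hc.mono fun ω h => h z))
  have h1 := hmext (fun A z => ∫ ω in A, v ω z ∂μ)
    (by simpa only [one_smul] using key 1 (hvs.mono fun ω h z => by
      rw [one_mul]
      exact (h z).1))
    (by simpa only [neg_one_smul, ← sub_eq_add_neg] using key (-1) (hvs.mono fun ω h z => by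
      rw [neg_one_mul, ← sub_eq_add_neg]
      exact (h z).2))
    (fun z => by rw [Measure.restrict_univ, hv0])
  exact Integrable.ae_eq_zero_of_forall_setIntegral_eq_zero (hvi z) fun A hA _ => h1 A hA z

end ExtremeDensity

section Saturation

lemma exists_countable_dense_measurableSet {Ω : Type v} [MeasurableSpace Ω]
    [MeasurableSpace.CountablyGenerated Ω] (ν : Measure Ω) [IsFiniteMeasure ν] :
    ∃ 𝒜 : Set (Set Ω), 𝒜.Countable ∧ (∀ t ∈ 𝒜, MeasurableSet t) ∧
      ∀ s, MeasurableSet s → ∀ ε : ℝ, 0 < ε → ∃ t ∈ 𝒜, ν (symmDiff s t) < ENNReal.ofReal ε := by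
  obtain ⟨𝒜, h𝒜c, h𝒜⟩ := exists_countable_measureDense (μ := ν)
  exact ⟨𝒜, h𝒜c, h𝒜.measurable, fun s hs => h𝒜.approx s hs (measure_ne_top _ _)⟩

variable {Ω : Type v} {m m₀ : MeasurableSpace Ω} {ν : Measure Ω}

lemma isSeparable_of_forall_exists_ae_eq [IsFiniteMeasure ν] (hm : m ≤ m₀)
    (hmc : @MeasurableSpace.CountablyGenerated Ω m)
    (h : ∀ A, MeasurableSet A → ∃ B, MeasurableSet[m] B ∧ A =ᵐ[ν] B) :
    MeasureTheory.IsSeparable ν := by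
  obtain ⟨𝒜, h𝒜c, h𝒜m, h𝒜⟩ := @exists_countable_dense_measurableSet Ω m hmc (ν.trim hm) _
  refine ⟨𝒜, h𝒜c, fun s hs => hm _ (h𝒜m s hs), fun s hs _ ε hε => ?_⟩
  obtain ⟨B, hB, hsB⟩ := h s hs
  obtain ⟨t, ht, hBt⟩ := h𝒜 B hB ε hε
  refine ⟨t, ht, ?_⟩
  rw [trim_measurableSet_eq hm (hB.symmDiff (h𝒜m t ht))] at hBt
  rwa [measure_congr (hsB.symmDiff (ae_eq_refl t))]

lemma exists_bounded_orthogonal_of_le [IsFiniteMeasure ν] (hm : m ≤ m₀)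
    (hmc : @MeasurableSpace.CountablyGenerated Ω m)
    (hν : ¬ TopologicalSpace.SeparableSpace (Lp ℝ 1 ν)) {g : ℕ → Ω → ℝ}
    (hgm : ∀ n, Measurable[m] (g n)) (hgi : ∀ n, Integrable (g n) ν) :
    ∃ h : Ω → ℝ, Measurable h ∧ (∀ᵐ ω ∂ν, |h ω| ≤ 1) ∧ ¬ h =ᵐ[ν] 0 ∧
      ∀ n, ∫ ω, h ω * g n ω ∂ν = 0 := by
  classical
  have hex : ∃ A, MeasurableSet A ∧ ∀ B, MeasurableSet[m] B → ¬ A =ᵐ[ν] B := by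
    by_contra! hcon
    have h1 : MeasureTheory.IsSeparable ν := isSeparable_of_forall_exists_ae_eq hm hmc hcon
    have h2 : Fact ((1 : ℝ≥0∞) ≠ ∞) := ⟨ENNReal.one_ne_top⟩
    have h3 : SecondCountableTopology (Lp ℝ 1 ν) := inferInstance
    exact hν inferInstance
  obtain ⟨A, hA, hAB⟩ := hex
  let a : Ω → ℝ := A.indicator 1
  have ham : Measurable a := measurable_one.indicator hA
  have ha0 : ∀ ω, 0 ≤ a ω := fun ω => indicator_nonneg (fun _ _ => zero_le_one) ω
  have ha1 : ∀ ω, a ω ≤ 1 := fun ω => indicator_le_self' (fun _ _ => zero_le_one) ω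
  have habs : ∀ ω, ‖a ω‖ ≤ 1 := fun ω => by
    rw [Real.norm_of_nonneg (ha0 ω)]
    exact ha1 ω
  have hai : Integrable a ν := Integrable.of_bound ham.aestronglyMeasurable 1 (ae_of_all _ habs)
  let w : Ω → ℝ := ν[a | m]
  have hwm : StronglyMeasurable[m] w := stronglyMeasurable_condExp
  have hw0 : ∀ᵐ ω ∂ν, 0 ≤ w ω := condExp_nonneg (ae_of_all _ ha0)
  have hw1 : ∀ᵐ ω ∂ν, w ω ≤ 1 := by
    have h1 := condExp_mono (m := m) hai (integrable_const (1 : ℝ)) (ae_of_all ν ha1)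
    rw [condExp_const hm] at h1
    exact h1
  refine ⟨fun ω => a ω - w ω, ham.sub (hwm.mono hm).measurable, ?_, fun h0 => ?_, fun n => ?_⟩
  · filter_upwards [hw0, hw1] with ω h1 h2
    have := ha0 ω
    have := ha1 ω
    rw [abs_le]
    constructor <;> linarith
  · refine hAB (w ⁻¹' {1}) (hwm.measurable (measurableSet_singleton 1)) ?_
    refine eventuallyEq_set.2 ?_
    filter_upwards [h0] with ω hω
    have hω : a ω - w ω = 0 := hω
    by_cases hωA : ω ∈ A
    · have h1 : a ω = 1 := indicator_of_mem hωA _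
      simp only [hωA, true_iff, mem_preimage, mem_singleton_iff]
      linarith
    · have h1 : a ω = 0 := indicator_of_notMem hωA _
      simp only [hωA, false_iff, mem_preimage, mem_singleton_iff]
      linarith
  · have h1 : Integrable (a * g n) ν := (hgi n).bdd_mul ham.aestronglyMeasurable
      (ae_of_all _ habs)
    have h2 := condExp_mul_of_stronglyMeasurable_right (hgm n).stronglyMeasurable h1 hai
    have h3 := integral_condExp (μ := ν) hm (f := a * g n)
    have h4 : Integrable (w * g n) ν := integrable_condExp.congr h2
    rw [integral_congr_ae h2] at h3
    simp only [sub_mul]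
    exact (integral_sub h1 h4).trans (sub_eq_zero.2 h3.symm)

/-- A measure with nonseparable `L¹` admits a nonzero bounded function orthogonal to any given
sequence of integrable functions. -/
lemma exists_bounded_orthogonal [IsFiniteMeasure ν]
    (hν : ¬ TopologicalSpace.SeparableSpace (Lp ℝ 1 ν)) {g : ℕ → Ω → ℝ}
    (hgm : ∀ n, Measurable (g n)) (hgi : ∀ n, Integrable (g n) ν) :
    ∃ h : Ω → ℝ, Measurable h ∧ (∀ᵐ ω ∂ν, |h ω| ≤ 1) ∧ ¬ h =ᵐ[ν] 0 ∧
      ∀ n, ∫ ω, h ω * g n ω ∂ν = 0 :=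
  exists_bounded_orthogonal_of_le (m := MeasurableSpace.comap (fun ω n => g n ω) inferInstance)
    (measurable_pi_lambda _ hgm).comap_le (MeasurableSpace.CountablyGenerated.comap _) hν
    (fun n => (measurable_pi_apply n).comp (comap_measurable fun ω n => g n ω)) hgi

end Saturation

section InfimalConvolution

variable {X : Type u} [NormedAddCommGroup X] [TopologicalSpace.SeparableSpace X]

/-- The infimal convolution of two functions, computed along a dense sequence. -/
def seqInfConv (P Q : X → ℝ) (z : X) : ℝ :=
  ⨅ n, P (TopologicalSpace.denseSeq X n) + Q (z - TopologicalSpace.denseSeq X n)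

variable {P Q : X → ℝ}

lemma seqInfConv_le (hP : Continuous P) (hQ : Continuous Q) (hP0 : ∀ z, 0 ≤ P z)
    (hQ0 : ∀ z, 0 ≤ Q z) (a z : X) : seqInfConv P Q z ≤ P a + Q (z - a) := by
  refine (TopologicalSpace.denseRange_denseSeq X).induction_on
    (p := fun a => seqInfConv P Q z ≤ P a + Q (z - a)) a ?_ fun n => ?_
  · exact isClosed_le continuous_const (by fun_prop)
  · exact ciInf_le ⟨0, by
      rintro _ ⟨n, rfl⟩
      exact add_nonneg (hP0 _) (hQ0 _)⟩ n

lemma le_seqInfConv {c : ℝ} {z : X} (h : ∀ a, c ≤ P a + Q (z - a)) : c ≤ seqInfConv P Q z :=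
  le_ciInf fun _ => h _

lemma exists_lt_seqInfConv_add (P Q : X → ℝ) (z : X) {ε : ℝ} (hε : 0 < ε) :
    ∃ a, P a + Q (z - a) < seqInfConv P Q z + ε := by
  obtain ⟨n, hn⟩ := exists_lt_of_ciInf_lt (lt_add_of_pos_right (seqInfConv P Q z) hε)
  exact ⟨_, hn⟩

lemma seqInfConv_add_le (hP : Continuous P) (hQ : Continuous Q) (hP0 : ∀ z, 0 ≤ P z)
    (hQ0 : ∀ z, 0 ≤ Q z) (hPa : ∀ y z, P (y + z) ≤ P y + P z)
    (hQa : ∀ y z, Q (y + z) ≤ Q y + Q z) (y z : X) :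
    seqInfConv P Q (y + z) ≤ seqInfConv P Q y + seqInfConv P Q z := by
  refine le_of_forall_pos_le_add fun ε hε => ?_
  obtain ⟨a, ha⟩ := exists_lt_seqInfConv_add P Q y (half_pos hε)
  obtain ⟨b, hb⟩ := exists_lt_seqInfConv_add P Q z (half_pos hε)
  have h1 := seqInfConv_le hP hQ hP0 hQ0 (a + b) (y + z)
  have h2 := hPa a b
  have h3 := hQa (y - a) (z - b)
  rw [show y - a + (z - b) = y + z - (a + b) by abel] at h3
  linarith

lemma seqInfConv_smul [NormedSpace ℝ X] (hP : Continuous P) (hQ : Continuous Q) (hP0 : ∀ z, 0 ≤ P z)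
    (hQ0 : ∀ z, 0 ≤ Q z) (hPs : ∀ c : ℝ, 0 < c → ∀ z, P (c • z) = c * P z)
    (hQs : ∀ c : ℝ, 0 < c → ∀ z, Q (c • z) = c * Q z) {c : ℝ} (hc : 0 < c) (z : X) :
    seqInfConv P Q (c • z) = c * seqInfConv P Q z := by
  have key : ∀ c : ℝ, 0 < c → ∀ z, seqInfConv P Q (c • z) ≤ c * seqInfConv P Q z := by
    intro c hc z
    rw [← div_le_iff₀' hc]
    refine le_seqInfConv fun a => ?_
    rw [div_le_iff₀' hc, mul_add, ← hPs c hc, ← hQs c hc, smul_sub]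
    exact seqInfConv_le hP hQ hP0 hQ0 _ _
  refine (key c hc z).antisymm ?_
  have h1 := key c⁻¹ (inv_pos.2 hc) (c • z)
  rw [inv_smul_smul₀ hc.ne'] at h1
  rwa [← div_eq_inv_mul, le_div_iff₀' hc] at h1

end InfimalConvolution

section ExtremePoints

variable {X : Type u} [NormedAddCommGroup X] [NormedSpace ℝ X] [TopologicalSpace.SeparableSpace X]
variable {Ω : Type v} [MeasurableSpace Ω] {μ : Measure Ω}

/-- A nonnegative sublinear integrand that does not vanish in a direction dominates, up to bounded
scalar factors, a field of functionals with zero integral that does not vanish in that direction,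
provided that the measure is saturated. -/
lemma IsSublinearIntegrand.exists_integral_eq_zero [IsFiniteMeasure μ] {s : Ω → X → ℝ} {l : Ω → ℝ}
    (hs : IsSublinearIntegrand μ s l) (hsat : Saturated μ) {d : X} (hd : 0 < ∫ ω, s ω d ∂μ)
    (hd' : 0 ≤ ∫ ω, s ω (-d) ∂μ) :
    ∃ w : Ω → X →L[ℝ] ℝ, (∀ z, Integrable (fun ω => w ω z) μ) ∧
      (∀ᵐ ω ∂μ, ∃ c : ℝ, |c| ≤ 1 ∧ ∃ v : X →L[ℝ] ℝ, w ω = c • v ∧ ∀ z, v z ≤ s ω z) ∧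
      (∀ z, ∫ ω, w ω z ∂μ = 0) ∧ ¬ (fun ω => w ω d) =ᵐ[μ] 0 := by
  set S : X → ℝ := fun z => ∫ ω, s ω z ∂μ with hS
  have hSsmul : ∀ c : ℝ, 0 < c → ∀ z, S (c • z) = c * S z := fun c hc z => by
    simp only [hS, hs.smul _ c hc, integral_const_mul]
  have hSadd : ∀ y z, S (y + z) ≤ S y + S z := fun y z => by
    simp only [hS]
    rw [← integral_add (hs.integrable y) (hs.integrable z)]
    exact integral_mono (hs.integrable _) ((hs.integrable y).add (hs.integrable z))
      fun ω => hs.add_le ω y z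
  have hSle : ∀ z, S z ≤ (∫ ω, l ω ∂μ) * ‖z‖ := fun z => by
    rw [← integral_mul_const]
    exact integral_mono (hs.integrable z) (hs.integrable_bound.mul_const _) fun ω => hs.le ω z
  obtain ⟨F, hFd, hFle⟩ := exists_linearMap_le_comp_eq (LinearMap.toSpanSingleton ℝ X d)
    (S d • LinearMap.id) hSsmul hSadd fun t => by
      simp only [LinearMap.smul_apply, LinearMap.id_apply, smul_eq_mul,
        LinearMap.toSpanSingleton_apply]
      rcases lt_trichotomy t 0 with ht | rfl | ht
      · have h1 := hSsmul (-t) (neg_pos.2 ht) (-d)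
        rw [neg_smul_neg] at h1
        rw [h1]
        nlinarith
      · simp [hS, hs.zero]
      · rw [hSsmul t ht, mul_comm]
  have hFd : F d = S d := by simpa using hFd 1
  let p : X →L[ℝ] ℝ := F.mkContinuous (∫ ω, l ω ∂μ)
    (abs_apply_le_of_add F.map_add fun z => (hFle z).trans (hSle z))
  obtain ⟨v, hvm, hvs, hvi, hvp, -⟩ := exists_extreme_density hs (p := p) hFle
  let E : Set Ω := {ω | v ω d ≠ 0}
  have hE : MeasurableSet E := (hvm d) (measurableSet_singleton 0).compl
  have hEpos : 0 < μ E := by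
    refine pos_iff_ne_zero.2 fun h0 => hd.ne' ?_
    have h1 : (fun ω => v ω d) =ᵐ[μ] 0 := h0
    rw [show ∫ ω, s ω d ∂μ = p d from hFd.symm, ← hvp d, integral_congr_ae h1]
    simp
  obtain ⟨h, hhm, hh1, hh0, hhv⟩ := exists_bounded_orthogonal (hsat E hE hEpos)
    (fun n => hvm (TopologicalSpace.denseSeq X n)) fun n => (hvi _).restrict
  let c : Ω → ℝ := E.indicator h
  have hcm : Measurable c := hhm.indicator hE
  have hc1 : ∀ᵐ ω ∂μ, |c ω| ≤ 1 := by
    filter_upwards [(ae_restrict_iff' hE).1 hh1] with ω hω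
    by_cases hωE : ω ∈ E
    · rw [show c ω = h ω from indicator_of_mem hωE _]
      exact hω hωE
    · rw [show c ω = 0 from indicator_of_notMem hωE _]
      simp
  have hwi : ∀ z, Integrable (fun ω => c ω * v ω z) μ := fun z =>
    (hvi z).bdd_mul hcm.aestronglyMeasurable hc1
  have hw0 : ∀ z, ∫ ω, c ω * v ω z ∂μ = 0 := by
    have hcont : Continuous fun z => ∫ ω, c ω * v ω z ∂μ := by
      refine continuous_of_add_of_le (c := ∫ ω, l ω ∂μ) (fun y z => ?_) fun z => ?_
      · simp only [map_add, mul_add]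
        exact integral_add (hwi y) (hwi z)
      · rw [← integral_mul_const]
        refine integral_mono_ae (hwi z) (hs.integrable_bound.mul_const _) ?_
        filter_upwards [hc1, hvs] with ω h1 h2
        refine (le_abs_self _).trans ?_
        rw [abs_mul]
        have := hs.abs_apply_le h2 z
        nlinarith [abs_nonneg (v ω z)]
    refine fun z => (TopologicalSpace.denseRange_denseSeq X).induction_on
      (p := fun z => ∫ ω, c ω * v ω z ∂μ = 0) z ?_ fun n => ?_
    · exact isClosed_eq hcont continuous_const
    · rw [← hhv n, ← integral_indicator hE]
      refine integral_congr_ae (ae_of_all _ fun ω => ?_)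
      simp only [c, indicator]
      split_ifs <;> simp
  refine ⟨fun ω => c ω • v ω, hwi, ?_, hw0, fun h0 => hh0 ?_⟩
  · filter_upwards [hc1, hvs] with ω h1 h2
    exact ⟨c ω, h1, v ω, rfl, h2⟩
  · refine (ae_restrict_iff' hE).2 ?_
    filter_upwards [h0] with ω hω hωE
    have h1 : c ω * v ω d = 0 := hω
    rw [show c ω = h ω from indicator_of_mem hωE _] at h1
    exact (mul_eq_zero.1 h1).resolve_right hωE

/-- The infimal convolution measuring the freedom of `u ω` inside the convex set with support
function `s ω`. -/
lemma IsSublinearIntegrand.indicator_seqInfConv {s : Ω → X → ℝ} {l : Ω → ℝ}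
    (hs : IsSublinearIntegrand μ s l) {u : Ω → X →L[ℝ] ℝ} (hum : ∀ z, Measurable fun ω => u ω z)
    {G : Set Ω} (hG : MeasurableSet G) (hu : ∀ ω ∈ G, ∀ z, u ω z ≤ s ω z) :
    IsSublinearIntegrand μ (fun ω z => G.indicator (fun ω =>
      seqInfConv (fun a => s ω a - u ω a) (fun b => s ω (-b) + u ω b) z) ω)
      fun ω => 2 * l ω := by
  have hP : ∀ ω, Continuous fun a => s ω a - u ω a := fun ω =>
    (hs.continuous ω).sub (u ω).continuous
  have hQ : ∀ ω, Continuous fun b => s ω (-b) + u ω b := fun ω =>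
    ((hs.continuous ω).comp continuous_neg).add (u ω).continuous
  have hP0 : ∀ ω ∈ G, ∀ a, 0 ≤ s ω a - u ω a := fun ω hω a => sub_nonneg.2 (hu ω hω a)
  have hQ0 : ∀ ω ∈ G, ∀ b, 0 ≤ s ω (-b) + u ω b := fun ω hω b => by
    have := hu ω hω (-b)
    rw [map_neg] at this
    linarith
  refine ⟨hs.integrable_bound.const_mul 2, fun ω => by linarith [hs.nonneg ω], fun z => ?_,
    fun ω y z => ?_, fun ω c hc z => ?_, fun ω z => ?_⟩
  · refine Measurable.indicator (Measurable.iInf fun n => ?_) hG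
    exact ((hs.measurable _).sub (hum _)).add ((hs.measurable _).add (hum _))
  · by_cases hω : ω ∈ G
    · simp only [indicator_of_mem hω]
      refine seqInfConv_add_le (hP ω) (hQ ω) (hP0 ω hω) (hQ0 ω hω) (fun y z => ?_)
        (fun y z => ?_) y z
      · have := hs.add_le ω y z
        rw [map_add]
        linarith
      · have := hs.add_le ω (-y) (-z)
        rw [map_add, neg_add]
        linarith
    · simp [indicator_of_notMem hω]
  · by_cases hω : ω ∈ G
    · simp only [indicator_of_mem hω]
      refine seqInfConv_smul (hP ω) (hQ ω) (hP0 ω hω) (hQ0 ω hω) (fun c hc z => ?_)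
        (fun c hc z => ?_) hc z
      · rw [hs.smul ω c hc, map_smul, smul_eq_mul, mul_sub]
      · rw [← smul_neg, hs.smul ω c hc, map_smul, smul_eq_mul, mul_add]
    · simp [indicator_of_notMem hω]
  · by_cases hω : ω ∈ G
    · simp only [indicator_of_mem hω]
      refine (seqInfConv_le (hP ω) (hQ ω) (hP0 ω hω) (hQ0 ω hω) z z).trans ?_
      have h1 := hs.le ω z
      have h2 := _root_.abs_le.1 (hs.abs_apply_le (hu ω hω) z)
      simp only [sub_self, neg_zero, hs.zero, map_zero]
      linarith [h2.1]
    · rw [indicator_of_notMem hω]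
      have := hs.nonneg ω
      positivity

/-- Over a saturated measure space, an extreme density takes extreme values. -/
lemma ae_extreme_of_extreme_density [IsFiniteMeasure μ] {s : Ω → X → ℝ} {l : Ω → ℝ}
    (hs : IsSublinearIntegrand μ s l) (hsat : Saturated μ) {u : Ω → X →L[ℝ] ℝ}
    (hum : ∀ z, Measurable fun ω => u ω z) (hus : ∀ᵐ ω ∂μ, ∀ z, u ω z ≤ s ω z)
    (hext : ∀ v : Ω → X →L[ℝ] ℝ, (∀ z, Integrable (fun ω => v ω z) μ) →
      (∀ᵐ ω ∂μ, ∀ z, u ω z + v ω z ≤ s ω z ∧ u ω z - v ω z ≤ s ω z) →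
      (∀ z, ∫ ω, v ω z ∂μ = 0) → ∀ z, (fun ω => v ω z) =ᵐ[μ] 0) :
    ∀ᵐ ω ∂μ, ∀ v : X →L[ℝ] ℝ, (∀ z, u ω z + v z ≤ s ω z) → (∀ z, u ω z - v z ≤ s ω z) →
      v = 0 := by
  obtain ⟨G, hGae, hGm, hG⟩ := hus.exists_measurable_mem
  have hσ := hs.indicator_seqInfConv hum hGm hG
  set σ : Ω → X → ℝ := fun ω z => G.indicator (fun ω =>
      seqInfConv (fun a => s ω a - u ω a) (fun b => s ω (-b) + u ω b) z) ω with hσdef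
  have hQ0 : ∀ ω ∈ G, ∀ b, 0 ≤ s ω (-b) + u ω b := fun ω hω b => by
    have := hG ω hω (-b)
    rw [map_neg] at this
    linarith
  have hσ0 : ∀ ω z, 0 ≤ σ ω z := fun ω z => by
    simp only [hσdef, indicator]
    split_ifs with hω
    · exact le_seqInfConv fun a => add_nonneg (sub_nonneg.2 (hG ω hω a)) (hQ0 ω hω _)
    · exact le_rfl
  have hσle : ∀ ω ∈ G, ∀ a z, σ ω z ≤ s ω a - u ω a + (s ω (-(z - a)) + u ω (z - a)) := by
    intro ω hω a z
    simp only [hσdef, indicator_of_mem hω]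
    exact seqInfConv_le (P := fun a => s ω a - u ω a) (Q := fun b => s ω (-b) + u ω b)
      ((hs.continuous ω).sub (u ω).continuous)
      (((hs.continuous ω).comp continuous_neg).add (u ω).continuous)
      (fun a => sub_nonneg.2 (hG ω hω a)) (hQ0 ω hω) a z
  have hzero : ∀ d, (fun ω => σ ω d) =ᵐ[μ] 0 := by
    intro d
    by_contra hd
    have hpos : 0 < ∫ ω, σ ω d ∂μ := by
      refine (integral_nonneg fun ω => hσ0 ω d).lt_of_ne fun h => hd ?_
      exact (integral_eq_zero_iff_of_nonneg (fun ω => hσ0 ω d) (hσ.integrable d)).1 h.symm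
    obtain ⟨w, hwi, hwc, hw0, hwd⟩ := hσ.exists_integral_eq_zero hsat hpos
      (integral_nonneg fun ω => hσ0 ω (-d))
    refine hwd (hext w hwi ?_ hw0 d)
    filter_upwards [hwc, hGae] with ω ⟨c, hc, v, hwv, hv⟩ hω z
    have h1 := (hv z).trans (hσle ω hω z z)
    have h2 := (hv (-z)).trans (hσle ω hω 0 (-z))
    simp only [sub_self, neg_zero, hs.zero, map_zero, sub_zero, neg_neg, map_neg] at h1 h2
    have h3 : |v z| ≤ s ω z - u ω z := abs_le.2 ⟨by linarith, by linarith⟩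
    have h4 : |w ω z| ≤ s ω z - u ω z := by
      rw [hwv, smul_apply, smul_eq_mul, abs_mul]
      nlinarith [abs_nonneg (v z)]
    have h5 := abs_le.1 h4
    exact ⟨by linarith [h5.2], by linarith [h5.1]⟩
  have hall : ∀ᵐ ω ∂μ, ∀ n, σ ω (TopologicalSpace.denseSeq X n) = 0 :=
    ae_all_iff.2 fun n => hzero _
  filter_upwards [hall, hGae] with ω hω hωG v hv1 hv2
  have hle : ∀ z, v z ≤ 0 := fun z => by
    refine (TopologicalSpace.denseRange_denseSeq X).induction_on
      (p := fun z => v z ≤ 0) z ?_ fun n => ?_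
    · exact isClosed_le v.continuous continuous_const
    · rw [← hω n, hσdef]
      simp only [indicator_of_mem hωG]
      refine le_seqInfConv fun a => ?_
      have h1 := hv1 a
      have h2 := hv2 (-(TopologicalSpace.denseSeq X n - a))
      simp only [map_neg, map_sub] at h1 h2 ⊢
      linarith
  ext z
  have h1 := hle (-z)
  rw [map_neg] at h1
  exact le_antisymm (hle z) (by linarith [zero_apply (F := X →L[ℝ] ℝ) z])

end ExtremePoints

section LeibnizRule

variable {X : Type u} [NormedAddCommGroup X] [NormedSpace ℝ X]

lemma exists_lipschitzWith_eventuallyEq {X : Type*} [NormedAddCommGroup X] {f : X → ℝ} {x : X}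
    {U : Set X} (hU : U ∈ 𝓝 x) {c : ℝ} (hf : ∀ y ∈ U, ∀ z ∈ U, |f y - f z| ≤ c * ‖y - z‖) :
    ∃ g, LipschitzWith ‖c‖₊ g ∧ f =ᶠ[𝓝 x] g := by
  have h : LipschitzOnWith ‖c‖₊ f U := LipschitzOnWith.of_dist_le_mul fun y hy z hz => by
    rw [Real.dist_eq, dist_eq_norm]
    refine (hf y hy z hz).trans ?_
    gcongr
    exact le_abs_self c
  obtain ⟨g, hg, hfg⟩ := h.extend_real
  exact ⟨g, hg, mem_of_superset hU hfg⟩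

section ClarkeDerivative

variable [CompleteSpace X] [TopologicalSpace.SeparableSpace X]
  [TopologicalSpace.SeparableSpace (X →L[ℝ] ℝ)] {f : X → ℝ} {L : ℝ≥0}

lemma clarkeDD_add_le (hf : LipschitzWith L f) (x y z : X) :
    clarkeDD f x (y + z) ≤ clarkeDD f x y + clarkeDD f x z := by
  obtain ⟨p, hp, hpz⟩ := exists_mem_limitingSubdiff_apply_eq hf x (y + z)
  rw [← hpz, map_add]
  exact add_le_add (apply_le_clarkeDD_of_mem_limitingSubdiff hf hp y)
    (apply_le_clarkeDD_of_mem_limitingSubdiff hf hp z)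

lemma clarkeDD_smul (hf : LipschitzWith L f) (x : X) {c : ℝ} (hc : 0 < c) (z : X) :
    clarkeDD f x (c • z) = c * clarkeDD f x z := by
  obtain ⟨p, hp, hpz⟩ := exists_mem_limitingSubdiff_apply_eq hf x (c • z)
  obtain ⟨q, hq, hqz⟩ := exists_mem_limitingSubdiff_apply_eq hf x z
  refine le_antisymm ?_ ?_
  · rw [← hpz, map_smul, smul_eq_mul]
    gcongr
    exact apply_le_clarkeDD_of_mem_limitingSubdiff hf hp z
  · rw [← hqz, ← smul_eq_mul, ← map_smul]
    exact apply_le_clarkeDD_of_mem_limitingSubdiff hf hq _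

lemma clarkeDD_le (hf : LipschitzWith L f) (x z : X) : clarkeDD f x z ≤ L * ‖z‖ := by
  obtain ⟨p, hp, hpz⟩ := exists_mem_limitingSubdiff_apply_eq hf x z
  rw [← hpz]
  exact (le_abs_self _).trans (p.le_of_opNorm_le (norm_le_of_mem_limitingSubdiff hf hp) z)

lemma supp_limitingSubdiff (hf : LipschitzWith L f) (x z : X) :
    supp z (limitingSubdiff f x) = clarkeDD f x z := by
  refine IsGreatest.csSup_eq ⟨exists_mem_limitingSubdiff_apply_eq hf x z, ?_⟩
  rintro _ ⟨p, hp, rfl⟩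
  exact apply_le_clarkeDD_of_mem_limitingSubdiff hf hp z

end ClarkeDerivative

section GelfandIntegral

variable {Ω : Type v} [MeasurableSpace Ω] {μ : Measure Ω}

lemma gelfandIntegral_mono {Γ Δ : Ω → Set (X →L[ℝ] ℝ)} (h : ∀ ω, Γ ω ⊆ Δ ω) :
    gelfandIntegral μ Γ ⊆ gelfandIntegral μ Δ := by
  rintro p ⟨f, ⟨hf, hfΓ⟩, hfp⟩
  exact ⟨f, ⟨hf, hfΓ.mono fun ω hω => h ω hω⟩, hfp⟩

lemma IsSublinearIntegrand.apply_le_of_mem_gelfandIntegral {s : Ω → X → ℝ} {l : Ω → ℝ}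
    (hs : IsSublinearIntegrand μ s l) {Γ : Ω → Set (X →L[ℝ] ℝ)}
    (hΓ : ∀ ω, ∀ p ∈ Γ ω, ∀ z, p z ≤ s ω z) {p : X →L[ℝ] ℝ} (hp : p ∈ gelfandIntegral μ Γ)
    (z : X) : p z ≤ ∫ ω, s ω z ∂μ := by
  obtain ⟨f, ⟨⟨hf, -⟩, hfΓ⟩, hfp⟩ := hp
  rw [hfp z]
  exact integral_mono_ae (hf z) (hs.integrable z) (hfΓ.mono fun ω hω => hΓ ω _ hω z)

/-- Over a saturated measure space, the Gelfand integral of a multifunction with closed values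
contains every functional dominated by the integral of the support functions. -/
lemma IsSublinearIntegrand.mem_gelfandIntegral [IsFiniteMeasure μ]
    [TopologicalSpace.SeparableSpace X] {s : Ω → X → ℝ} {l : Ω → ℝ}
    (hs : IsSublinearIntegrand μ s l) (hsat : Saturated μ) {Γ : Ω → Set (X →L[ℝ] ℝ)}
    (hle : ∀ ω, ∀ p ∈ Γ ω, ∀ z, p z ≤ s ω z) (hattain : ∀ ω z, ∃ p ∈ Γ ω, p z = s ω z)
    (hclosed : ∀ ω, ∀ p : X →L[ℝ] ℝ,
      (∀ (t : Finset X), ∀ ε > 0, ∃ q ∈ Γ ω, ∀ z ∈ t, |q z - p z| ≤ ε) → p ∈ Γ ω)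
    {p : X →L[ℝ] ℝ} (hp : ∀ z, p z ≤ ∫ ω, s ω z ∂μ) : p ∈ gelfandIntegral μ Γ := by
  obtain ⟨u, hum, hus, hui, hup, hext⟩ := exists_extreme_density hs hp
  refine ⟨u, ⟨⟨hui, p, fun z => (hup z).symm⟩, ?_⟩, fun z => (hup z).symm⟩
  filter_upwards [hus, ae_extreme_of_extreme_density hs hsat hum hus hext] with ω h1 h2
  exact mem_of_extreme_of_forall_apply_le (hs.le ω) (hle ω) (hattain ω) (hclosed ω) h1 h2

end GelfandIntegral

section Integrals

variable {Ω : Type v} [MeasurableSpace Ω] {μ : Measure Ω} {φ : X → Ω → ℝ} {x : X} {U : Set X}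
  {l : Ω → ℝ}

lemma eventually_mem_and_add_smul_mem (hU : U ∈ 𝓝 x) (z : X) :
    ∀ᶠ p : X × ℝ in 𝓝 x ×ˢ 𝓝[>] (0 : ℝ), p.1 ∈ U ∧ p.1 + p.2 • z ∈ U ∧ 0 < p.2 := by
  filter_upwards [tendsto_fst.eventually hU, tendsto_add_smul_nhds x z hU,
    tendsto_snd.eventually (self_mem_nhdsWithin (a := (0 : ℝ)) (s := Ioi 0))] with p h1 h2 h3
  exact ⟨h1, h2, h3⟩

lemma abs_quotient_le {f : X → ℝ} {c : ℝ} (hf : ∀ y ∈ U, ∀ y' ∈ U, |f y - f y'| ≤ c * ‖y - y'‖)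
    {y z : X} {θ : ℝ} (hy : y ∈ U) (hyz : y + θ • z ∈ U) (hθ : 0 < θ) :
    |(f (y + θ • z) - f y) / θ| ≤ c * ‖z‖ := by
  have h := hf _ hyz _ hy
  rw [add_sub_cancel_left, norm_smul, Real.norm_of_nonneg hθ.le] at h
  rw [abs_div, abs_of_pos hθ, div_le_iff₀ hθ]
  linarith

lemma integral_quotient (hint : ∀ y ∈ U, Integrable (fun ω => φ y ω) μ) {y z : X} {θ : ℝ}
    (hy : y ∈ U) (hyz : y + θ • z ∈ U) :
    ∫ ω, (φ (y + θ • z) ω - φ y ω) / θ ∂μ = (∫ ω, φ (y + θ • z) ω ∂μ - ∫ ω, φ y ω ∂μ) / θ := by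
  rw [integral_div, integral_sub (hint _ hyz) (hint _ hy)]

lemma abs_integral_sub_integral_le {X : Type*} [NormedAddCommGroup X] {φ : X → Ω → ℝ}
    {U : Set X} (hl : Integrable l μ)
    (hLip : ∀ ω, ∀ y ∈ U, ∀ y' ∈ U, |φ y ω - φ y' ω| ≤ l ω * ‖y - y'‖)
    (hint : ∀ y ∈ U, Integrable (fun ω => φ y ω) μ) :
    ∀ y ∈ U, ∀ y' ∈ U, |∫ ω, φ y ω ∂μ - ∫ ω, φ y' ω ∂μ| ≤ (∫ ω, l ω ∂μ) * ‖y - y'‖ := by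
  intro y hy y' hy'
  rw [← integral_sub (hint y hy) (hint y' hy'), ← integral_mul_const]
  exact norm_integral_le_of_norm_le (f := fun ω => φ y ω - φ y' ω) (hl.mul_const _)
    (ae_of_all _ fun ω => hLip ω y hy y' hy')

/-- The generalized directional derivative of an integral functional is at most the integral of
the generalized directional derivatives. -/
lemma clarkeDD_integral_le (hU : U ∈ 𝓝 x) (hl : Integrable l μ)
    (hLip : ∀ ω, ∀ y ∈ U, ∀ y' ∈ U, |φ y ω - φ y' ω| ≤ l ω * ‖y - y'‖)
    (hint : ∀ y ∈ U, Integrable (fun ω => φ y ω) μ) (z : X)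
    (hs : Integrable (fun ω => clarkeDD (fun y => φ y ω) x z) μ) :
    clarkeDD (fun y => ∫ ω, φ y ω ∂μ) x z ≤ ∫ ω, clarkeDD (fun y => φ y ω) x z ∂μ := by
  refine le_of_forall_pos_sub_le fun ε hε => ?_
  have hbelow : IsBoundedUnder (· ≥ ·) (𝓝 x ×ˢ 𝓝[>] (0 : ℝ)) fun p : X × ℝ =>
      (∫ ω, φ (p.1 + p.2 • z) ω ∂μ - ∫ ω, φ p.1 ω ∂μ) / p.2 := by
    refine isBoundedUnder_of_eventually_ge (a := -((∫ ω, l ω ∂μ) * ‖z‖)) ?_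
    filter_upwards [eventually_mem_and_add_smul_mem hU z] with p ⟨h1, h2, h3⟩
    exact (abs_le.1 (abs_quotient_le (abs_integral_sub_integral_le hl hLip hint) h1 h2 h3)).1
  obtain ⟨r, hr, hrU⟩ := exists_seq_forall_of_frequently
    ((frequently_lt_of_lt_limsup hbelow.isCoboundedUnder_le
      (sub_lt_self (clarkeDD (fun y => ∫ ω, φ y ω ∂μ) x z) hε)).and_eventually
      (eventually_mem_and_add_smul_mem hU z))
  let q : ℕ → Ω → ℝ := fun n ω => (φ ((r n).1 + (r n).2 • z) ω - φ (r n).1 ω) / (r n).2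
  have hqi : ∀ n, Integrable (q n) μ := fun n =>
    ((hint _ (hrU n).2.2.1).sub (hint _ (hrU n).2.1)).div_const _
  have hqb : ∀ n ω, |q n ω| ≤ l ω * ‖z‖ := fun n ω =>
    abs_quotient_le (hLip ω) (hrU n).2.1 (hrU n).2.2.1 (hrU n).2.2.2
  let s : Ω → ℝ := fun ω => clarkeDD (fun y => φ y ω) x z
  have hlim : ∀ ω, Tendsto (fun n => max (q n ω) (s ω)) atTop (𝓝 (s ω)) := by
    intro ω
    refine tendsto_order.2
      ⟨fun a ha => Eventually.of_forall fun n => ha.trans_le (le_max_right _ _), fun a ha => ?_⟩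
    have hbd : IsBoundedUnder (· ≤ ·) (𝓝 x ×ˢ 𝓝[>] (0 : ℝ)) fun p : X × ℝ =>
        (φ (p.1 + p.2 • z) ω - φ p.1 ω) / p.2 := by
      refine isBoundedUnder_of_eventually_le (a := l ω * ‖z‖) ?_
      filter_upwards [eventually_mem_and_add_smul_mem hU z] with p ⟨h1, h2, h3⟩
      exact (abs_le.1 (abs_quotient_le (hLip ω) h1 h2 h3)).2
    filter_upwards [hr.eventually (eventually_lt_of_limsup_lt ha hbd)] with n hn
    exact max_lt hn ha
  have hconv : Tendsto (fun n => ∫ ω, max (q n ω) (s ω) ∂μ) atTop (𝓝 (∫ ω, s ω ∂μ)) := by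
    refine tendsto_integral_of_dominated_convergence (fun ω => l ω * ‖z‖ + |s ω|)
      (fun n => ((hqi n).sup hs).aestronglyMeasurable) ((hl.mul_const _).add hs.abs)
      (fun n => ae_of_all _ fun ω => ?_) (ae_of_all _ hlim)
    rw [Real.norm_eq_abs]
    refine abs_max_le_max_abs_abs.trans (max_le ?_ ?_)
    · linarith [hqb n ω, abs_nonneg (s ω)]
    · linarith [hqb n ω, abs_nonneg (q n ω)]
  refine ge_of_tendsto' hconv fun n => ?_
  refine (hrU n).1.le.trans ?_
  rw [← integral_quotient hint (hrU n).2.1 (hrU n).2.2.1]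
  exact integral_mono (hqi n) ((hqi n).sup hs) fun ω => le_max_left _ _

/-- An integral functional is directionally differentiable when the integrands are regular. -/
lemma tendsto_integral_quotient_of_regular (hU : U ∈ 𝓝 x) (hl : Integrable l μ)
    (hLip : ∀ ω, ∀ y ∈ U, ∀ y' ∈ U, |φ y ω - φ y' ω| ≤ l ω * ‖y - y'‖)
    (hint : ∀ y ∈ U, Integrable (fun ω => φ y ω) μ)
    (hreg : ∀ ω, ClarkeRegularAt (fun y => φ y ω) x) (z : X) :
    Tendsto (fun θ : ℝ => (∫ ω, φ (x + θ • z) ω ∂μ - ∫ ω, φ x ω ∂μ) / θ) (𝓝[>] (0 : ℝ))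
      (𝓝 (∫ ω, clarkeDD (fun y => φ y ω) x z ∂μ)) := by
  have hxU : ∀ᶠ θ in 𝓝[>] (0 : ℝ), x + θ • z ∈ U ∧ 0 < θ := by
    have h1 : Tendsto (fun θ : ℝ => x + θ • z) (𝓝 0) (𝓝 x) := by
      have : Continuous fun θ : ℝ => x + θ • z := by fun_prop
      simpa using this.tendsto 0
    filter_upwards [nhdsWithin_le_nhds (h1 hU), self_mem_nhdsWithin] with θ h2 h3
    exact ⟨h2, h3⟩
  have hx : x ∈ U := mem_of_mem_nhds hU
  have h := tendsto_integral_filter_of_dominated_convergence (μ := μ) (l := 𝓝[>] (0 : ℝ))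
    (F := fun θ ω => (φ (x + θ • z) ω - φ x ω) / θ) (fun ω => l ω * ‖z‖)
    (hxU.mono fun θ hθ => (((hint _ hθ.1).sub (hint _ hx)).div_const _).aestronglyMeasurable)
    (hxU.mono fun θ hθ => ae_of_all _ fun ω => abs_quotient_le (hLip ω) hx hθ.1 hθ.2)
    (hl.mul_const _) (ae_of_all _ fun ω => hreg ω z)
  refine h.congr' ?_
  filter_upwards [hxU] with θ hθ
  exact integral_quotient hint hx hθ.1

end Integrals

end LeibnizRule

/-- unconvexified Leibniz rule over a complete saturated finite measure
space with `X` separable Asplund: `∂I_φ(x̄) ⊆ ∫ ∂φ(x̄,ω) dμ = ∫ ∂°φ(x̄,ω) dμ` without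
closure, with equality of the inclusion under regularity. -/
theorem unconvexified_leibniz_rule
    {X : Type u} [NormedAddCommGroup X] [NormedSpace ℝ X] [CompleteSpace X]
    [TopologicalSpace.SeparableSpace X]
    (hX : Asplund X)
    {Ω : Type v} [MeasurableSpace Ω] (μ : Measure Ω)
    (hcomp : μ.IsComplete) [IsFiniteMeasure μ]
    (hsat : Saturated μ)
    (φ : X → Ω → ℝ) (xbar : X) (U : Set X) (hU : U ∈ 𝓝 xbar)
    (l : Ω → ℝ) (hl : Integrable l μ)
    (hLip : ∀ ω, ∀ x ∈ U, ∀ x' ∈ U, |φ x ω - φ x' ω| ≤ l ω * ‖x - x'‖)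
    (hmeas : ∀ x ∈ U, Measurable fun ω => φ x ω)
    (hint : ∀ x ∈ U, Integrable (fun ω => φ x ω) μ)
    (hscal : ∀ z : X, Measurable fun ω => supp z (limitingSubdiff (fun x => φ x ω) xbar)) :
    limitingSubdiff (fun x => ∫ ω, φ x ω ∂μ) xbar ⊆
      gelfandIntegral μ (fun ω => limitingSubdiff (fun x => φ x ω) xbar) ∧
    gelfandIntegral μ (fun ω => limitingSubdiff (fun x => φ x ω) xbar) =
      gelfandIntegral μ (fun ω => clarkeSubdiff (fun x => φ x ω) xbar) ∧
    ((∀ ω, ClarkeRegularAt (fun x => φ x ω) xbar) →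
      limitingSubdiff (fun x => ∫ ω, φ x ω ∂μ) xbar =
        gelfandIntegral μ (fun ω => limitingSubdiff (fun x => φ x ω) xbar)) := by
  have hdual := separableSpace_dual_of_asplund hX
  choose ψ hψ hφψ using fun ω => exists_lipschitzWith_eventuallyEq hU (hLip ω)
  have hlim : ∀ ω, limitingSubdiff (fun x => φ x ω) xbar = limitingSubdiff (ψ ω) xbar :=
    fun ω => limitingSubdiff_congr (hφψ ω)
  have hDD : ∀ ω z, clarkeDD (fun x => φ x ω) xbar z = clarkeDD (ψ ω) xbar z :=
    fun ω => clarkeDD_congr (hφψ ω)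
  have hs : IsSublinearIntegrand μ (fun ω z => clarkeDD (fun x => φ x ω) xbar z)
      fun ω => |l ω| := by
    refine ⟨hl.abs, fun ω => abs_nonneg _, fun z => ?_, fun ω y z => ?_, fun ω c hc z => ?_,
      fun ω z => ?_⟩
    · convert hscal z using 2 with ω
      rw [hlim, hDD, supp_limitingSubdiff (hψ ω)]
    · simp only [hDD]
      exact clarkeDD_add_le (hψ ω) xbar y z
    · simp only [hDD]
      exact clarkeDD_smul (hψ ω) xbar hc z
    · simp only [hDD]
      exact clarkeDD_le (hψ ω) xbar z
  have hle : ∀ ω, ∀ p ∈ limitingSubdiff (fun x => φ x ω) xbar, ∀ z,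
      p z ≤ clarkeDD (fun x => φ x ω) xbar z := fun ω p hp z => by
    rw [hlim] at hp
    rw [hDD]
    exact apply_le_clarkeDD_of_mem_limitingSubdiff (hψ ω) hp z
  have hmem : ∀ p : X →L[ℝ] ℝ, (∀ z, p z ≤ ∫ ω, clarkeDD (fun x => φ x ω) xbar z ∂μ) →
      p ∈ gelfandIntegral μ fun ω => limitingSubdiff (fun x => φ x ω) xbar := by
    refine fun p hp => hs.mem_gelfandIntegral hsat hle (fun ω z => ?_) (fun ω q hq => ?_) hp
    · rw [hlim, hDD]
      exact exists_mem_limitingSubdiff_apply_eq (hψ ω) xbar z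
    · rw [hlim] at hq ⊢
      exact mem_limitingSubdiff_of_approx (hψ ω) hq
  obtain ⟨g, hg, hIg⟩ := exists_lipschitzWith_eventuallyEq hU
    (abs_integral_sub_integral_le hl hLip hint)
  have hsub : limitingSubdiff (fun x => ∫ ω, φ x ω ∂μ) xbar ⊆
      gelfandIntegral μ (fun ω => limitingSubdiff (fun x => φ x ω) xbar) := by
    refine fun p hp => hmem p fun z => ?_
    rw [limitingSubdiff_congr hIg] at hp
    refine (apply_le_clarkeDD_of_mem_limitingSubdiff hg hp z).trans ?_
    rw [← clarkeDD_congr hIg]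
    exact clarkeDD_integral_le hU hl hLip hint z (hs.integrable z)
  refine ⟨hsub, (gelfandIntegral_mono hle).antisymm fun p hp => hmem p ?_, fun hreg =>
    hsub.antisymm fun p hp => ?_⟩
  · exact hs.apply_le_of_mem_gelfandIntegral (fun ω q hq => hq) hp
  · rw [limitingSubdiff_congr hIg]
    refine mem_limitingSubdiff_of_le_dini hg fun z ε hε => ?_
    have h1 := hs.apply_le_of_mem_gelfandIntegral hle hp z
    have h2 := tendsto_integral_quotient_of_regular hU hl hLip hint hreg z
    have h3 : Tendsto (fun θ : ℝ => xbar + θ • z) (𝓝[>] (0 : ℝ)) (𝓝 xbar) := by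
      have : Continuous fun θ : ℝ => xbar + θ • z := by fun_prop
      simpa using (this.tendsto 0).mono_left nhdsWithin_le_nhds
    filter_upwards [h2.eventually_const_le (sub_lt_self _ hε), h3.eventually hIg] with θ h4 h5
    rw [← h5, ← hIg.self_of_nhds]
    linarith

end Paper
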